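/- Let k be an algebraically closed field and let S = V(f) ⊆ P³ be a smooth surface of degree d > 3 containing exactly d²(d²−3d+3) lines. Then after an invertible linear change of coordinates and rescaling, f equals x^{d−1}w + xw^{d−1} + y^{d−1}z + yz^{d−1}: there exist A ∈ GL₄(k) and a nonzero scalar c such that c·f(A·v) = v₀^{d−1}v₃ + v₀v₃^{d−1} + v₁^{d−1}v₂ + v₁v₂^{d−1} for all v ∈ k⁴. -/

import Mathlib

open MvPolynomial

/-- `W` is a line (2-dimensional linear subspace of `k⁴`) lying on the surface `V(f) ⊆ P³`. -/
def IsLineOn {k : Type*} [Field k] (f : MvPolynomial (Fin 4) k)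
    (W : Submodule k (Fin 4 → k)) : Prop :=
  Module.finrank k W = 2 ∧ ∀ v ∈ W, MvPolynomial.eval v f = 0

/-- `f` is a nonzero homogeneous polynomial of degree `d` in `k[x,y,z,w]` such that `f` and its
four partial derivatives have no common zero in `k⁴ ∖ {0}`; i.e. `V(f) ⊆ P³` is a smooth
surface of degree `d`. -/
def IsSmoothSurface {k : Type*} [Field k] (f : MvPolynomial (Fin 4) k) (d : ℕ) : Prop :=
  f ≠ 0 ∧ f.IsHomogeneous d ∧
    ∀ v : Fin 4 → k, v ≠ 0 →
      ¬ (MvPolynomial.eval v f = 0 ∧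
         ∀ i : Fin 4, MvPolynomial.eval v (MvPolynomial.pderiv i f) = 0)

section LinePolynomial

variable {σ k A B : Type*} [CommRing k] [CommRing A] [CommRing B] [Algebra k A] [Algebra k B]

/-- The restriction of `f` to the parametrized line `t ↦ p + t u`. -/
noncomputable def linePoly (f : MvPolynomial σ k) (p u : σ → A) : Polynomial A :=
  aeval (fun i => Polynomial.C (p i) + Polynomial.C (u i) * Polynomial.X) f

lemma linePoly_map (f : MvPolynomial σ k) (p u : σ → A) (φ : A →ₐ[k] B) :
    (linePoly f p u).map (φ : A →+* B) = linePoly f (fun i => φ (p i)) (fun i => φ (u i)) := by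
  have h := MvPolynomial.comp_aeval_apply
    (fun i => Polynomial.C (p i) + Polynomial.C (u i) * Polynomial.X) (Polynomial.mapAlgHom φ) f
  simpa [linePoly, Polynomial.coe_mapAlgHom] using h

lemma linePoly_eval (f : MvPolynomial σ k) (p u : σ → A) (x : A) :
    (linePoly f p u).eval x = aeval (fun i => p i + u i * x) f := by
  have h := MvPolynomial.comp_aeval_apply
    (fun i => Polynomial.C (p i) + Polynomial.C (u i) * Polynomial.X)
    ((Polynomial.aeval x).restrictScalars k) f
  simpa [linePoly, Polynomial.coe_aeval_eq_eval] using h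

lemma linePoly_coeff_zero (f : MvPolynomial σ k) (p u : σ → A) :
    (linePoly f p u).coeff 0 = aeval p f := by
  rw [Polynomial.coeff_zero_eq_eval_zero, linePoly_eval]
  simp

lemma linePoly_coeff_one [Fintype σ] (f : MvPolynomial σ k) (p u : σ → A) :
    (linePoly f p u).coeff 1 = ∑ i, u i * aeval p (pderiv i f) := by
  classical
  induction f using MvPolynomial.induction_on with
  | C a =>
    simp [linePoly, Polynomial.algebraMap_apply]
  | add f g hf hg =>
    have : linePoly (f + g) p u = linePoly f p u + linePoly g p u := by simp [linePoly]
    simp [this, hf, hg, mul_add, Finset.sum_add_distrib]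
  | mul_X f i hf =>
    have : linePoly (f * X i) p u =
        linePoly f p u * (Polynomial.C (p i) + Polynomial.C (u i) * Polynomial.X) := by
      simp [linePoly]
    rw [this, Polynomial.mul_coeff_one, hf, linePoly_coeff_zero]
    have hs : ∑ x, u x * (aeval p f * aeval p ((Pi.single x 1 : σ → MvPolynomial σ k) i)) =
        u i * aeval p f := by
      rw [Finset.sum_eq_single i]
      · simp
      · intro j _ hj
        simp [Pi.single_eq_of_ne hj.symm]
      · simp
    have hC : (Polynomial.C (p i)).coeff 1 = 0 := by simp
    simp only [Polynomial.coeff_add, Polynomial.coeff_C_zero, Polynomial.coeff_C_mul,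
      Polynomial.coeff_X_zero, Polynomial.coeff_X_one, Derivation.leibniz, map_add, smul_eq_mul,
      map_mul, aeval_X, pderiv_X, mul_add, Finset.sum_add_distrib, hs, hC, mul_one, mul_zero,
      add_zero, zero_add, Finset.sum_mul]
    rw [mul_comm]
    congr 1
    exact Finset.sum_congr rfl fun _ _ => by ring

/-- A binary form of degree `d` is the sum of its terms. -/
lemma eq_sum_of_isHomogeneous_fin_two {Q : MvPolynomial (Fin 2) A} {d : ℕ}
    (hQ : Q.IsHomogeneous d) :
    Q = ∑ j ∈ Finset.range (d + 1),
      C (Q.coeff (Finsupp.single 0 (d - j) + Finsupp.single 1 j)) * X 0 ^ (d - j) * X 1 ^ j := by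
  classical
  have hmon : ∀ (a b : ℕ) (c : A), C c * X 0 ^ a * X 1 ^ b =
      monomial (Finsupp.single (0 : Fin 2) a + Finsupp.single 1 b) c := fun a b c => by
    simp [monomial_fin_two]
  simp only [hmon]
  ext s
  rw [coeff_sum]
  simp only [coeff_monomial]
  by_cases hs : Q.coeff s = 0
  · rw [hs, Finset.sum_eq_zero]
    intro j _
    split_ifs with h
    · rw [h, hs]
    · rfl
  · have hdeg : s 0 + s 1 = d := by
      have := hQ hs
      simpa [Finsupp.weight_apply, Finsupp.sum_fintype] using this
    have hs' : Finsupp.single 0 (d - s 1) + Finsupp.single 1 (s 1) = s := by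
      ext i
      fin_cases i
      · simp [← hdeg]
      · simp
    rw [Finset.sum_eq_single (s 1)]
    · rw [hs', if_pos rfl]
    · intro j _ hj
      rw [if_neg]
      rintro rfl
      simp at hj
    · intro h
      simp at h
      omega

variable {f : MvPolynomial σ k} {d : ℕ}

/-- The binary form obtained by restricting `f` to the plane spanned by `p` and `u`. -/
noncomputable def planeForm (f : MvPolynomial σ k) (p u : σ → A) : MvPolynomial (Fin 2) A :=
  aeval (fun i => C (p i) * X 0 + C (u i) * X 1) f

lemma planeForm_isHomogeneous (hf : f.IsHomogeneous d) (p u : σ → A) :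
    (planeForm f p u).IsHomogeneous d := by
  have := hf.aeval (fun i => C (p i) * X 0 + C (u i) * X 1 : σ → MvPolynomial (Fin 2) A) (n := 1)
    (fun i => ((isHomogeneous_C_mul_X _ _).add (isHomogeneous_C_mul_X _ _)))
  simpa [planeForm] using this

lemma aeval_planeForm [Algebra A B] [IsScalarTower k A B] (f : MvPolynomial σ k) (p u : σ → A)
    (x : Fin 2 → B) :
    aeval x (planeForm f p u) =
      aeval (fun i => algebraMap A B (p i) * x 0 + algebraMap A B (u i) * x 1) f := by
  have h := MvPolynomial.comp_aeval_apply
    (fun i => C (p i) * X 0 + C (u i) * X 1 : σ → MvPolynomial (Fin 2) A)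
    ((MvPolynomial.aeval x : MvPolynomial (Fin 2) A →ₐ[A] B).restrictScalars k) f
  simpa [planeForm] using h

lemma linePoly_eq_sum (hf : f.IsHomogeneous d) (p u : σ → A) :
    linePoly f p u = ∑ j ∈ Finset.range (d + 1),
      Polynomial.C ((planeForm f p u).coeff (Finsupp.single 0 (d - j) + Finsupp.single 1 j)) *
        Polynomial.X ^ j := by
  have h := aeval_planeForm (B := Polynomial A) f p u ![1, Polynomial.X]
  rw [eq_sum_of_isHomogeneous_fin_two (planeForm_isHomogeneous hf p u)] at h
  simp only [map_sum, map_mul, map_pow, aeval_X, Matrix.cons_val_zero, Matrix.cons_val_one,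
    one_pow, mul_one, algHom_C] at h
  rw [linePoly]
  exact h.symm

lemma linePoly_coeff (hf : f.IsHomogeneous d) (p u : σ → A) {j : ℕ} (hj : j ≤ d) :
    (linePoly f p u).coeff j =
      (planeForm f p u).coeff (Finsupp.single 0 (d - j) + Finsupp.single 1 j) := by
  rw [linePoly_eq_sum hf, Polynomial.finsetSum_coeff]
  simp only [Polynomial.coeff_C_mul, Polynomial.coeff_X_pow]
  rw [Finset.sum_eq_single j]
  · simp
  · intro i _ hi
    simp [hi.symm]
  · intro h
    simp at h
    omega

lemma linePoly_natDegree_le (hf : f.IsHomogeneous d) (p u : σ → A) :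
    (linePoly f p u).natDegree ≤ d := by
  rw [linePoly_eq_sum hf]
  refine Polynomial.natDegree_sum_le_of_forall_le _ _ fun j hj => ?_
  exact (Polynomial.natDegree_C_mul_X_pow_le _ _).trans (by simpa [Nat.lt_succ_iff] using hj)

lemma aeval_comb (hf : f.IsHomogeneous d) (p u : σ → A) (α β : A) :
    aeval (fun i => p i * α + u i * β) f =
      ∑ j ∈ Finset.range (d + 1), (linePoly f p u).coeff j * α ^ (d - j) * β ^ j := by
  have h := aeval_planeForm (B := A) f p u ![α, β]
  rw [eq_sum_of_isHomogeneous_fin_two (planeForm_isHomogeneous hf p u)] at h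
  simp only [map_sum, map_mul, map_pow, aeval_X, Matrix.cons_val_zero, Matrix.cons_val_one,
    algHom_C, Algebra.algebraMap_self, RingHom.id_apply] at h
  rw [← h]
  refine Finset.sum_congr rfl fun j hj => ?_
  rw [linePoly_coeff hf _ _ (by simpa [Nat.lt_succ_iff] using hj)]

lemma linePoly_coeff_top (hf : f.IsHomogeneous d) (p u : σ → A) :
    (linePoly f p u).coeff d = aeval u f := by
  have h := aeval_comb hf p u 0 1
  simp only [mul_zero, zero_add, mul_one, one_pow] at h
  rw [h, Finset.sum_eq_single d]
  · simp
  · intro j hj hjd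
    have : d - j ≠ 0 := by simp at hj; omega
    simp [this]
  · simp

lemma linePoly_C_comb (hf : f.IsHomogeneous d) (p u : σ → A) (α β : Polynomial A) :
    aeval (fun i => Polynomial.C (p i) * α + Polynomial.C (u i) * β) f =
      ∑ j ∈ Finset.range (d + 1),
        Polynomial.C ((linePoly f p u).coeff j) * α ^ (d - j) * β ^ j := by
  rw [aeval_comb hf]
  have h := linePoly_map f p u (Algebra.ofId A (Polynomial A) |>.restrictScalars k)
  have h2 : ∀ j, (linePoly f (fun i => Polynomial.C (p i)) (fun i => Polynomial.C (u i))).coeff j =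
      Polynomial.C ((linePoly f p u).coeff j) := by
    intro j
    have h3 := congrArg (fun q => q.coeff j) h
    rw [Polynomial.coeff_map] at h3
    exact h3.symm
  simp only [h2]

lemma linePoly_coeff_smul (hf : f.IsHomogeneous d) (p u : σ → A) (α β : A) {j : ℕ} (hj : j ≤ d) :
    (linePoly f (fun i => p i * α) (fun i => u i * β)).coeff j =
      (linePoly f p u).coeff j * α ^ (d - j) * β ^ j := by
  have h := linePoly_C_comb hf p u (Polynomial.C α) (Polynomial.C β * Polynomial.X)
  have h2 : linePoly f (fun i => p i * α) (fun i => u i * β) = aeval (fun i =>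
      Polynomial.C (p i) * Polynomial.C α + Polynomial.C (u i) * (Polynomial.C β * Polynomial.X)) f
      := by
    simp [linePoly, mul_assoc]
  rw [h2, h, Polynomial.finsetSum_coeff, Finset.sum_eq_single j]
  · rw [mul_pow, ← mul_assoc, ← Polynomial.C_pow, ← Polynomial.C_pow, ← Polynomial.C_mul,
      ← Polynomial.C_mul, Polynomial.coeff_C_mul_X_pow, if_pos rfl]
  · intro i _ hi
    rw [mul_pow, ← mul_assoc, ← Polynomial.C_pow, ← Polynomial.C_pow, ← Polynomial.C_mul,
      ← Polynomial.C_mul, Polynomial.coeff_C_mul_X_pow, if_neg hi.symm]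
  · intro h
    simp at h
    omega

lemma linePoly_coeff_swap (hf : f.IsHomogeneous d) (p u : σ → A) {j : ℕ} (hj : j ≤ d) :
    (linePoly f u p).coeff j = (linePoly f p u).coeff (d - j) := by
  have h := linePoly_C_comb hf p u Polynomial.X 1
  have h2 : linePoly f u p = aeval (fun i =>
      Polynomial.C (p i) * Polynomial.X + Polynomial.C (u i) * 1) f := by
    simp [linePoly, add_comm]
  rw [h2, h, Polynomial.finsetSum_coeff, Finset.sum_eq_single (d - j)]
  · rw [one_pow, mul_one, Polynomial.coeff_C_mul_X_pow, if_pos (by omega)]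
  · intro i hi hij
    rw [one_pow, mul_one, Polynomial.coeff_C_mul_X_pow, if_neg]
    simp at hi
    omega
  · intro h
    simp at h

end LinePolynomial

section Irreducibility

variable {σ k : Type*} [Field k]

lemma exists_basis_of_finrank_eq_two {V : Type*} [AddCommGroup V] [Module k V] {W : Submodule k V}
    (hW : Module.finrank k W = 2) :
    ∃ p ∈ W, ∃ u ∈ W, (∀ α β : k, α • p + β • u = 0 → α = 0 ∧ β = 0) ∧
      ∀ v ∈ W, ∃ α β : k, v = α • p + β • u := by
  have : Module.Finite k W := Module.finite_of_finrank_pos (by omega)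
  let b := Module.finBasisOfFinrankEq k W hW
  refine ⟨b 0, (b 0).2, b 1, (b 1).2, ?_, ?_⟩
  · intro α β h
    have h1 : α • b 0 + β • b 1 = 0 := by
      apply Subtype.ext
      simpa using h
    have h2 := Fintype.linearIndependent_iff.1 b.linearIndependent ![α, β]
      (by simpa [Fin.sum_univ_two] using h1)
    exact ⟨h2 0, h2 1⟩
  · intro v hv
    have h := b.sum_repr ⟨v, hv⟩
    rw [Fin.sum_univ_two] at h
    exact ⟨_, _, by simpa using (congrArg Subtype.val h).symm⟩

lemma homogeneousComponent_totalDegree_sub {p : MvPolynomial σ k} (hp : 0 < p.totalDegree) :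
    (p - homogeneousComponent p.totalDegree p).totalDegree < p.totalDegree := by
  have h := sum_homogeneousComponent p
  rw [Finset.sum_range_succ] at h
  have h2 : p - homogeneousComponent p.totalDegree p =
      ∑ i ∈ Finset.range p.totalDegree, homogeneousComponent i p := by
    rw [eq_comm, eq_sub_iff_add_eq]; exact h
  rw [h2]
  refine lt_of_le_of_lt (totalDegree_finsetSum _ _) ?_
  rw [Finset.sup_lt_iff hp]
  intro i hi
  exact lt_of_le_of_lt (homogeneousComponent_isHomogeneous i p).totalDegree_le
    (Finset.mem_range.1 hi)

/-- A homogeneous product is the product of the leading forms of its factors. -/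
lemma eq_mul_homogeneousComponent {f p q : MvPolynomial σ k} {d : ℕ} (hf : f.IsHomogeneous d)
    (hf0 : f ≠ 0) (h : f = p * q) (hp : 0 < p.totalDegree) (hq : 0 < q.totalDegree) :
    f = homogeneousComponent p.totalDegree p * homogeneousComponent q.totalDegree q := by
  have hp0 : p ≠ 0 := by rintro rfl; simp at hp
  have hq0 : q ≠ 0 := by rintro rfl; simp at hq
  set P := homogeneousComponent p.totalDegree p with hP
  set Q := homogeneousComponent q.totalDegree q with hQ
  have hPd := homogeneousComponent_isHomogeneous p.totalDegree p
  have hQd := homogeneousComponent_isHomogeneous q.totalDegree q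
  have hd : d = p.totalDegree + q.totalDegree := by
    rw [← totalDegree_mul_of_isDomain hp0 hq0, ← h, hf.totalDegree hf0]
  have hr : (f - P * Q).totalDegree < d := by
    have : f - P * Q = (p - P) * q + P * (q - Q) := by rw [h]; ring
    rw [this]
    refine lt_of_le_of_lt (totalDegree_add _ _) (max_lt ?_ ?_)
    · have h1 := totalDegree_mul (p - P) q
      have h2 := homogeneousComponent_totalDegree_sub hp
      rw [← hP] at h2
      omega
    · have h1 := totalDegree_mul P (q - Q)
      have h2 := homogeneousComponent_totalDegree_sub hq
      have h3 : P.totalDegree ≤ p.totalDegree := hPd.totalDegree_le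
      rw [← hQ] at h2
      omega
  have hh : (f - P * Q).IsHomogeneous d := hf.sub (hd ▸ hPd.mul hQd)
  have := homogeneousComponent_eq_zero _ _ hr
  rw [homogeneousComponent_eq_self hh] at this
  exact sub_eq_zero.1 this

variable [IsAlgClosed k]

lemma exists_zero_of_linePoly {F : MvPolynomial σ k} {d : ℕ} (hF : F.IsHomogeneous d) (hd : 0 < d)
    (p u : σ → k) :
    ∃ α β : k, (α ≠ 0 ∨ β ≠ 0) ∧ eval (α • p + β • u) F = 0 := by
  by_cases hu : eval u F = 0
  · exact ⟨0, 1, by simp, by simpa using hu⟩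
  have hc : (linePoly F p u).coeff d ≠ 0 := by
    rw [linePoly_coeff_top hF]
    exact hu
  have hdeg : (linePoly F p u).natDegree = d :=
    le_antisymm (linePoly_natDegree_le hF p u) (Polynomial.le_natDegree_of_ne_zero hc)
  obtain ⟨x, hx⟩ := IsAlgClosed.exists_root (linePoly F p u) (by
    intro h
    have h0 : (linePoly F p u).natDegree = 0 := Polynomial.natDegree_eq_of_degree_eq_some h
    omega)
  refine ⟨1, x, by simp, ?_⟩
  rw [Polynomial.IsRoot, linePoly_eval] at hx
  rw [← hx]
  change _ = eval _ F
  congr 2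
  ext i
  simp [mul_comm]

lemma planeForm_eq_zero_iff (F : MvPolynomial σ k) (p u : σ → k) :
    planeForm F p u = 0 ↔ ∀ α β : k, eval (α • p + β • u) F = 0 := by
  have key : ∀ x : Fin 2 → k, eval x (planeForm F p u) = eval (x 0 • p + x 1 • u) F := by
    intro x
    have := aeval_planeForm (B := k) F p u x
    change eval x _ = eval _ F at this
    rw [this]
    congr 2
    ext i
    simp [mul_comm]
  constructor
  · intro h α β
    simpa [h] using (key ![α, β]).symm
  · intro h
    have : Infinite k := IsAlgClosed.instInfinite
    exact MvPolynomial.funext fun x => by rw [key, h]; simp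

omit [IsAlgClosed k] in
lemma IsSmoothSurface.pos_degree {f : MvPolynomial (Fin 4) k} {d : ℕ} (hf : IsSmoothSurface f d)
    {W : Submodule k (Fin 4 → k)} (hW : IsLineOn f W) : 0 < d := by
  rcases Nat.eq_zero_or_pos d with rfl | h
  · have h0 := hW.2 0 (zero_mem _)
    have h1 := totalDegree_eq_zero_iff_eq_C.1 (hf.2.1.totalDegree hf.1)
    rw [h1, eval_C] at h0
    rw [h0, C_0] at h1
    exact absurd h1 hf.1
  · exact h

/-- A smooth surface containing a line is irreducible. -/
lemma IsSmoothSurface.irreducible {f : MvPolynomial (Fin 4) k} {d : ℕ} (hf : IsSmoothSurface f d)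
    {W : Submodule k (Fin 4 → k)} (hW : IsLineOn f W) : Irreducible f := by
  have hd := hf.pos_degree hW
  have hdeg := hf.2.1.totalDegree hf.1
  have hunit : ∀ p : MvPolynomial (Fin 4) k, p ≠ 0 → ¬ IsUnit p → 0 < p.totalDegree := by
    intro p hp hu
    by_contra h0
    have h1 := totalDegree_eq_zero_iff_eq_C.1 (Nat.eq_zero_of_not_pos h0)
    rw [h1] at hu hp
    refine hu (IsUnit.map C (isUnit_iff_ne_zero.2 fun h => hp ?_))
    rw [h, C_0]
  have main : ∀ (P Q : MvPolynomial (Fin 4) k) (m : ℕ), f = P * Q → 0 < m → Q.IsHomogeneous m →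
      ∀ p ∈ W, ∀ u ∈ W, (∀ α β : k, α • p + β • u = 0 → α = 0 ∧ β = 0) →
      planeForm P p u ≠ 0 := by
    intro P Q m hPQ hm hQ p hp u hu hind h0
    obtain ⟨α, β, hαβ, hz⟩ := exists_zero_of_linePoly hQ hm p u
    have hP := (planeForm_eq_zero_iff P p u).1 h0 α β
    refine hf.2.2 (α • p + β • u) ?_ ⟨?_, ?_⟩
    · intro h
      have := hind _ _ h
      simp [this] at hαβ
    · rw [hPQ, map_mul, hP, zero_mul]
    · intro i
      rw [hPQ, pderiv_mul, map_add, map_mul, map_mul, hP, hz, zero_mul, mul_zero, add_zero]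
  refine ⟨fun hu => ?_, fun p q hpq => ?_⟩
  · have : f.totalDegree = 0 := by
      obtain ⟨g, hg⟩ := hu.exists_right_inv
      have hg0 : g ≠ 0 := by rintro rfl; simp at hg
      have := totalDegree_mul_of_isDomain hf.1 hg0
      rw [hg, totalDegree_one] at this
      omega
    omega
  by_contra! hcon
  have hp0 : p ≠ 0 := by rintro rfl; exact hf.1 (by simpa using hpq)
  have hq0 : q ≠ 0 := by rintro rfl; exact hf.1 (by simpa using hpq)
  have hp1 := hunit p hp0 hcon.1
  have hq1 := hunit q hq0 hcon.2
  have hfac := eq_mul_homogeneousComponent hf.2.1 hf.1 hpq hp1 hq1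
  obtain ⟨a, ha, b, hb, hind, -⟩ := exists_basis_of_finrank_eq_two hW.1
  have hzero : planeForm f a b = 0 := by
    rw [planeForm_eq_zero_iff]
    intro α β
    exact hW.2 _ (W.add_mem (W.smul_mem _ ha) (W.smul_mem _ hb))
  have hprod : planeForm f a b = planeForm (homogeneousComponent p.totalDegree p) a b *
      planeForm (homogeneousComponent q.totalDegree q) a b := by
    conv_lhs => rw [hfac]
    simp [planeForm]
  rw [hprod] at hzero
  rcases mul_eq_zero.1 hzero with h | h
  · exact main _ _ _ hfac hq1 (homogeneousComponent_isHomogeneous _ _) a ha b hb hind h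
  · exact main _ _ _ (hfac.trans (mul_comm _ _)) hp1 (homogeneousComponent_isHomogeneous _ _)
      a ha b hb hind h

end Irreducibility

section Generic

variable {σ k : Type*} [Fintype σ] [Field k] [Infinite k]

/-- A nonzero polynomial and finitely many nonzero linear forms have a common non-zero. -/
lemma exists_eval_ne_zero_and {ι : Type*} {p : MvPolynomial σ k} (hp : p ≠ 0) (s : Finset ι)
    (φ : ι → Module.Dual k (σ → k)) (hφ : ∀ i ∈ s, φ i ≠ 0) :
    ∃ v : σ → k, eval v p ≠ 0 ∧ ∀ i ∈ s, φ i v ≠ 0 := by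
  classical
  let L : ι → MvPolynomial σ k := fun i => ∑ j, C (φ i (Pi.single j 1)) * X j
  have hL : ∀ i v, eval v (L i) = φ i v := by
    intro i v
    conv_rhs => rw [← Finset.univ_sum_single v]
    simp only [L, map_sum, map_mul, eval_C, eval_X]
    refine Finset.sum_congr rfl fun j _ => ?_
    have : (Pi.single j (v j) : σ → k) = v j • Pi.single j 1 := by
      rw [← Pi.single_smul]; simp
    rw [this, map_smul, smul_eq_mul, mul_comm]
  have hne : p * ∏ i ∈ s, L i ≠ 0 := by
    refine mul_ne_zero hp (Finset.prod_ne_zero_iff.2 fun i hi h => hφ i hi ?_)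
    refine LinearMap.ext fun v => ?_
    rw [← hL, h]
    simp
  obtain ⟨v, hv⟩ : ∃ v, eval v (p * ∏ i ∈ s, L i) ≠ 0 := by
    by_contra! h
    exact hne (MvPolynomial.funext fun x => by rw [h]; simp)
  rw [map_mul, map_prod] at hv
  refine ⟨v, left_ne_zero_of_mul hv, fun i hi => ?_⟩
  rw [← hL]
  exact Finset.prod_ne_zero_iff.1 (right_ne_zero_of_mul hv) i hi

end Generic

/-- A polynomial vanishing on the zero locus of an irreducible polynomial is divisible by it. -/
lemma dvd_of_forall_eval_eq_zero {σ k : Type*} [Finite σ] [Field k] [IsAlgClosed k]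
    {f g : MvPolynomial σ k} (hf : Irreducible f) (h : ∀ v, eval v f = 0 → eval v g = 0) :
    f ∣ g := by
  have hp : (Ideal.span {f}).IsPrime := (Ideal.span_singleton_prime hf.ne_zero).2 hf.prime
  rw [← Ideal.mem_span_singleton,
    ← MvPolynomial.IsPrime.vanishingIdeal_zeroLocus (K := k) (Ideal.span {f})]
  rw [mem_vanishingIdeal_iff]
  intro x hx
  rw [mem_zeroLocus_iff] at hx
  exact h x (hx f (Ideal.mem_span_singleton_self f))

section Shear

variable {σ k : Type*} [CommRing k]

/-- The shear `x ↦ x + w c` of `k[x][w]`. -/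
noncomputable def shear (c : σ → k) :
    Polynomial (MvPolynomial σ k) →+* Polynomial (MvPolynomial σ k) :=
  Polynomial.eval₂RingHom
    (aeval fun i => Polynomial.C (X i) + Polynomial.C (C (c i)) * Polynomial.X :
      MvPolynomial σ k →ₐ[k] Polynomial (MvPolynomial σ k)).toRingHom Polynomial.X

lemma shear_C (c : σ → k) (g : MvPolynomial σ k) :
    shear c (Polynomial.C g) = linePoly g X (fun i => C (c i)) := by
  simp [shear, linePoly]

lemma shear_X (c : σ → k) : shear c Polynomial.X = Polynomial.X := by
  simp [shear]

lemma shear_comp_shear (b c : σ → k) (h : b + c = 0) :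
    (shear b).comp (shear c) = RingHom.id _ := by
  refine Polynomial.ringHom_ext' (MvPolynomial.ringHom_ext (fun r => ?_) fun i => ?_) ?_
  · simp [shear_C, linePoly, Polynomial.algebraMap_apply]
  · have : c i = - b i := by
      have := congrFun h i
      simp only [Pi.add_apply, Pi.zero_apply] at this
      linear_combination this
    simp [shear_C, shear_X, linePoly, this]
  · simp [shear_X]

/-- The shear `x ↦ x + w c` as an automorphism. -/
noncomputable def shearEquiv (c : σ → k) :
    Polynomial (MvPolynomial σ k) ≃+* Polynomial (MvPolynomial σ k) :=
  RingEquiv.ofRingHom (shear c) (shear (-c)) (shear_comp_shear _ _ (by simp))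
    (shear_comp_shear _ _ (by simp))

lemma eval_linePoly_shear (g : MvPolynomial σ k) (a c : σ → k) (w : k) :
    ((linePoly g X (fun i => C (c i))).map (eval a)).eval w = eval (a + w • c) g := by
  have h := linePoly_map g X (fun i => C (c i)) (aeval a : MvPolynomial σ k →ₐ[k] k)
  change (linePoly g X (fun i => C (c i))).map (eval a) = _ at h
  rw [h, linePoly_eval]
  change eval _ g = _
  congr 2
  ext i
  simp [mul_comm]

end Shear

/-- If `f` is irreducible and does not divide `g`, then for general `a` the restrictions of `f` and
`g` to the line through `a` in direction `c` have no common zero. -/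
lemma exists_eval_ne_zero_of_not_dvd {σ k : Type*} [Field k] {f g : MvPolynomial σ k} {d : ℕ}
    {c : σ → k} (hf : Irreducible f) (hfd : f.IsHomogeneous d) (hc : eval c f = 1) (hg : ¬ f ∣ g) :
    ∃ ρ : MvPolynomial σ k, ρ ≠ 0 ∧ ∀ (a : σ → k) (w : k), eval a ρ ≠ 0 →
      eval (a + w • c) f = 0 → eval (a + w • c) g ≠ 0 := by
  set F := linePoly f X (fun i => C (c i)) with hF
  set G := linePoly g X (fun i => C (c i)) with hG
  have hFm : F.Monic := by
    refine Polynomial.monic_of_natDegree_le_of_coeff_eq_one d (linePoly_natDegree_le hfd _ _) ?_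
    rw [hF, linePoly_coeff_top hfd]
    have := MvPolynomial.comp_aeval_apply c (Algebra.ofId k (MvPolynomial σ k)) f
    change C (eval c f) = _ at this
    rw [hc, C_1] at this
    exact this.symm
  have hFi : Irreducible F := by
    have h1 : Irreducible (Polynomial.C f) := (Polynomial.prime_C_iff.2 hf.prime).irreducible
    have h2 := (MulEquiv.irreducible_iff (shearEquiv c)).2 h1
    change Irreducible (shear c _) at h2
    rwa [shear_C] at h2
  have hdvd : ¬ F ∣ G := by
    intro h
    apply hg
    have h2 := map_dvd (Polynomial.evalRingHom 0) h
    simp only [Polynomial.coe_evalRingHom, ← Polynomial.coeff_zero_eq_eval_zero, hF, hG,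
      linePoly_coeff_zero, aeval_X_left, AlgHom.id_apply] at h2
    exact h2
  let K := FractionRing (MvPolynomial σ k)
  have hcop : IsCoprime (F.map (algebraMap _ K)) (G.map (algebraMap _ K)) := by
    rw [(hFm.irreducible_iff_irreducible_map_fraction_map.1 hFi).coprime_iff_not_dvd]
    exact fun h => hdvd ((Polynomial.map_dvd_map _ (IsFractionRing.injective _ K) hFm).1 h)
  have hres := Polynomial.resultant_ne_zero _ _ hcop
  rw [Polynomial.natDegree_map_eq_of_injective (IsFractionRing.injective _ K),
    Polynomial.natDegree_map_eq_of_injective (IsFractionRing.injective _ K),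
    Polynomial.resultant_map_map] at hres
  have hρ : F.resultant G ≠ 0 := fun h => hres (by rw [h, map_zero])
  obtain ⟨p, q, h⟩ : ∃ p q, F * p + G * q = Polynomial.C (F.resultant G) := by
    obtain ⟨p, q, -, -, h⟩ := Polynomial.exists_mul_add_mul_eq_C_resultant F G le_rfl le_rfl
      (Or.inl fun h0 => hFi.not_isUnit
        (by rw [Polynomial.eq_one_of_monic_natDegree_zero hFm h0]; simp))
    exact ⟨p, q, h⟩
  refine ⟨_, hρ, fun a w ha hfa hga => ha ?_⟩
  have h2 := congrArg (fun P => (Polynomial.map (eval a) P).eval w) h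
  simp only [Polynomial.map_add, Polynomial.map_mul, Polynomial.eval_add, Polynomial.eval_mul,
    Polynomial.map_C, Polynomial.eval_C, hF, hG, eval_linePoly_shear, hfa, hga, zero_mul,
    add_zero] at h2
  exact h2.symm

section Specialization

variable {k : Type*} [Field k]

lemma exists_C_mul_dvd [Infinite k] {p : Polynomial (Polynomial k)} (hp : p ≠ 0) (n : ℕ) :
    ∀ q : Polynomial (Polynomial k), q.degree < n →
      (∀ t : k, p.map (Polynomial.evalRingHom t) ∣ q.map (Polynomial.evalRingHom t)) →
      ∃ r : Polynomial k, r ≠ 0 ∧ p ∣ Polynomial.C r * q := by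
  have hlc : p.leadingCoeff ≠ 0 := Polynomial.leadingCoeff_ne_zero.2 hp
  have hsmall : ∀ q : Polynomial (Polynomial k), q.degree < p.degree →
      (∀ t : k, p.map (Polynomial.evalRingHom t) ∣ q.map (Polynomial.evalRingHom t)) → q = 0 := by
    intro q hq h
    ext1 i
    rw [Polynomial.coeff_zero]
    have hz : ∀ t, (p.leadingCoeff * q.coeff i).eval t = 0 := by
      intro t
      by_cases ht : p.leadingCoeff.eval t = 0
      · rw [Polynomial.eval_mul, ht, zero_mul]
      · have hd : (q.map (Polynomial.evalRingHom t)).degree <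
            (p.map (Polynomial.evalRingHom t)).degree := by
          rw [Polynomial.degree_map_eq_of_leadingCoeff_ne_zero (p := p)
            (Polynomial.evalRingHom t) ht]
          exact lt_of_le_of_lt Polynomial.degree_map_le hq
        have h0 := Polynomial.eq_zero_of_dvd_of_degree_lt (h t) hd
        have := congrArg (fun r => r.coeff i) h0
        simp only [Polynomial.coeff_map, Polynomial.coe_evalRingHom, Polynomial.coeff_zero] at this
        rw [Polynomial.eval_mul, this, mul_zero]
    have := Polynomial.funext (p := p.leadingCoeff * q.coeff i) (q := 0) (by simpa using hz)
    exact (mul_eq_zero.1 this).resolve_left hlc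
  induction n with
  | zero =>
    intro q hq _
    have : q = 0 := by
      rw [← Polynomial.degree_eq_bot]
      exact Nat.WithBot.lt_zero_iff.1 hq
    exact ⟨1, one_ne_zero, by simp [this]⟩
  | succ n ih =>
    intro q hq h
    by_cases hqp : q.degree < p.degree
    · exact ⟨1, one_ne_zero, by simp [hsmall q hqp h]⟩
    by_cases hq0 : q = 0
    · exact ⟨1, one_ne_zero, by simp [hq0]⟩
    have hlcq : q.leadingCoeff ≠ 0 := Polynomial.leadingCoeff_ne_zero.2 hq0
    have hle : p.natDegree ≤ q.natDegree := Polynomial.natDegree_le_natDegree (not_lt.1 hqp)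
    set s := Polynomial.C q.leadingCoeff * Polynomial.X ^ (q.natDegree - p.natDegree) with hs
    have hlt : (Polynomial.C p.leadingCoeff * q - s * p).degree < q.degree := by
      have h1 : (Polynomial.C p.leadingCoeff * q).degree = q.degree :=
        Polynomial.degree_C_mul hlc
      rw [← h1]
      refine Polynomial.degree_sub_lt_left ?_ ?_ ?_
      · rw [h1, hs, mul_assoc, Polynomial.degree_C_mul hlcq, Polynomial.degree_mul,
          Polynomial.degree_X_pow, Polynomial.degree_eq_natDegree hp,
          Polynomial.degree_eq_natDegree hq0]
        norm_cast
        omega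
      · exact mul_ne_zero (Polynomial.C_ne_zero.2 hlc) hq0
      · rw [hs, Polynomial.leadingCoeff_mul, Polynomial.leadingCoeff_mul,
          Polynomial.leadingCoeff_mul, Polynomial.leadingCoeff_X_pow,
          Polynomial.leadingCoeff_C, Polynomial.leadingCoeff_C]
        ring
    obtain ⟨r, hr, hdvd⟩ := ih (Polynomial.C p.leadingCoeff * q - s * p)
      (lt_of_lt_of_le hlt (Order.lt_succ_iff.1 (by exact_mod_cast hq))) (fun t => by
        simp only [Polynomial.map_sub, Polynomial.map_mul]
        exact dvd_sub ((h t).mul_left _) (dvd_mul_left _ _))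
    refine ⟨r * p.leadingCoeff, mul_ne_zero hr hlc, ?_⟩
    have : Polynomial.C (r * p.leadingCoeff) * q =
        Polynomial.C r * (Polynomial.C p.leadingCoeff * q - s * p) + Polynomial.C r * s * p := by
      rw [Polynomial.C_mul]; ring
    rw [this]
    exact dvd_add hdvd (dvd_mul_left _ _)

/-- A pointwise form of Gauss's lemma. -/
lemma dvd_of_forall_map_eval_dvd [IsAlgClosed k] {p q : Polynomial (Polynomial k)}
    (hp : ∀ t : k, p.map (Polynomial.evalRingHom t) ≠ 0)
    (h : ∀ t : k, p.map (Polynomial.evalRingHom t) ∣ q.map (Polynomial.evalRingHom t)) :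
    p ∣ q := by
  have : Infinite k := IsAlgClosed.instInfinite
  have hp0 : p ≠ 0 := by
    rintro rfl
    exact hp 0 (by simp)
  obtain ⟨r, hr, hdvd⟩ := exists_C_mul_dvd hp0 (q.natDegree + 1) q
    (lt_of_le_of_lt Polynomial.degree_le_natDegree (by exact_mod_cast Nat.lt_succ_self _)) h
  have hprim : p.IsPrimitive := by
    intro s hs
    by_contra hu
    obtain ⟨x, hx⟩ := IsAlgClosed.exists_root s fun h0 =>
      hu (Polynomial.isUnit_iff_degree_eq_zero.2 h0)
    refine hp x ?_
    obtain ⟨w, hw⟩ := hs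
    rw [hw, Polynomial.map_mul, Polynomial.map_C]
    have : (Polynomial.evalRingHom x) s = 0 := hx
    rw [this]
    simp
  let K := FractionRing (Polynomial k)
  refine hprim.dvd_of_fraction_map_dvd_fraction_map (K := K) ?_
  have h2 := Polynomial.map_dvd (algebraMap (Polynomial k) K) hdvd
  rw [Polynomial.map_mul, Polynomial.map_C] at h2
  refine (IsUnit.dvd_mul_left ?_).1 h2
  rw [Polynomial.isUnit_C, isUnit_iff_ne_zero]
  intro h0
  exact hr (IsFractionRing.injective (Polynomial k) K (by rw [h0, map_zero]))

/-- If `p(t) = t ^ N q(1/t)`, then `p` has degree at most `N` and its coefficient at `N` is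
`q(0)`. -/
lemma natDegree_le_of_eval_eq_pow_mul [Infinite k] {p q : Polynomial k} {N : ℕ}
    (h : ∀ t : k, t ≠ 0 → p.eval t = t ^ N * q.eval t⁻¹) :
    p.natDegree ≤ N ∧ p.coeff N = q.coeff 0 := by
  set M := q.natDegree
  have key : Polynomial.X ^ (M + 1) * p = Polynomial.X ^ (N + 1) * q.reflect M := by
    refine Polynomial.funext fun t => ?_
    by_cases ht : t = 0
    · simp [ht]
    · let _ : Invertible t⁻¹ := ⟨t, mul_inv_cancel₀ ht, inv_mul_cancel₀ ht⟩
      have h1 := Polynomial.eval₂_reflect_mul_pow (RingHom.id k) t⁻¹ M q le_rfl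
      change (q.reflect M).eval t * t⁻¹ ^ M = q.eval t⁻¹ at h1
      simp only [Polynomial.eval_mul, Polynomial.eval_pow, Polynomial.eval_X]
      rw [h t ht, ← h1]
      have h2 : t ^ M * t⁻¹ ^ M = 1 := by rw [← mul_pow, mul_inv_cancel₀ ht, one_pow]
      linear_combination (t ^ (N + 1) * (q.reflect M).eval t) * h2
  have hco : ∀ j, N ≤ j → p.coeff j = q.coeff (Polynomial.revAt M (j + M - N)) := by
    intro j hj
    have h1 := congrArg (fun r => r.coeff (j + (M + 1))) key
    simp only [Polynomial.coeff_X_pow_mul] at h1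
    rw [show j + (M + 1) = (j + M - N) + (N + 1) by omega, Polynomial.coeff_X_pow_mul,
      Polynomial.coeff_reflect] at h1
    exact h1
  constructor
  · rw [Polynomial.natDegree_le_iff_coeff_eq_zero]
    intro j hj
    rw [hco j hj.le, Polynomial.revAt_eq_self_of_lt (by omega)]
    exact Polynomial.coeff_eq_zero_of_natDegree_lt (by omega)
  · rw [hco N le_rfl]
    simp

end Specialization

section Pencil

lemma map_aeval_congr {σ k A A' B : Type*} [CommRing k] [CommRing A] [CommRing A'] [CommRing B]
    [Algebra k A] [Algebra k A'] (φ : A →+* B) (ψ : A' →+* B) {g : σ → A} {g' : σ → A'}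
    (h : ∀ r : k, φ (algebraMap k A r) = ψ (algebraMap k A' r)) (h' : ∀ i, φ (g i) = ψ (g' i))
    (p : MvPolynomial σ k) : φ (aeval g p) = ψ (aeval g' p) := by
  rw [MvPolynomial.map_aeval, MvPolynomial.map_aeval]
  exact eval₂Hom_congr (RingHom.ext h) (funext h') rfl

variable {σ k : Type*} [Field k]

/-- The polynomial in the parameter `τ` obtained by evaluating the other variables of
`G` at `P`. -/
noncomputable def pencil (G : MvPolynomial (Option σ) k) (P : σ → k) : Polynomial k :=
  aeval (fun o => o.elim Polynomial.X fun i => Polynomial.C (P i)) G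

/-- The specialization of `G` at the value `τ` of the parameter. -/
noncomputable def specialize (G : MvPolynomial (Option σ) k) (τ : k) : MvPolynomial σ k :=
  aeval (fun o => o.elim (C τ) X) G

lemma eval_specialize (G : MvPolynomial (Option σ) k) (P : σ → k) (τ : k) :
    eval P (specialize G τ) = (pencil G P).eval τ := by
  refine map_aeval_congr (eval P) (Polynomial.evalRingHom τ) ?_ ?_ G
  · simp
  · intro o; cases o <;> simp

/-- The product of `G` over the points of `V(f)` on the line through `P` in direction `c`. -/
noncomputable def lineNorm (f : MvPolynomial σ k) (c : σ → k) (G : MvPolynomial (Option σ) k)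
    (P : σ → k) : Polynomial k :=
  ((linePoly f P c).roots.map fun w => pencil G (P + w • c)).prod

variable {f : MvPolynomial σ k} {d : ℕ} {c : σ → k}

lemma linePoly_monic (hf : f.IsHomogeneous d) (hc : eval c f = 1) (P : σ → k) :
    (linePoly f P c).Monic := by
  refine Polynomial.monic_of_natDegree_le_of_coeff_eq_one d (linePoly_natDegree_le hf _ _) ?_
  rw [linePoly_coeff_top hf]
  exact hc

lemma linePoly_natDegree (hf : f.IsHomogeneous d) (hc : eval c f = 1) (P : σ → k) :
    (linePoly f P c).natDegree = d := by
  refine le_antisymm (linePoly_natDegree_le hf _ _) (Polynomial.le_natDegree_of_ne_zero ?_)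
  rw [linePoly_coeff_top hf]
  change eval c f ≠ 0
  simp [hc]

lemma mem_roots_linePoly (hf : f.IsHomogeneous d) (hc : eval c f = 1) (P : σ → k) (w : k) :
    w ∈ (linePoly f P c).roots ↔ eval (P + w • c) f = 0 := by
  rw [Polynomial.mem_roots (linePoly_monic hf hc P).ne_zero, Polynomial.IsRoot, linePoly_eval]
  have : (fun i => P i + c i * w) = P + w • c := by
    ext i; simp [mul_comm]
  rw [this]
  rfl

lemma lineNorm_smul [IsAlgClosed k] (hf : f.IsHomogeneous d) (hc : eval c f = 1)
    {G : MvPolynomial (Option σ) k} {e : ℕ}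
    (hG : ∀ (a : k) (P : σ → k), pencil G (a • P) = Polynomial.C (a ^ e) * pencil G P)
    {a : k} (ha : a ≠ 0) (P : σ → k) :
    lineNorm f c G (a • P) = Polynomial.C (a ^ (d * e)) * lineNorm f c G P := by
  have h1 : linePoly f (a • P) c = (linePoly f P c).scaleRoots a := by
    ext j
    rw [Polynomial.coeff_scaleRoots, linePoly_natDegree hf hc]
    by_cases hj : j ≤ d
    · have := linePoly_coeff_smul hf P c a 1 hj
      simp only [mul_one, one_pow] at this
      rw [← this]
      congr 2
      ext i
      simp [mul_comm]
    · rw [Polynomial.coeff_eq_zero_of_natDegree_lt, Polynomial.coeff_eq_zero_of_natDegree_lt,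
        zero_mul]
      · rw [linePoly_natDegree hf hc]; omega
      · rw [linePoly_natDegree hf hc]; omega
  have hcard : (linePoly f P c).roots.card = d := by
    rw [← (IsAlgClosed.splits _).natDegree_eq_card_roots, linePoly_natDegree hf hc]
  rw [lineNorm, h1, Polynomial.roots_scaleRoots _ (isUnit_iff_ne_zero.2 ha), Multiset.map_map]
  have h2 : ∀ w, pencil G (a • P + (a * w) • c) =
      Polynomial.C (a ^ e) * pencil G (P + w • c) := by
    intro w
    rw [← hG, smul_add, smul_smul]
  simp only [Function.comp_def, h2]
  rw [Multiset.prod_map_mul, Multiset.map_const', Multiset.prod_replicate, hcard,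
    ← Polynomial.C_pow, ← pow_mul, mul_comm e d, lineNorm]

/-- The norm is polynomial along a line of base points. -/
lemma exists_map_eq_lineNorm [IsAlgClosed k] (hf : f.IsHomogeneous d) (hc : eval c f = 1)
    (G : MvPolynomial (Option σ) k) (a b : σ → k) :
    ∃ N : Polynomial (Polynomial k), ∀ t : k,
      N.map (Polynomial.evalRingHom t) = lineNorm f c G (a + t • b) := by
  let p : σ → Polynomial (Polynomial k) := fun i =>
    Polynomial.C (Polynomial.C (a i) + Polynomial.C (b i) * Polynomial.X)
  let u : σ → Polynomial (Polynomial k) := fun i => Polynomial.C (Polynomial.C (c i))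
  let Φ : Polynomial (Polynomial (Polynomial k)) := linePoly f p u
  let Γ : Polynomial (Polynomial (Polynomial k)) := aeval (fun o : Option σ =>
    o.elim (Polynomial.C Polynomial.X) fun i =>
      Polynomial.C (p i) + Polynomial.C (u i) * Polynomial.X) G
  refine ⟨Φ.resultant Γ d Γ.natDegree, fun t => ?_⟩
  let ψ : Polynomial (Polynomial k) →+* Polynomial k :=
    Polynomial.mapRingHom (Polynomial.evalRingHom t)
  have hΦ : Φ.map ψ = (linePoly f (a + t • b) c).map Polynomial.C := by
    refine map_aeval_congr (A := Polynomial (Polynomial (Polynomial k))) (A' := Polynomial k)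
      (B := Polynomial (Polynomial k)) (Polynomial.mapRingHom ψ)
      (Polynomial.mapRingHom Polynomial.C) ?_ ?_ f
    · intro r; simp [ψ, Polynomial.algebraMap_apply]
    · intro i; simp [ψ, p, u]; ring
  have hΓ : ∀ w : k, (Γ.map ψ).eval (Polynomial.C w) = pencil G (a + t • b + w • c) := by
    intro w
    refine map_aeval_congr (A := Polynomial (Polynomial (Polynomial k))) (A' := Polynomial k)
      (B := Polynomial k) ((Polynomial.evalRingHom (Polynomial.C w)).comp
      (Polynomial.mapRingHom ψ)) (RingHom.id _) ?_ ?_ G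
    · intro r; simp [ψ, Polynomial.algebraMap_apply]
    · intro o
      cases o
      · simp [ψ]
      · simp [ψ, p, u]; ring
  change ψ _ = _
  have hm := linePoly_monic hf hc (a + t • b)
  have hs : (linePoly f (a + t • b) c).Splits := IsAlgClosed.splits _
  have hdeg : ((linePoly f (a + t • b) c).map Polynomial.C).natDegree = d := by
    rw [Polynomial.natDegree_map_eq_of_injective Polynomial.C_injective, linePoly_natDegree hf hc]
  have h1 := Polynomial.resultant_eq_prod_eval ((linePoly f (a + t • b) c).map Polynomial.C)
    (Γ.map ψ) Γ.natDegree Polynomial.natDegree_map_le (hs.map _)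
  rw [hdeg, (hm.map _).leadingCoeff, one_pow, one_mul, hs.roots_map, Multiset.map_map] at h1
  rw [← Polynomial.resultant_map_map, hΦ, h1, lineNorm]
  simp only [Function.comp_def, hΓ]

end Pencil

lemma eval_smul_of_isHomogeneous {σ k : Type*} [CommRing k] {f : MvPolynomial σ k} {d : ℕ}
    (hf : f.IsHomogeneous d) (r : k) (v : σ → k) : eval (r • v) f = r ^ d * eval v f := by
  have h := linePoly_coeff_smul hf v 0 r 1 (Nat.zero_le d)
  simp only [linePoly_coeff_zero, Nat.sub_zero, pow_zero, mul_one] at h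
  rw [mul_comm]
  refine Eq.trans ?_ h
  change eval _ f = eval _ f
  congr 2
  ext i
  simp [mul_comm]

section Counting

variable {k : Type*} [Field k] [IsAlgClosed k]

omit [IsAlgClosed k] in
lemma exists_dual_ne_zero {V : Type*} [AddCommGroup V] [Module k V] (W : Submodule k V)
    (hW : W ≠ ⊤) : ∃ φ : Module.Dual k V, φ ≠ 0 ∧ ∀ v ∈ W, φ v = 0 := by
  obtain ⟨φ, h0, h⟩ := Submodule.exists_le_ker_of_lt_top W (lt_top_iff_ne_top.2 hW)
  exact ⟨φ, h0, fun v hv => h hv⟩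

/-- There is a point `c` off the surface and, for each line, a plane containing the line and `c`,
such that the planes are pairwise distinct. -/
lemma exists_projection_center {f : MvPolynomial (Fin 4) k} {d : ℕ} (hf : f ≠ 0) (hd : 0 < d)
    (hfd : f.IsHomogeneous d) (𝓛 : Finset (Submodule k (Fin 4 → k)))
    (h𝓛 : ∀ L ∈ 𝓛, IsLineOn f L) :
    ∃ (c : Fin 4 → k) (ℓ : Submodule k (Fin 4 → k) → Module.Dual k (Fin 4 → k)),
      eval c f = 1 ∧ (∀ L ∈ 𝓛, ℓ L ≠ 0 ∧ ∀ v, ℓ L v = 0 ↔ ∃ w : k, v + w • c ∈ L) ∧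
      ∀ L ∈ 𝓛, ∀ L' ∈ 𝓛, L ≠ L' → ∀ α β : k, α ≠ 0 → β ≠ 0 → α • ℓ L - β • ℓ L' ≠ 0 := by
  classical
  let s := (𝓛 ×ˢ 𝓛).filter fun x => x.1 ⊔ x.2 ≠ ⊤
  have hex : ∀ x : Submodule k (Fin 4 → k) × Submodule k (Fin 4 → k),
      ∃ φ : Module.Dual k (Fin 4 → k), x.1 ⊔ x.2 ≠ ⊤ → φ ≠ 0 ∧ ∀ v ∈ x.1 ⊔ x.2, φ v = 0 := by
    intro x
    by_cases h : x.1 ⊔ x.2 = ⊤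
    · exact ⟨0, fun h' => absurd h h'⟩
    · obtain ⟨φ, hφ⟩ := exists_dual_ne_zero _ h
      exact ⟨φ, fun _ => hφ⟩
  choose φ hφ using hex
  have : Infinite k := IsAlgClosed.instInfinite
  obtain ⟨c₀, hc₀, hφc⟩ := exists_eval_ne_zero_and hf s φ
    (fun x hx => (hφ x (Finset.mem_filter.1 hx).2).1)
  obtain ⟨r, hr⟩ := IsAlgClosed.exists_pow_nat_eq (eval c₀ f)⁻¹ hd
  have hr0 : r ≠ 0 := by
    rintro rfl
    rw [zero_pow hd.ne'] at hr
    exact hc₀ (inv_eq_zero.1 hr.symm)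
  set c := r • c₀ with hc
  have hfc : eval c f = 1 := by
    rw [hc, eval_smul_of_isHomogeneous hfd, hr, inv_mul_cancel₀ hc₀]
  have hcL : ∀ L ∈ 𝓛, c ∉ L := fun L hL h => by
    rw [(h𝓛 L hL).2 c h] at hfc
    exact zero_ne_one hfc
  have hrank : ∀ L ∈ 𝓛, Module.finrank k ↥(L ⊔ Submodule.span k {c}) = 3 := by
    intro L hL
    have hc0 : c ≠ 0 := fun h => hcL L hL (h ▸ zero_mem L)
    have h := Submodule.finrank_sup_add_finrank_inf_eq L (Submodule.span k {c})
    rw [((Submodule.disjoint_span_singleton' hc0).2 (hcL L hL)).eq_bot, finrank_bot,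
      finrank_span_singleton hc0, (h𝓛 L hL).1] at h
    exact h
  have hex2 : ∀ L : Submodule k (Fin 4 → k), ∃ ψ : Module.Dual k (Fin 4 → k),
      L ∈ 𝓛 → ψ ≠ 0 ∧ LinearMap.ker ψ = L ⊔ Submodule.span k {c} := by
    intro L
    by_cases hL : L ∈ 𝓛
    · obtain ⟨ψ, h0, h⟩ := Submodule.exists_le_ker_of_lt_top (L ⊔ Submodule.span k {c})
        (lt_top_iff_ne_top.2 fun h => by
          have := hrank L hL
          rw [h, finrank_top] at this
          simp at this)
      refine ⟨ψ, fun _ => ⟨h0, (Submodule.eq_of_le_of_finrank_eq h ?_).symm⟩⟩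
      have := Module.Dual.finrank_ker_add_one_of_ne_zero h0
      rw [hrank L hL]
      simp at this
      omega
    · exact ⟨0, fun h => absurd h hL⟩
  choose ℓ hℓ using hex2
  refine ⟨c, ℓ, hfc, fun L hL => ⟨(hℓ L hL).1, fun v => ?_⟩, ?_⟩
  · rw [← LinearMap.mem_ker, (hℓ L hL).2]
    constructor
    · intro hv
      obtain ⟨y, hy, z, hz, rfl⟩ := Submodule.mem_sup.1 hv
      obtain ⟨w, rfl⟩ := Submodule.mem_span_singleton.1 hz
      exact ⟨-w, by simpa using hy⟩
    · rintro ⟨w, hw⟩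
      have : v = (v + w • c) + (-w) • c := by simp
      rw [this]
      exact Submodule.add_mem_sup hw (Submodule.smul_mem _ _ (Submodule.mem_span_singleton_self c))
  · intro L hL L' hL' hne α β hα hβ h0
    have hker : LinearMap.ker (ℓ L) = LinearMap.ker (ℓ L') := by
      ext v
      have h := congrArg (fun ψ => ψ v) h0
      simp only [LinearMap.sub_apply, LinearMap.smul_apply, smul_eq_mul, LinearMap.zero_apply] at h
      simp only [LinearMap.mem_ker]
      constructor
      · intro hv
        rw [hv] at h
        simpa [hβ] using h
      · intro hv
        rw [hv] at h
        simpa [hα] using h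
    have hle : L ⊔ L' ≤ LinearMap.ker (ℓ L) :=
      sup_le ((hℓ L hL).2 ▸ le_sup_left) (by rw [hker]; exact (hℓ L' hL').2 ▸ le_sup_left)
    have hlt : L < L ⊔ L' := by
      refine lt_of_le_of_ne le_sup_left fun h => hne ?_
      have h1 : L' ≤ L := by rw [h]; exact le_sup_right
      exact (Submodule.eq_of_le_of_finrank_eq h1 ((h𝓛 L' hL').1.trans (h𝓛 L hL).1.symm)).symm
    have h3 : L ⊔ L' = LinearMap.ker (ℓ L) := by
      refine Submodule.eq_of_le_of_finrank_le hle ?_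
      have := Submodule.finrank_lt_finrank_of_lt hlt
      rw [(hℓ L hL).2, hrank L hL]
      rw [(h𝓛 L hL).1] at this
      omega
    have htop : L ⊔ L' ≠ ⊤ := by
      rw [h3]
      intro h
      exact (hℓ L hL).1 (LinearMap.ker_eq_top.1 h)
    have hmem : (L, L') ∈ s := Finset.mem_filter.2 ⟨Finset.mem_product.2 ⟨hL, hL'⟩, htop⟩
    have hcm : c ∈ L ⊔ L' := by
      rw [h3, (hℓ L hL).2]
      exact Submodule.mem_sup_right (Submodule.mem_span_singleton_self c)
    have := (hφ (L, L') htop).2 c hcm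
    rw [hc, map_smul, smul_eq_mul] at this
    exact mul_ne_zero hr0 (hφc _ hmem) this

end Counting

section Counting

variable {k : Type*} [Field k] [IsAlgClosed k]

/-- If a family `G` of forms of degree `a` with parameter vanishes along the lines `𝓛` on the
irreducible surface `V(f)` of degree `d`, but not identically on `V(f)`, and is divisible at each
point of the surface by a nonzero value of a family `D` of degree `b`, then there are at most
`d (a - b)` lines. -/
lemma card_lines_add_le {f : MvPolynomial (Fin 4) k} {d : ℕ} (hf : Irreducible f) (hd : 0 < d)
    (hfd : f.IsHomogeneous d) (𝓛 : Finset (Submodule k (Fin 4 → k)))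
    (h𝓛 : ∀ L ∈ 𝓛, IsLineOn f L) {G D : MvPolynomial (Option (Fin 4)) k} {a b : ℕ}
    (hG : ∀ (r : k) (P : Fin 4 → k), pencil G (r • P) = Polynomial.C (r ^ a) * pencil G P)
    (hD : ∀ (r : k) (P : Fin 4 → k), pencil D (r • P) = Polynomial.C (r ^ b) * pencil D P)
    (hdvd : ∀ P : Fin 4 → k, P ≠ 0 → eval P f = 0 → pencil D P ∣ pencil G P)
    (hD0 : ∀ P : Fin 4 → k, P ≠ 0 → eval P f = 0 → pencil D P ≠ 0)
    (hGL : ∀ L ∈ 𝓛, ∀ P ∈ L, pencil G P = 0)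
    (hG0 : ∃ P : Fin 4 → k, eval P f = 0 ∧ pencil G P ≠ 0) :
    𝓛.card + d * b ≤ d * a := by
  classical
  have : Infinite k := IsAlgClosed.instInfinite
  obtain ⟨c, ℓ, hc, hℓ, hℓℓ⟩ := exists_projection_center hf.ne_zero hd hfd 𝓛 h𝓛
  have hc0 : c ≠ 0 := by
    rintro rfl
    have := eval_smul_of_isHomogeneous hfd 0 (0 : Fin 4 → k)
    rw [smul_zero, hc, zero_pow hd.ne', zero_mul] at this
    exact one_ne_zero this
  -- a specialization of `G` that does not vanish on the surface
  obtain ⟨τ₁, hτ₁⟩ : ∃ τ, ¬ f ∣ specialize G τ := by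
    obtain ⟨P, hP, hPG⟩ := hG0
    obtain ⟨τ, hτ⟩ : ∃ τ, (pencil G P).eval τ ≠ 0 := by
      by_contra! h
      exact hPG (Polynomial.funext fun t => by simp [h])
    refine ⟨τ, fun ⟨q, hq⟩ => hτ ?_⟩
    rw [← eval_specialize, hq, map_mul, hP, zero_mul]
  obtain ⟨ρ, hρ, hρ'⟩ := exists_eval_ne_zero_of_not_dvd hf hfd hc hτ₁
  -- a general direction
  obtain ⟨ψ, hψ, hψc⟩ := exists_dual_ne_zero (Submodule.span k {c}) (fun h => by
    have h1 := finrank_span_singleton (K := k) hc0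
    rw [h, finrank_top] at h1
    simp at h1)
  obtain ⟨e, -, he⟩ := exists_eval_ne_zero_and (σ := Fin 4) (k := k) one_ne_zero
    (insert ψ (𝓛.image ℓ)) id (by
      intro φ hφ
      rcases Finset.mem_insert.1 hφ with rfl | hφ
      · exact hψ
      · obtain ⟨L, hL, rfl⟩ := Finset.mem_image.1 hφ
        exact (hℓ L hL).1)
  have heψ : ψ e ≠ 0 := he ψ (Finset.mem_insert_self _ _)
  have heℓ : ∀ L ∈ 𝓛, ℓ L e ≠ 0 := fun L hL =>
    he _ (Finset.mem_insert_of_mem (Finset.mem_image_of_mem _ hL))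
  -- a general base point
  obtain ⟨χ, hχ, hχec⟩ := exists_dual_ne_zero (Submodule.span k {e, c}) (fun h => by
    have h1 := finrank_span_finset_le_card (R := k) ({e, c} : Finset (Fin 4 → k))
    have h2 := Finset.card_le_two (a := e) (b := c)
    rw [Finset.coe_pair] at h1
    rw [Set.finrank, h, finrank_top] at h1
    simp at h1
    omega)
  let δ : Submodule k (Fin 4 → k) × Submodule k (Fin 4 → k) → Module.Dual k (Fin 4 → k) :=
    fun x => ℓ x.2 e • ℓ x.1 - ℓ x.1 e • ℓ x.2
  obtain ⟨p, hpρ, hp⟩ := exists_eval_ne_zero_and hρ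
    (insert χ (((𝓛 ×ˢ 𝓛).filter fun x => x.1 ≠ x.2).image δ)) id (by
      intro φ hφ
      rcases Finset.mem_insert.1 hφ with rfl | hφ
      · exact hχ
      · obtain ⟨x, hx, rfl⟩ := Finset.mem_image.1 hφ
        obtain ⟨hx1, hx2⟩ := Finset.mem_filter.1 hx
        obtain ⟨hx3, hx4⟩ := Finset.mem_product.1 hx1
        exact hℓℓ _ hx3 _ hx4 hx2 _ _ (heℓ _ hx4) (heℓ _ hx3))
  have hpχ : χ p ≠ 0 := hp χ (Finset.mem_insert_self _ _)
  have hpδ : ∀ L ∈ 𝓛, ∀ L' ∈ 𝓛, L ≠ L' → ℓ L' e * ℓ L p - ℓ L e * ℓ L' p ≠ 0 := by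
    intro L hL L' hL' hne
    have := hp (δ (L, L')) (Finset.mem_insert_of_mem (Finset.mem_image_of_mem _
      (Finset.mem_filter.2 ⟨Finset.mem_product.2 ⟨hL, hL'⟩, hne⟩)))
    simpa [δ] using this
  have hpt : ∀ t w : k, p + t • e + w • c ≠ 0 := by
    intro t w h
    have h1 := congrArg χ h
    rw [map_add, map_add, map_smul, map_smul, hχec e (Submodule.subset_span (by simp)),
      hχec c (Submodule.subset_span (by simp)), map_zero] at h1
    simp at h1
    exact hpχ h1
  have hew : ∀ w : k, e + w • c ≠ 0 := by
    intro w h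
    have h1 := congrArg ψ h
    rw [map_add, map_smul, hψc c (Submodule.mem_span_singleton_self c), map_zero] at h1
    simp at h1
    exact heψ h1
  -- the norms
  obtain ⟨NG, hNG⟩ := exists_map_eq_lineNorm hfd hc G p e
  obtain ⟨ND, hND⟩ := exists_map_eq_lineNorm hfd hc D p e
  obtain ⟨NG', hNG'⟩ := exists_map_eq_lineNorm hfd hc G e p
  obtain ⟨ND', hND'⟩ := exists_map_eq_lineNorm hfd hc D e p
  have hDne : ∀ P : Fin 4 → k, (∀ w : k, P + w • c ≠ 0) → lineNorm f c D P ≠ 0 := by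
    intro P hP h0
    obtain ⟨w, hw, hw0⟩ := Multiset.mem_map.1 (Multiset.prod_eq_zero_iff.1 h0)
    exact hD0 _ (hP w) ((mem_roots_linePoly hfd hc P w).1 hw) hw0
  have hDG : ND ∣ NG := by
    refine dvd_of_forall_map_eval_dvd (fun t => ?_) (fun t => ?_)
    · rw [hND]
      exact hDne _ (hpt t)
    · rw [hND, hNG]
      refine Multiset.prod_dvd_prod_of_dvd _ _ fun w hw => ?_
      exact hdvd _ (hpt t w) ((mem_roots_linePoly hfd hc _ w).1 hw)
  obtain ⟨H, hH⟩ := hDG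
  have hGp : lineNorm f c G p ≠ 0 := by
    intro h0
    obtain ⟨w, hw, hw0⟩ := Multiset.mem_map.1 (Multiset.prod_eq_zero_iff.1 h0)
    refine hρ' p w hpρ ((mem_roots_linePoly hfd hc p w).1 hw) ?_
    rw [eval_specialize, hw0, Polynomial.eval_zero]
  obtain ⟨τ, hτ⟩ : ∃ τ, (lineNorm f c G p * lineNorm f c D e).eval τ ≠ 0 := by
    by_contra! h
    exact mul_ne_zero hGp (hDne e hew) (Polynomial.funext fun t => by rw [h]; simp)
  rw [Polynomial.eval_mul] at hτ
  have hτG := left_ne_zero_of_mul hτ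
  have hτD := right_ne_zero_of_mul hτ
  -- evaluate the parameter
  have hev : ∀ (N : Polynomial (Polynomial k)) (t : k),
      (N.eval (Polynomial.C τ)).eval t = (N.map (Polynomial.evalRingHom t)).eval τ := by
    intro N t
    have h := Polynomial.hom_eval₂ N (RingHom.id _) (Polynomial.evalRingHom t) (Polynomial.C τ)
    rw [Polynomial.eval_map]
    simpa using h
  have hscale : ∀ (K : MvPolynomial (Option (Fin 4)) k) (m : ℕ) (N N' : Polynomial (Polynomial k)),
      (∀ (r : k) (P : Fin 4 → k), pencil K (r • P) = Polynomial.C (r ^ m) * pencil K P) →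
      (∀ t : k, N.map (Polynomial.evalRingHom t) = lineNorm f c K (p + t • e)) →
      (∀ t : k, N'.map (Polynomial.evalRingHom t) = lineNorm f c K (e + t • p)) →
      (N.eval (Polynomial.C τ)).natDegree ≤ d * m ∧
        (N.eval (Polynomial.C τ)).coeff (d * m) = (lineNorm f c K e).eval τ := by
    intro K m N N' hK hN hN'
    have h := natDegree_le_of_eval_eq_pow_mul (p := N.eval (Polynomial.C τ))
      (q := N'.eval (Polynomial.C τ)) (N := d * m) (fun t ht => by
        rw [hev, hev, hN, hN']
        have : p + t • e = t • (e + t⁻¹ • p) := by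
          rw [smul_add, smul_smul, mul_inv_cancel₀ ht, one_smul, add_comm]
        rw [this, lineNorm_smul hfd hc hK ht, Polynomial.eval_mul, Polynomial.eval_C])
    refine ⟨h.1, h.2.trans ?_⟩
    rw [Polynomial.coeff_zero_eq_eval_zero, hev, hN', zero_smul, add_zero]
  obtain ⟨hdegG, -⟩ := hscale G a NG NG' hG hNG hNG'
  obtain ⟨hdegD, hcoD⟩ := hscale D b ND ND' hD hND hND'
  have hdegD' : (ND.eval (Polynomial.C τ)).natDegree = d * b :=
    le_antisymm hdegD (Polynomial.le_natDegree_of_ne_zero (by rw [hcoD]; exact hτD))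
  have hprod : NG.eval (Polynomial.C τ) = ND.eval (Polynomial.C τ) * H.eval (Polynomial.C τ) := by
    rw [hH, Polynomial.eval_mul]
  have hNG0 : NG.eval (Polynomial.C τ) ≠ 0 := by
    intro h
    have h1 := hev NG 0
    rw [h, hNG, zero_smul, add_zero, Polynomial.eval_zero] at h1
    exact hτG h1.symm
  rw [hprod] at hNG0 hdegG
  have hH0 := right_ne_zero_of_mul hNG0
  rw [Polynomial.natDegree_mul (left_ne_zero_of_mul hNG0) hH0, hdegD'] at hdegG
  -- the lines give distinct roots
  have hroot : ∀ L ∈ 𝓛, -(ℓ L p / ℓ L e) ∈ (H.eval (Polynomial.C τ)).roots.toFinset := by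
    intro L hL
    rw [Multiset.mem_toFinset, Polynomial.mem_roots hH0, Polynomial.IsRoot, hev]
    set t := -(ℓ L p / ℓ L e) with ht
    have h0 : ℓ L (p + t • e) = 0 := by
      rw [map_add, map_smul, smul_eq_mul, ht, neg_mul, div_mul_cancel₀ _ (heℓ L hL), add_neg_cancel]
    obtain ⟨w, hw⟩ := ((hℓ L hL).2 _).1 h0
    have hz : lineNorm f c G (p + t • e) = 0 := by
      refine Multiset.prod_eq_zero (Multiset.mem_map.2 ⟨w, ?_, hGL L hL _ hw⟩)
      rw [mem_roots_linePoly hfd hc]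
      exact (h𝓛 L hL).2 _ hw
    have h2 := congrArg (Polynomial.map (Polynomial.evalRingHom t)) hH
    rw [Polynomial.map_mul, hNG, hND, hz] at h2
    rw [(mul_eq_zero.1 h2.symm).resolve_left (hDne _ (hpt t)), Polynomial.eval_zero]
  have hinj : Set.InjOn (fun L => -(ℓ L p / ℓ L e)) (𝓛 : Set (Submodule k (Fin 4 → k))) := by
    intro L hL L' hL' h
    by_contra hne
    refine hpδ L hL L' hL' hne ?_
    have h' := neg_inj.1 h
    rw [div_eq_div_iff (heℓ L hL) (heℓ L' hL')] at h'
    linear_combination h'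
  have hcard := Finset.card_le_card_of_injOn _ hroot hinj
  have h3 := Multiset.toFinset_card_le (H.eval (Polynomial.C τ)).roots
  have h4 := Polynomial.card_roots' (H.eval (Polynomial.C τ))
  omega

end Counting

section Forms

variable {σ k : Type*} [Field k] [Infinite k]

omit [Infinite k] in
lemma linePoly_eval' (h : MvPolynomial σ k) (p u : σ → k) (t : k) :
    (linePoly h p u).eval t = eval (p + t • u) h := by
  rw [linePoly_eval]
  change eval _ h = eval _ h
  congr 2
  ext i
  simp [mul_comm]

/-- The restriction of a form of degree `e` to a line has degree at most `e`; the top coefficient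
is the value at infinity. -/
lemma linePoly_natDegree_le_of_smul {h : MvPolynomial σ k} {e : ℕ}
    (hh : ∀ (r : k) (v : σ → k), eval (r • v) h = r ^ e * eval v h) (p u : σ → k) :
    (linePoly h p u).natDegree ≤ e ∧ (linePoly h p u).coeff e = eval u h := by
  have := natDegree_le_of_eval_eq_pow_mul (p := linePoly h p u) (q := linePoly h u p) (N := e)
    (fun t ht => by
      rw [linePoly_eval', linePoly_eval', ← hh, smul_add, smul_smul, mul_inv_cancel₀ ht, one_smul,
        add_comm])
  refine ⟨this.1, this.2.trans ?_⟩
  rw [linePoly_coeff_zero]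
  rfl

/-- A form of degree less than `d` which is divisible by a form of degree `d` is zero. -/
lemma eq_zero_of_dvd_of_smul {f h : MvPolynomial σ k} {d e : ℕ} (hfd : f.IsHomogeneous d)
    (hf : f ≠ 0) (hed : e < d)
    (hh : ∀ (r : k) (v : σ → k), eval (r • v) h = r ^ e * eval v h) (hfh : f ∣ h) : h = 0 := by
  obtain ⟨c, hc⟩ : ∃ c, eval c f ≠ 0 := by
    by_contra! H
    exact hf (MvPolynomial.funext fun x => by rw [H]; simp)
  refine MvPolynomial.funext fun v => ?_
  have hdvd : linePoly f v c ∣ linePoly h v c := map_dvd _ hfh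
  have hdeg : (linePoly h v c).natDegree < (linePoly f v c).natDegree := by
    refine lt_of_le_of_lt (linePoly_natDegree_le_of_smul hh v c).1 (lt_of_lt_of_le hed ?_)
    refine Polynomial.le_natDegree_of_ne_zero ?_
    rw [linePoly_coeff_top hfd]
    exact hc
  have h0 := Polynomial.eq_zero_of_dvd_of_natDegree_lt hdvd hdeg
  have h1 := linePoly_eval' h v c 0
  rw [h0] at h1
  simpa using h1.symm

end Forms

section Counting

variable {k : Type*} [Field k] [IsAlgClosed k]

/-- A form of degree `e` containing all the lines `𝓛` but not the surface bounds the number of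
lines by `d e`. -/
lemma card_lines_le {f : MvPolynomial (Fin 4) k} {d : ℕ} (hf : Irreducible f) (hd : 0 < d)
    (hfd : f.IsHomogeneous d) (𝓛 : Finset (Submodule k (Fin 4 → k)))
    (h𝓛 : ∀ L ∈ 𝓛, IsLineOn f L) {g : MvPolynomial (Fin 4) k} {e : ℕ}
    (hg : ∀ (r : k) (P : Fin 4 → k), eval (r • P) g = r ^ e * eval P g)
    (hgL : ∀ L ∈ 𝓛, ∀ P ∈ L, eval P g = 0) (hgf : ∃ P, eval P f = 0 ∧ eval P g ≠ 0) :
    𝓛.card ≤ d * e := by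
  have hpen : ∀ P, pencil (rename some g) P = Polynomial.C (eval P g) := by
    intro P
    rw [pencil, aeval_rename]
    have := MvPolynomial.comp_aeval_apply P (Algebra.ofId k (Polynomial k)) g
    exact this.symm
  have h1 : ∀ P, pencil (1 : MvPolynomial (Option (Fin 4)) k) P = 1 := fun P => by simp [pencil]
  have := card_lines_add_le hf hd hfd 𝓛 h𝓛 (G := rename some g) (D := 1) (a := e) (b := 0)
    (fun r P => by rw [hpen, hpen, hg, Polynomial.C_mul]) (fun r P => by simp [h1])
    (fun P _ _ => by simp [h1]) (fun P _ _ => by simp [h1])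
    (fun L hL P hP => by rw [hpen, hgL L hL P hP, Polynomial.C_0]) (by
      obtain ⟨P, hP, hPg⟩ := hgf
      exact ⟨P, hP, by rwa [hpen, Polynomial.C_ne_zero]⟩)
  simpa using this

end Counting

section BinaryForms

/-- A binary form over an algebraically closed field is a product of linear forms. -/
lemma exists_binary_factorization {k : Type*} [Field k] [IsAlgClosed k] {a : ℕ} (Q : k → k → k)
    (hQ : ∀ r y z, Q (r * y) (r * z) = r ^ a * Q y z) (ψ ψ' : Polynomial k)
    (hψ : ∀ t, ψ.eval t = Q 1 t) (hψ' : ∀ t, ψ'.eval t = Q t 1) :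
    ∃ (κ : k) (S : Multiset (k × k)), S.card = a ∧ (∀ x ∈ S, x ≠ 0) ∧
      ∀ y z, Q y z = κ * (S.map fun x => x.2 * y - x.1 * z).prod := by
  have : Infinite k := IsAlgClosed.instInfinite
  obtain ⟨hdeg, hcoeff⟩ := natDegree_le_of_eval_eq_pow_mul (p := ψ) (q := ψ') (N := a)
    (fun t ht => by rw [hψ, hψ', ← hQ, mul_inv_cancel₀ ht, mul_one])
  have hsplit := IsAlgClosed.splits ψ
  have hcard : ψ.natDegree = ψ.roots.card := hsplit.natDegree_eq_card_roots
  have hprod := hsplit.eq_prod_roots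
  refine ⟨ψ.leadingCoeff, ψ.roots.map (fun r => ((-1 : k), -r)) +
    Multiset.replicate (a - ψ.natDegree) ((0 : k), (1 : k)), ?_, ?_, ?_⟩
  · simp only [Multiset.card_add, Multiset.card_map, Multiset.card_replicate]
    lia
  · intro x hx
    rcases Multiset.mem_add.1 hx with h | h
    · obtain ⟨r, -, rfl⟩ := Multiset.mem_map.1 h
      simp
    · rw [Multiset.eq_of_mem_replicate h]
      simp
  · intro y z
    have key : (Multiset.map (fun x : k × k => x.2 * y - x.1 * z)
        (ψ.roots.map (fun r => ((-1 : k), -r)) +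
          Multiset.replicate (a - ψ.natDegree) ((0 : k), (1 : k)))).prod =
        (ψ.roots.map fun r => z - r * y).prod * y ^ (a - ψ.natDegree) := by
      simp only [Multiset.map_add, Multiset.prod_add, Multiset.map_map, Multiset.map_replicate,
        Multiset.prod_replicate]
      congr 1
      · congr 1
        refine Multiset.map_congr rfl fun r _ => ?_
        simp only [Function.comp]
        ring
      · simp
    rw [key]
    by_cases hy : y = 0
    · subst hy
      have h1 : Q 0 z = z ^ a * ψ.coeff a := by
        have := hQ z 0 1
        rw [mul_zero, mul_one] at this
        rw [this, hcoeff, ← hψ' 0, ← Polynomial.coeff_zero_eq_eval_zero]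
      rw [h1]
      simp only [mul_zero, sub_zero, Multiset.map_const', Multiset.prod_replicate, ← hcard]
      rcases hdeg.lt_or_eq with h | h
      · rw [Polynomial.coeff_eq_zero_of_natDegree_lt h, zero_pow (by lia)]
        simp
      · rw [← h, Nat.sub_self, Polynomial.leadingCoeff]
        ring
    · have h1 : Q y z = y ^ a * ψ.eval (z / y) := by
        rw [hψ, ← hQ, mul_one, mul_div_cancel₀ _ hy]
      have h2 : (ψ.roots.map fun r => z - r * y).prod =
          y ^ ψ.natDegree * (ψ.roots.map fun r => z / y - r).prod := by
        have h : (fun r => z - r * y) = fun r => y * (z / y - r) := by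
          ext r
          field_simp
        rw [h, Multiset.prod_map_mul, Multiset.map_const', Multiset.prod_replicate, hcard]
      have h3 : ψ.eval (z / y) = ψ.leadingCoeff * (ψ.roots.map fun r => z / y - r).prod := by
        conv_lhs => rw [hprod]
        rw [Polynomial.eval_mul, Polynomial.eval_C, Polynomial.eval_multiset_prod, Multiset.map_map]
        congr 2
        refine Multiset.map_congr rfl fun r _ => ?_
        simp
      rw [h1, h2, h3]
      have : y ^ a = y ^ ψ.natDegree * y ^ (a - ψ.natDegree) := by
        rw [← pow_add]
        congr 1
        lia
      rw [this]
      ring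

lemma resultant_mul_of_natDegree_le {R : Type*} [CommRing R] {p₁ p₂ q : Polynomial R}
    {m₁ m₂ n : ℕ} (h₁ : p₁.natDegree ≤ m₁) (h₂ : p₂.natDegree ≤ m₂) (hq : q.natDegree ≤ n) :
    (p₁ * p₂).resultant q (m₁ + m₂) n = p₁.resultant q m₁ n * p₂.resultant q m₂ n := by
  obtain ⟨k₁, rfl⟩ := Nat.exists_eq_add_of_le h₁
  obtain ⟨k₂, rfl⟩ := Nat.exists_eq_add_of_le h₂
  rw [show p₁.natDegree + k₁ + (p₂.natDegree + k₂) = (p₁.natDegree + p₂.natDegree) + (k₁ + k₂) by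
    ring, Polynomial.resultant_add_left_deg _ _ _ _ _ Polynomial.natDegree_mul_le,
    Polynomial.resultant_add_left_deg _ _ _ _ _ le_rfl,
    Polynomial.resultant_add_left_deg _ _ _ _ _ le_rfl, Polynomial.resultant_mul_left _ _ _ _ hq]
  ring

variable {σ k : Type*} [Field k] {f : MvPolynomial σ k} {d : ℕ}

/-- The resultant of a linear polynomial with the restriction of `f` to a line is the value of
`f` at the corresponding point of the line. -/
lemma resultant_linear_linePoly (hfd : f.IsHomogeneous d) (W U : σ → k) (p q : k) :
    (Polynomial.C q + Polynomial.C p * Polynomial.X).resultant (linePoly f W U) 1 d =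
      eval (p • W - q • U) f := by
  have hdeg := linePoly_natDegree_le hfd W U
  have hcomb := aeval_comb hfd W U p (-q)
  have hLHS : eval (p • W - q • U) f = aeval (fun i => W i * p + U i * -q) f := by
    change _ = eval _ f
    congr 2
    ext i
    simp only [Pi.sub_apply, Pi.smul_apply, smul_eq_mul]
    ring
  rw [hLHS]
  by_cases hp : p = 0
  · subst hp
    have h1 : (Polynomial.C q + Polynomial.C 0 * Polynomial.X : Polynomial k) = Polynomial.C q := by
      simp
    rw [h1, Polynomial.resultant_C_left, hcomb, Finset.sum_eq_single d]
    · rw [Nat.sub_self, neg_pow]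
      ring
    · intro j hj hjd
      rw [zero_pow (by have := Finset.mem_range.1 hj; lia)]
      ring
    · simp
  · have h1 : (Polynomial.C q + Polynomial.C p * Polynomial.X : Polynomial k) =
        Polynomial.C p * (Polynomial.X - Polynomial.C (-(q / p))) := by
      rw [mul_sub, ← Polynomial.C_mul, mul_neg, mul_div_cancel₀ _ hp]
      simp [add_comm]
    rw [h1, Polynomial.resultant_C_mul_left, Polynomial.resultant_X_sub_C_left _ _ _ hdeg, hcomb,
      Polynomial.eval_eq_sum_range' (Nat.lt_succ_of_le hdeg), Finset.mul_sum]
    refine Finset.sum_congr rfl fun j hj => ?_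
    have : p ^ d = p ^ (d - j) * p ^ j := by
      rw [← pow_add]
      congr 1
      have := Finset.mem_range.1 hj
      lia
    rw [this, ← neg_div, div_pow]
    field_simp

lemma natDegree_linear_le (p q : k) :
    (Polynomial.C q + Polynomial.C p * Polynomial.X : Polynomial k).natDegree ≤ 1 := by
  rw [add_comm]
  exact Polynomial.natDegree_linear_le

lemma resultant_prod_linear_linePoly (hfd : f.IsHomogeneous d) (W U : σ → k) {ι : Type*}
    (S : Multiset ι) (p q : ι → k) (κ : k) :
    (Polynomial.C κ * (S.map fun x =>
      Polynomial.C (q x) + Polynomial.C (p x) * Polynomial.X).prod).resultant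
        (linePoly f W U) S.card d =
      κ ^ d * (S.map fun x => eval (p x • W - q x • U) f).prod := by
  rw [Polynomial.resultant_C_mul_left]
  congr 1
  induction S using Multiset.induction_on with
  | empty => simp [Polynomial.resultant_zero_left_deg]
  | cons x S ih =>
    rw [Multiset.map_cons, Multiset.prod_cons, Multiset.card_cons,
      add_comm S.card 1,
      resultant_mul_of_natDegree_le (natDegree_linear_le _ _) _ (linePoly_natDegree_le hfd W U),
      Multiset.map_cons, Multiset.prod_cons, ih, resultant_linear_linePoly hfd]
    refine (Polynomial.natDegree_multiset_prod_le _).trans ?_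
    rw [Multiset.map_map]
    refine (Multiset.sum_le_card_nsmul _ 1 ?_).trans (by simp)
    intro y hy
    obtain ⟨z, -, rfl⟩ := Multiset.mem_map.1 hy
    exact natDegree_linear_le _ _

end BinaryForms

section CrossProduct

variable {k : Type*} [Field k]

/-- The cross product of three covectors in dimension four. -/
def cross (a b c : Fin 4 → k) : Fin 4 → k :=
  ![a 1 * (b 2 * c 3 - b 3 * c 2) - a 2 * (b 1 * c 3 - b 3 * c 1) + a 3 * (b 1 * c 2 - b 2 * c 1),
    -(a 0 * (b 2 * c 3 - b 3 * c 2) - a 2 * (b 0 * c 3 - b 3 * c 0) +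
      a 3 * (b 0 * c 2 - b 2 * c 0)),
    a 0 * (b 1 * c 3 - b 3 * c 1) - a 1 * (b 0 * c 3 - b 3 * c 0) + a 3 * (b 0 * c 1 - b 1 * c 0),
    -(a 0 * (b 1 * c 2 - b 2 * c 1) - a 1 * (b 0 * c 2 - b 2 * c 0) +
      a 2 * (b 0 * c 1 - b 1 * c 0))]

lemma cross_dotProduct (a b c : Fin 4 → k) :
    a ⬝ᵥ cross a b c = 0 ∧ b ⬝ᵥ cross a b c = 0 ∧ c ⬝ᵥ cross a b c = 0 := by
  simp only [dotProduct, Fin.sum_univ_four, cross, Matrix.cons_val]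
  refine ⟨?_, ?_, ?_⟩ <;> ring

lemma cross_eq_smul_sub_smul {ℓ g P : Fin 4 → k} (hℓ : ℓ ⬝ᵥ P = 0) (hg : g ⬝ᵥ P = 0)
    (l l₀ : Fin 4 → k) :
    (l₀ ⬝ᵥ P) • cross ℓ g l = (l ⬝ᵥ P) • cross ℓ g l₀ - (l ⬝ᵥ cross ℓ g l₀) • P := by
  ext i
  have e1 := congrArg (fun x => x * cross g l l₀ i) hℓ
  have e2 := congrArg (fun x => x * cross ℓ l l₀ i) hg
  fin_cases i <;>
  · simp only [dotProduct, Fin.sum_univ_four, cross, Pi.sub_apply, Pi.smul_apply, smul_eq_mul,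
      Fin.zero_eta, Fin.mk_one, Fin.reduceFinMk, Matrix.cons_val] at e1 e2 ⊢
    linear_combination e1 - e2

lemma cross_ne_zero {ℓ g l₀ P x y : Fin 4 → k} (hℓ : ℓ ⬝ᵥ P = 0) (hg : g ⬝ᵥ P = 0)
    (h₀ : l₀ ⬝ᵥ P = 1) (hx : g ⬝ᵥ x = 0) (hx' : ℓ ⬝ᵥ x ≠ 0) (hy : g ⬝ᵥ y ≠ 0) :
    cross ℓ g l₀ ≠ 0 := by
  intro h
  have hz : ∀ l : Fin 4 → k, cross ℓ g l = 0 := fun l => by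
    have := cross_eq_smul_sub_smul hℓ hg l l₀
    rw [h₀, one_smul, h] at this
    simpa using this
  have hm : ∀ i j, ℓ i * g j = ℓ j * g i := by
    have h0 := hz (Pi.single 0 1)
    have h1 := hz (Pi.single 1 1)
    have h2 := hz (Pi.single 2 1)
    simp only [funext_iff, Fin.forall_fin_succ, cross, Pi.single_apply] at h0 h1 h2
    simp at h0 h1 h2
    intro i j
    fin_cases i <;> fin_cases j <;> simp <;> grind
  refine mul_ne_zero hx' hy ?_
  have : (ℓ ⬝ᵥ x) * (g ⬝ᵥ y) = (ℓ ⬝ᵥ y) * (g ⬝ᵥ x) := by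
    simp only [dotProduct, Finset.sum_mul_sum]
    rw [Finset.sum_comm]
    refine Finset.sum_congr rfl fun j _ => Finset.sum_congr rfl fun i _ => ?_
    linear_combination x i * y j * hm i j
  rw [this, hx, mul_zero]

lemma eq_smul_cross {ℓ g l₀ v : Fin 4 → k} (hc : cross ℓ g l₀ ≠ 0) (hℓ : ℓ ⬝ᵥ v = 0)
    (hg : g ⬝ᵥ v = 0) (h₀ : l₀ ⬝ᵥ v = 0) : ∃ r : k, v = r • cross ℓ g l₀ := by
  obtain ⟨i, hi⟩ := Function.ne_iff.1 hc
  have key := cross_eq_smul_sub_smul hℓ hg (Pi.single i 1) l₀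
  rw [h₀, zero_smul, single_one_dotProduct, single_one_dotProduct] at key
  refine ⟨v i / cross ℓ g l₀ i, ?_⟩
  rw [div_eq_inv_mul, mul_smul, sub_eq_zero.1 key.symm, inv_smul_smul₀ hi]

lemma cross_curve (ℓ g : Fin 4 → k) (τ : k) :
    let A : Fin 4 → k := ![-τ - τ ^ 4 - τ ^ 6, 1, τ ^ 2, τ ^ 3]
    let B : Fin 4 → k := ![-τ ^ 2, 0, 1, 0]
    let C : Fin 4 → k := ![-τ ^ 3, 0, 0, 1]
    let l : Fin 4 → k := ![1, τ, τ ^ 2, τ ^ 3]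
    let U := (g ⬝ᵥ B) • A - (g ⬝ᵥ A) • B
    let W := (g ⬝ᵥ C) • A - (g ⬝ᵥ A) • C
    (ℓ ⬝ᵥ U) • W - (ℓ ⬝ᵥ W) • U = (g ⬝ᵥ A) • cross ℓ g l := by
  intro A B C l U W
  ext i
  fin_cases i <;>
  · simp [dotProduct, Fin.sum_univ_four, cross, A, B, C, l, U, W]
    ring

end CrossProduct

section ResultantForm

variable {k A B : Type*} [CommRing k] [CommRing A] [CommRing B] [Algebra k A] [Algebra k B]

/-- The gradient of `f` at `P`. -/
noncomputable def grad (f : MvPolynomial (Fin 4) k) (P : Fin 4 → A) : Fin 4 → A :=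
  fun i => aeval P (pderiv i f)

/-- The linear form with coefficients on the twisted cubic. -/
def curveForm (τ : A) : Fin 4 → A := ![1, τ, τ ^ 2, τ ^ 3]

/-- The first of three vectors spanning the plane of zeros of `curveForm`. -/
def curveVec₀ (τ : A) : Fin 4 → A := ![-τ - τ ^ 4 - τ ^ 6, 1, τ ^ 2, τ ^ 3]

/-- The second of three vectors spanning the plane of zeros of `curveForm`. -/
def curveVec₁ (τ : A) : Fin 4 → A := ![-τ ^ 2, 0, 1, 0]

/-- The third of three vectors spanning the plane of zeros of `curveForm`. -/
def curveVec₂ (τ : A) : Fin 4 → A := ![-τ ^ 3, 0, 0, 1]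

/-- The first of two vectors in the intersection of the tangent plane at `P` with a moving plane. -/
noncomputable def tangentVec₁ (f : MvPolynomial (Fin 4) k) (P : Fin 4 → A) (τ : A) : Fin 4 → A :=
  (grad f P ⬝ᵥ curveVec₁ τ) • curveVec₀ τ - (grad f P ⬝ᵥ curveVec₀ τ) • curveVec₁ τ

/-- The second of two vectors in the intersection of the tangent plane at `P` with a moving plane. -/
noncomputable def tangentVec₂ (f : MvPolynomial (Fin 4) k) (P : Fin 4 → A) (τ : A) : Fin 4 → A :=
  (grad f P ⬝ᵥ curveVec₂ τ) • curveVec₀ τ - (grad f P ⬝ᵥ curveVec₀ τ) • curveVec₂ τ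

/-- The polar term of degree `a` of `f` at `P` on the pencil of vectors `W + x U`. -/
noncomputable def polarPoly (f : MvPolynomial (Fin 4) k) (a : ℕ) (P W U : Fin 4 → A) :
    Polynomial A :=
  (linePoly f (fun i => Polynomial.C (P i))
    (fun i => Polynomial.C (W i) + Polynomial.C (U i) * Polynomial.X)).coeff a

/-- The resultant of the polar term of degree `a` at `P` with `f` on the intersection of the
tangent plane at `P` with a moving plane. -/
noncomputable def polarRes (f : MvPolynomial (Fin 4) k) (d a : ℕ) (P : Fin 4 → A) (τ : A) : A :=
  (polarPoly f a P (tangentVec₂ f P τ) (tangentVec₁ f P τ)).resultant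
    (linePoly f (tangentVec₂ f P τ) (tangentVec₁ f P τ)) a d

/-- The extraneous factor of `polarRes` on a smooth surface. -/
noncomputable def polarExtra (f : MvPolynomial (Fin 4) k) (d a : ℕ) (P : Fin 4 → A) (τ : A) : A :=
  ((grad f P ⬝ᵥ curveVec₀ τ) ^ d * (curveForm τ ⬝ᵥ P) ^ (a + 1)) ^ a

variable (f : MvPolynomial (Fin 4) k) (φ : A →ₐ[k] B)

lemma map_grad (P : Fin 4 → A) (i : Fin 4) : φ (grad f P i) = grad f (fun j => φ (P j)) i := by
  rw [grad, grad, comp_aeval_apply]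

lemma map_dotProduct' (v w : Fin 4 → A) :
    φ (v ⬝ᵥ w) = (fun i => φ (v i)) ⬝ᵥ (fun i => φ (w i)) := by
  simp [dotProduct]

lemma map_curveForm (τ : A) : (fun i => φ (curveForm τ i)) = curveForm (φ τ) := by
  ext i
  fin_cases i <;> simp [curveForm]

lemma map_curveVec₀ (τ : A) : (fun i => φ (curveVec₀ τ i)) = curveVec₀ (φ τ) := by
  ext i
  fin_cases i <;> simp [curveVec₀]

lemma map_curveVec₁ (τ : A) : (fun i => φ (curveVec₁ τ i)) = curveVec₁ (φ τ) := by
  ext i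
  fin_cases i <;> simp [curveVec₁]

lemma map_curveVec₂ (τ : A) : (fun i => φ (curveVec₂ τ i)) = curveVec₂ (φ τ) := by
  ext i
  fin_cases i <;> simp [curveVec₂]

lemma map_tangentVec₁ (P : Fin 4 → A) (τ : A) :
    (fun i => φ (tangentVec₁ f P τ i)) = tangentVec₁ f (fun i => φ (P i)) (φ τ) := by
  ext i
  simp only [tangentVec₁, Pi.sub_apply, Pi.smul_apply, smul_eq_mul, map_sub, map_mul,
    map_dotProduct', map_grad]
  rw [← map_curveVec₀, ← map_curveVec₁]

lemma map_tangentVec₂ (P : Fin 4 → A) (τ : A) :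
    (fun i => φ (tangentVec₂ f P τ i)) = tangentVec₂ f (fun i => φ (P i)) (φ τ) := by
  ext i
  simp only [tangentVec₂, Pi.sub_apply, Pi.smul_apply, smul_eq_mul, map_sub, map_mul,
    map_dotProduct', map_grad]
  rw [← map_curveVec₀, ← map_curveVec₂]

lemma map_polarPoly (a : ℕ) (P W U : Fin 4 → A) :
    (polarPoly f a P W U).map (φ : A →+* B) =
      polarPoly f a (fun i => φ (P i)) (fun i => φ (W i)) (fun i => φ (U i)) := by
  have h := linePoly_map f (fun i => Polynomial.C (P i))
    (fun i => Polynomial.C (W i) + Polynomial.C (U i) * Polynomial.X) (Polynomial.mapAlgHom φ)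
  have h' := congrArg (fun p => p.coeff a) h
  simp only [Polynomial.coeff_map] at h'
  rw [polarPoly, polarPoly]
  convert h' using 3 <;> simp

lemma map_polarRes (d a : ℕ) (P : Fin 4 → A) (τ : A) :
    φ (polarRes f d a P τ) = polarRes f d a (fun i => φ (P i)) (φ τ) := by
  rw [polarRes, polarRes, ← map_tangentVec₁, ← map_tangentVec₂, ← map_polarPoly, ← linePoly_map,
    Polynomial.resultant_map_map]
  rfl

lemma map_polarExtra (d a : ℕ) (P : Fin 4 → A) (τ : A) :
    φ (polarExtra f d a P τ) = polarExtra f d a (fun i => φ (P i)) (φ τ) := by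
  simp only [polarExtra, map_pow, map_mul, map_dotProduct', map_grad]
  rw [← map_curveVec₀, ← map_curveForm]

lemma eval_polarPoly (a : ℕ) (P W U : Fin 4 → A) (x : A) :
    (polarPoly f a P W U).eval x = (linePoly f P (fun i => W i + U i * x)).coeff a := by
  have h := linePoly_map f (fun i => Polynomial.C (P i))
    (fun i => Polynomial.C (W i) + Polynomial.C (U i) * Polynomial.X)
    ((Polynomial.aeval x).restrictScalars k : Polynomial A →ₐ[k] A)
  have h' := congrArg (fun p => p.coeff a) h
  simp only [Polynomial.coeff_map] at h'
  rw [polarPoly]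
  convert h' using 3 <;> simp

lemma grad_dotProduct_tangentVec (P : Fin 4 → A) (τ : A) :
    grad f P ⬝ᵥ tangentVec₁ f P τ = 0 ∧ grad f P ⬝ᵥ tangentVec₂ f P τ = 0 := by
  simp only [tangentVec₁, tangentVec₂, dotProduct_sub, dotProduct_smul, smul_eq_mul]
  constructor <;> ring

lemma linePoly_coeff_one_eq_grad (P u : Fin 4 → A) :
    (linePoly f P u).coeff 1 = grad f P ⬝ᵥ u := by
  rw [linePoly_coeff_one, dotProduct]
  exact Finset.sum_congr rfl fun i _ => mul_comm _ _

variable {f}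

lemma grad_smul {d : ℕ} (hfd : f.IsHomogeneous d) (r : A) (P : Fin 4 → A) :
    grad f (r • P) = r ^ (d - 1) • grad f P := by
  ext i
  have : (pderiv i f).IsHomogeneous (d - 1) := hfd.pderiv
  have h := aeval_comb this P 0 r 0
  have h' := linePoly_coeff_zero (pderiv i f) P 0
  simp only [Pi.smul_apply, smul_eq_mul, grad]
  have e : (fun i => P i * r + (0 : Fin 4 → A) i * 0) = r • P := by
    ext j
    simp [mul_comm]
  rw [e] at h
  rw [h, Finset.sum_eq_single 0, h', Nat.sub_zero, pow_zero]
  · ring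
  · intro j _ hj
    rw [zero_pow hj, mul_zero]
  · simp

lemma tangentVec_smul {d : ℕ} (hfd : f.IsHomogeneous d) (r : A) (P : Fin 4 → A) (τ : A) :
    tangentVec₁ f (r • P) τ = r ^ (d - 1) • tangentVec₁ f P τ ∧
      tangentVec₂ f (r • P) τ = r ^ (d - 1) • tangentVec₂ f P τ := by
  simp only [tangentVec₁, tangentVec₂, grad_smul hfd, smul_dotProduct, smul_eq_mul, mul_smul,
    smul_sub, and_self]

end ResultantForm

section ResultantFormField

variable {k : Type*} [Field k] {f : MvPolynomial (Fin 4) k} {d a : ℕ}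

lemma linePoly_coeff_smul_smul (hfd : f.IsHomogeneous d) (ha : a ≤ d) (r s : k)
    (P u : Fin 4 → k) :
    (linePoly f (r • P) (s • u)).coeff a = (linePoly f P u).coeff a * r ^ (d - a) * s ^ a := by
  rw [← linePoly_coeff_smul hfd P u r s ha]
  congr 2 <;> ext i <;> simp [mul_comm]

lemma polarPoly_eval' (a : ℕ) (P W U : Fin 4 → k) (x : k) :
    (polarPoly f a P W U).eval x = (linePoly f P (W + x • U)).coeff a := by
  rw [eval_polarPoly]
  congr 2
  ext i
  simp [mul_comm]

lemma polarRes_smul [Infinite k] (hfd : f.IsHomogeneous d) (ha : a ≤ d) (r : k) (P : Fin 4 → k)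
    (τ : k) : polarRes f d a (r • P) τ =
      r ^ ((d - a + (d - 1) * a) * d + (d - 1) * d * a) * polarRes f d a P τ := by
  obtain ⟨h1, h2⟩ := tangentVec_smul hfd r P τ
  rw [polarRes, polarRes, h1, h2]
  set U := tangentVec₁ f P τ
  set W := tangentVec₂ f P τ
  have e1 : polarPoly f a (r • P) (r ^ (d - 1) • W) (r ^ (d - 1) • U) =
      Polynomial.C (r ^ (d - a + (d - 1) * a)) * polarPoly f a P W U := by
    refine Polynomial.funext fun x => ?_
    rw [polarPoly_eval', Polynomial.eval_mul, Polynomial.eval_C, polarPoly_eval', smul_comm x,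
      ← smul_add, linePoly_coeff_smul_smul hfd ha, pow_add, pow_mul]
    ring
  have e2 : linePoly f (r ^ (d - 1) • W) (r ^ (d - 1) • U) =
      Polynomial.C (r ^ ((d - 1) * d)) * linePoly f W U := by
    refine Polynomial.funext fun x => ?_
    rw [linePoly_eval', Polynomial.eval_mul, Polynomial.eval_C, linePoly_eval', smul_comm x,
      ← smul_add, eval_smul_of_isHomogeneous hfd, pow_mul]
  rw [e1, e2, Polynomial.resultant_C_mul_left, Polynomial.resultant_C_mul_right, ← pow_mul,
    ← pow_mul, pow_add]
  ring

lemma polarExtra_smul (hfd : f.IsHomogeneous d) (r : k) (P : Fin 4 → k) (τ : k) :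
    polarExtra f d a (r • P) τ =
      r ^ (((d - 1) * d + (a + 1)) * a) * polarExtra f d a P τ := by
  rw [polarExtra, polarExtra, grad_smul hfd, smul_dotProduct, dotProduct_smul, smul_eq_mul,
    smul_eq_mul, pow_mul _ _ a, ← mul_pow, pow_add _ _ (a + 1), pow_mul, mul_pow, mul_pow]
  ring

lemma dotProduct_eq_zero_of_forall {v : Fin 4 → k} [Infinite k]
    (h : ∀ τ : k, curveForm τ ⬝ᵥ v = 0) : v = 0 := by
  have hp : Polynomial.C (v 0) + Polynomial.C (v 1) * Polynomial.X +
      Polynomial.C (v 2) * Polynomial.X ^ 2 + Polynomial.C (v 3) * Polynomial.X ^ 3 = 0 := by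
    refine Polynomial.funext fun τ => ?_
    have := h τ
    simp only [dotProduct, Fin.sum_univ_four, curveForm, Matrix.cons_val] at this
    simp only [Polynomial.eval_add, Polynomial.eval_mul, Polynomial.eval_C, Polynomial.eval_X,
      Polynomial.eval_pow, Polynomial.eval_zero]
    linear_combination this
  have hc := fun i => congrArg (fun p => Polynomial.coeff p i) hp
  have h0 := hc 0
  have h1 := hc 1
  have h2 := hc 2
  have h3 := hc 3
  simp [Polynomial.coeff_X, Polynomial.coeff_C] at h0 h1 h2 h3
  ext i
  fin_cases i <;> simp [*]

lemma curveVec₀_dotProduct_eq_zero_of_forall {v : Fin 4 → k} [Infinite k]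
    (h : ∀ τ : k, v ⬝ᵥ curveVec₀ τ = 0) : v = 0 := by
  have hp : Polynomial.C (v 0) * (-Polynomial.X - Polynomial.X ^ 4 - Polynomial.X ^ 6) +
      Polynomial.C (v 1) +
      Polynomial.C (v 2) * Polynomial.X ^ 2 + Polynomial.C (v 3) * Polynomial.X ^ 3 = 0 := by
    refine Polynomial.funext fun τ => ?_
    have := h τ
    simp only [dotProduct, Fin.sum_univ_four, curveVec₀, Matrix.cons_val] at this
    simp only [Polynomial.eval_add, Polynomial.eval_sub, Polynomial.eval_neg, Polynomial.eval_mul,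
      Polynomial.eval_C, Polynomial.eval_X, Polynomial.eval_pow, Polynomial.eval_zero]
    linear_combination this
  have hc := fun i => congrArg (fun p => Polynomial.coeff p i) hp
  have h0 := hc 0
  have h1 := hc 1
  have h2 := hc 2
  have h3 := hc 3
  simp [Polynomial.coeff_X, Polynomial.coeff_C] at h0 h1 h2 h3
  ext i
  fin_cases i <;> simp [*]

/-- `polarRes` and `polarExtra` at the generic point. -/
lemma exists_generic_polarRes (f : MvPolynomial (Fin 4) k) (d a : ℕ) :
    ∃ G D : MvPolynomial (Option (Fin 4)) k,
      (∀ P, pencil G P = polarRes f d a (fun i => Polynomial.C (P i)) Polynomial.X) ∧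
      (∀ P, pencil D P = polarExtra f d a (fun i => Polynomial.C (P i)) Polynomial.X) := by
  refine ⟨polarRes f d a (fun i => X (some i)) (X none),
    polarExtra f d a (fun i => X (some i)) (X none), fun P => ?_, fun P => ?_⟩
  · rw [pencil, map_polarRes]
    simp
  · rw [pencil, map_polarExtra]
    simp

lemma eval_polarRes (P : Fin 4 → k) (τ : k) :
    (polarRes f d a (fun i => Polynomial.C (P i)) Polynomial.X).eval τ = polarRes f d a P τ := by
  have := map_polarRes f ((Polynomial.aeval τ : Polynomial k →ₐ[k] k)) d a
    (fun i => Polynomial.C (P i)) Polynomial.X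
  simpa using this

lemma eval_polarExtra (P : Fin 4 → k) (τ : k) :
    (polarExtra f d a (fun i => Polynomial.C (P i)) Polynomial.X).eval τ =
      polarExtra f d a P τ := by
  have := map_polarExtra f ((Polynomial.aeval τ : Polynomial k →ₐ[k] k)) d a
    (fun i => Polynomial.C (P i)) Polynomial.X
  simpa using this

end ResultantFormField

section LocalFactorization

variable {k : Type*} [Field k] {f : MvPolynomial (Fin 4) k} {d a : ℕ}

lemma eval_comb (hfd : f.IsHomogeneous d) (P u : Fin 4 → k) (α β : k) :
    eval (α • P + β • u) f =
      ∑ j ∈ Finset.range (d + 1), (linePoly f P u).coeff j * α ^ (d - j) * β ^ j := by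
  rw [← aeval_comb hfd]
  change _ = eval _ f
  congr 2
  ext i
  simp [mul_comm]

/-- If the lower polar terms vanish on the tangent plane, the polar term of degree `a` is
well-defined modulo the base point. -/
lemma linePoly_coeff_add_smul (hfd : f.IsHomogeneous d) (ha : a ≤ d) {P u : Fin 4 → k}
    (h : ∀ j < a, (linePoly f P u).coeff j = 0) (x : k) :
    (linePoly f P (u + x • P)).coeff a = (linePoly f P u).coeff a := by
  have h1 : linePoly f P (u + x • P) = aeval (fun i => Polynomial.C (P i) *
      (1 + Polynomial.C x * Polynomial.X) + Polynomial.C (u i) * Polynomial.X) f := by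
    rw [linePoly]
    congr 2
    ext1 i
    simp only [Pi.add_apply, Pi.smul_apply, smul_eq_mul, map_add, map_mul]
    ring
  rw [h1, linePoly_C_comb hfd, Polynomial.finsetSum_coeff, Finset.sum_eq_single a]
  · rw [Polynomial.coeff_mul_X_pow', if_pos le_rfl, Nat.sub_self, Polynomial.coeff_C_mul]
    simp [Polynomial.coeff_zero_eq_eval_zero]
  · intro j _ hj
    rcases lt_or_gt_of_ne hj with hj | hj
    · simp [h j hj]
    · rw [Polynomial.coeff_mul_X_pow', if_neg (by lia)]
  · intro h'
    simp at h'
    lia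

variable [IsAlgClosed k]

/-- The lowest polar term at a point of a smooth surface is a product of linear forms on the
tangent plane. -/
lemma exists_polar_factorization (hfd : f.IsHomogeneous d) (ha : a ≤ d) {P : Fin 4 → k}
    (hP : P ≠ 0) (hg : grad f P ≠ 0) (hgP : grad f P ⬝ᵥ P = 0)
    (h : ∀ u, grad f P ⬝ᵥ u = 0 → ∀ j < a, (linePoly f P u).coeff j = 0) :
    ∃ (κ : k) (S : Multiset (Fin 4 → k)), S.card = a ∧
      (∀ ℓ ∈ S, ℓ ⬝ᵥ P = 0 ∧ ∃ x, grad f P ⬝ᵥ x = 0 ∧ ℓ ⬝ᵥ x ≠ 0) ∧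
      ∀ u, grad f P ⬝ᵥ u = 0 →
        (linePoly f P u).coeff a = κ * (S.map fun ℓ => ℓ ⬝ᵥ u).prod := by
  obtain ⟨n, b, i, j, hij, hbi, hbj⟩ := exists_basis_of_pairing_eq_zero
    (f := dotProductEquiv k (Fin 4) (grad f P)) (v := P) hgP (by simpa using hg) hP
  have : Fintype n := FiniteDimensional.fintypeBasisIndex b
  have hcard : Fintype.card n = 4 := by
    rw [← Module.finrank_eq_card_basis b]
    simp
  classical
  obtain ⟨e₁, e₂, he, hn⟩ : ∃ e₁ e₂, e₁ ≠ e₂ ∧ (Finset.univ.erase i).erase j = {e₁, e₂} := by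
    refine Finset.card_eq_two.1 ?_
    rw [Finset.card_erase_of_mem (by simp [hij.symm]), Finset.card_erase_of_mem (by simp),
      Finset.card_univ, hcard]
  have hmem : ∀ x, (x ≠ j ∧ x ≠ i) ↔ x = e₁ ∨ x = e₂ := fun x => by
    simpa using congrArg (fun s => x ∈ s) hn
  have he1 := (hmem e₁).2 (Or.inl rfl)
  have he2 := (hmem e₂).2 (Or.inr rfl)
  have huniv : (Finset.univ : Finset n) = {i, j, e₁, e₂} := by
    ext x
    have := hmem x
    simp
    tauto
  have hgrad : ∀ u, grad f P ⬝ᵥ u = b.coord j u := fun u => by rw [← hbj]; rfl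
  let c : n → Fin 4 → k := fun x => (dotProductEquiv k (Fin 4)).symm (b.coord x)
  have hc : ∀ x u, c x ⬝ᵥ u = b.coord x u := fun x u => by
    have := (dotProductEquiv k (Fin 4)).apply_symm_apply (b.coord x)
    exact LinearMap.congr_fun this u
  have hexp : ∀ u, grad f P ⬝ᵥ u = 0 →
      u = (c e₁ ⬝ᵥ u) • b e₁ + (c e₂ ⬝ᵥ u) • b e₂ + (b.coord i u) • P := by
    intro u hu
    rw [hgrad, Module.Basis.coord_apply] at hu
    conv_lhs => rw [← b.sum_repr u, huniv]
    rw [Finset.sum_insert (by simp [hij, he1.2.symm, he2.2.symm]),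
      Finset.sum_insert (by simp [he1.1.symm, he2.1.symm]), Finset.sum_pair he, hu, hc, hc, hbi]
    simp only [Module.Basis.coord_apply, zero_smul]
    abel
  have hge : ∀ y z : k, grad f P ⬝ᵥ (y • b e₁ + z • b e₂) = 0 := fun y z => by
    rw [hgrad]
    simp [he1.1, he2.1]
  obtain ⟨κ, S, hS, hS0, hprod⟩ := exists_binary_factorization (a := a)
    (fun y z => (linePoly f P (y • b e₁ + z • b e₂)).coeff a)
    (fun r y z => by
      have := linePoly_coeff_smul_smul hfd ha 1 r P (y • b e₁ + z • b e₂)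
      rw [one_smul, smul_add, smul_smul, smul_smul, one_pow, mul_one] at this
      rw [this, mul_comm])
    (polarPoly f a P (b e₁) (b e₂)) (polarPoly f a P (b e₂) (b e₁))
    (fun t => by rw [polarPoly_eval', one_smul])
    (fun t => by rw [polarPoly_eval', one_smul, add_comm])
  refine ⟨κ, S.map fun x => x.2 • c e₁ - x.1 • c e₂, by simpa using hS, ?_, fun u hu => ?_⟩
  · intro ℓ hℓ
    obtain ⟨x, hx, rfl⟩ := Multiset.mem_map.1 hℓ
    have hval : ∀ v, (x.2 • c e₁ - x.1 • c e₂) ⬝ᵥ v =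
        x.2 * b.coord e₁ v - x.1 * b.coord e₂ v := fun v => by
      rw [sub_dotProduct, smul_dotProduct, smul_dotProduct, hc, hc]
      rfl
    refine ⟨?_, ?_⟩
    · rw [hval, hbi]
      simp [he1.2.symm, he2.2.symm]
    · by_cases h2 : x.2 = 0
      · have h1 : x.1 ≠ 0 := fun h1 => hS0 x hx (Prod.ext h1 h2)
        refine ⟨b e₂, by simpa using hge 0 1, ?_⟩
        rw [hval]
        simpa [h2, he] using h1
      · refine ⟨b e₁, by simpa using hge 1 0, ?_⟩
        rw [hval]
        simpa [he] using h2
  · have h1 : (linePoly f P u).coeff a =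
        (linePoly f P ((c e₁ ⬝ᵥ u) • b e₁ + (c e₂ ⬝ᵥ u) • b e₂)).coeff a := by
      conv_lhs => rw [hexp u hu]
      exact linePoly_coeff_add_smul hfd ha (h _ (hge _ _)) _
    rw [h1]
    refine (hprod _ _).trans ?_
    rw [Multiset.map_map]
    congr 2
    refine Multiset.map_congr rfl fun x _ => ?_
    simp [sub_dotProduct, smul_dotProduct]

/-- The value of the resultant at a point of a smooth surface, in terms of a factorization of the
polar term. -/
lemma polarRes_eq (hfd : f.IsHomogeneous d) {P l₀ : Fin 4 → k}
    (hgP : grad f P ⬝ᵥ P = 0) (hl₀ : l₀ ⬝ᵥ P = 1) {κ : k} {S : Multiset (Fin 4 → k)}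
    (hS : S.card = a) (hSP : ∀ ℓ ∈ S, ℓ ⬝ᵥ P = 0)
    (h : ∀ u, grad f P ⬝ᵥ u = 0 →
        (linePoly f P u).coeff a = κ * (S.map fun ℓ => ℓ ⬝ᵥ u).prod) (τ : k) :
    polarRes f d a P τ = κ ^ d * (S.map fun ℓ => (grad f P ⬝ᵥ curveVec₀ τ) ^ d *
      eval ((-(curveForm τ ⬝ᵥ cross ℓ (grad f P) l₀)) • P +
        (curveForm τ ⬝ᵥ P) • cross ℓ (grad f P) l₀) f).prod := by
  obtain ⟨hU, hW⟩ := grad_dotProduct_tangentVec f P τ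
  have h1 : polarPoly f a P (tangentVec₂ f P τ) (tangentVec₁ f P τ) = Polynomial.C κ *
      (S.map fun ℓ => Polynomial.C (ℓ ⬝ᵥ tangentVec₂ f P τ) +
        Polynomial.C (ℓ ⬝ᵥ tangentVec₁ f P τ) * Polynomial.X).prod := by
    refine Polynomial.funext fun x => ?_
    rw [polarPoly_eval', h _ (by rw [dotProduct_add, dotProduct_smul, hU, hW]; simp),
      Polynomial.eval_mul, Polynomial.eval_C, Polynomial.eval_multiset_prod, Multiset.map_map]
    congr 2
    refine Multiset.map_congr rfl fun ℓ _ => ?_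
    simp only [Function.comp, dotProduct_add, dotProduct_smul, smul_eq_mul, Polynomial.eval_add,
      Polynomial.eval_mul, Polynomial.eval_C, Polynomial.eval_X, mul_comm x]
  rw [polarRes, h1, ← hS, resultant_prod_linear_linePoly hfd]
  congr 2
  refine Multiset.map_congr rfl fun ℓ hℓ => ?_
  have hc := cross_curve ℓ (grad f P) τ
  have e : (ℓ ⬝ᵥ tangentVec₁ f P τ) • tangentVec₂ f P τ -
      (ℓ ⬝ᵥ tangentVec₂ f P τ) • tangentVec₁ f P τ =
      (grad f P ⬝ᵥ curveVec₀ τ) • cross ℓ (grad f P) (curveForm τ) := hc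
  have hs := cross_eq_smul_sub_smul (hSP ℓ hℓ) hgP (curveForm τ) l₀
  rw [hl₀, one_smul] at hs
  rw [e, eval_smul_of_isHomogeneous hfd, hs]
  congr 3
  module

end LocalFactorization

section PencilFactorization

variable {k : Type*} [Field k] {f : MvPolynomial (Fin 4) k} {d a : ℕ}

/-- The linear form with coefficients on the twisted cubic as a polynomial in the parameter. -/
noncomputable def curvePoly (v : Fin 4 → k) : Polynomial k :=
  curveForm Polynomial.X ⬝ᵥ fun i => Polynomial.C (v i)

/-- The value of a covector at `curveVec₀` as a polynomial in the parameter. -/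
noncomputable def covecPoly (v : Fin 4 → k) : Polynomial k :=
  (fun i => Polynomial.C (v i)) ⬝ᵥ curveVec₀ Polynomial.X

lemma eval_curvePoly (v : Fin 4 → k) (τ : k) : (curvePoly v).eval τ = curveForm τ ⬝ᵥ v := by
  simp [curvePoly, dotProduct, Fin.sum_univ_four, curveForm]
  ring

lemma eval_covecPoly (v : Fin 4 → k) (τ : k) : (covecPoly v).eval τ = v ⬝ᵥ curveVec₀ τ := by
  simp [covecPoly, dotProduct, Fin.sum_univ_four, curveVec₀]

lemma curvePoly_ne_zero [Infinite k] {v : Fin 4 → k} (hv : v ≠ 0) : curvePoly v ≠ 0 := fun h =>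
  hv (dotProduct_eq_zero_of_forall fun τ => by rw [← eval_curvePoly, h, Polynomial.eval_zero])

lemma covecPoly_ne_zero [Infinite k] {v : Fin 4 → k} (hv : v ≠ 0) : covecPoly v ≠ 0 := fun h =>
  hv (curveVec₀_dotProduct_eq_zero_of_forall fun τ => by
    rw [← eval_covecPoly, h, Polynomial.eval_zero])

/-- The value of `f` at the intersection point of the line through `P` and `θ` with a moving
plane, as a polynomial in the parameter. -/
noncomputable def curveValue (f : MvPolynomial (Fin 4) k) (P θ : Fin 4 → k) : Polynomial k :=
  aeval (fun i => Polynomial.C (P i) * -curvePoly θ + Polynomial.C (θ i) * curvePoly P) f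

lemma eval_curveValue (P θ : Fin 4 → k) (τ : k) :
    (curveValue f P θ).eval τ =
      eval ((-(curveForm τ ⬝ᵥ θ)) • P + (curveForm τ ⬝ᵥ P) • θ) f := by
  refine map_aeval_congr (Polynomial.evalRingHom τ) (RingHom.id k) ?_ ?_ f
  · simp
  · intro i
    simp [eval_curvePoly, mul_comm]

lemma pow_dvd_curveValue (hfd : f.IsHomogeneous d) {P θ : Fin 4 → k}
    (h : ∀ j ≤ a, (linePoly f P θ).coeff j = 0) : curvePoly P ^ (a + 1) ∣ curveValue f P θ := by
  rw [curveValue, linePoly_C_comb hfd]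
  refine Finset.dvd_sum fun j _ => ?_
  rcases le_or_gt j a with hj | hj
  · simp [h j hj]
  · exact Dvd.dvd.mul_left (pow_dvd_pow _ hj) _

lemma polarExtra_eq [Infinite k] (P : Fin 4 → k) :
    polarExtra f d a (fun i => Polynomial.C (P i)) Polynomial.X =
      (covecPoly (grad f P) ^ d * curvePoly P ^ (a + 1)) ^ a := by
  refine Polynomial.funext fun τ => ?_
  rw [eval_polarExtra, polarExtra]
  simp [eval_curvePoly, eval_covecPoly]

lemma curveValue_eq_zero_of_mem {L : Submodule k (Fin 4 → k)} [Infinite k]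
    (hL : ∀ v ∈ L, eval v f = 0) {P θ : Fin 4 → k} (hP : P ∈ L) (hθ : θ ∈ L) :
    curveValue f P θ = 0 := by
  refine Polynomial.funext fun τ => ?_
  rw [eval_curveValue, Polynomial.eval_zero]
  exact hL _ (L.add_mem (L.smul_mem _ hP) (L.smul_mem _ hθ))

lemma exists_dotProduct_eq_one {P : Fin 4 → k} (hP : P ≠ 0) : ∃ l₀ : Fin 4 → k, l₀ ⬝ᵥ P = 1 := by
  obtain ⟨i, hi⟩ := Function.ne_iff.1 hP
  refine ⟨Pi.single i (P i)⁻¹, ?_⟩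
  rw [single_dotProduct]
  exact inv_mul_cancel₀ hi

lemma IsSmoothSurface.grad_ne_zero (hf : IsSmoothSurface f d) {P : Fin 4 → k} (hP : P ≠ 0)
    (hfP : eval P f = 0) : grad f P ≠ 0 := fun h =>
  hf.2.2 P hP ⟨hfP, fun i => congrFun h i⟩

variable [IsAlgClosed k]

/-- If `f` vanishes at the moving point of a line then it vanishes on the line. -/
lemma eval_eq_zero_of_curveValue_eq_zero (hfd : f.IsHomogeneous d) {P θ l₀ : Fin 4 → k}
    (hP : l₀ ⬝ᵥ P = 1) (hθ : l₀ ⬝ᵥ θ = 0) (hθ0 : θ ≠ 0) (h : curveValue f P θ = 0) (α β : k) :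
    eval (α • P + β • θ) f = 0 := by
  have : Infinite k := IsAlgClosed.instInfinite
  obtain ⟨κ, S, -, hS0, hprod⟩ := exists_binary_factorization (a := d)
    (fun y z => eval (y • P + z • θ) f)
    (fun r y z => by
      simp only [mul_smul, ← smul_add]
      exact eval_smul_of_isHomogeneous hfd _ _)
    (linePoly f P θ) (linePoly f θ P)
    (fun t => by rw [linePoly_eval', one_smul])
    (fun t => by rw [linePoly_eval', one_smul, add_comm])
  have hz : Polynomial.C κ * (S.map fun x => curvePoly (-(x.2 • θ + x.1 • P))).prod = 0 := by
    rw [← h]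
    refine Polynomial.funext fun τ => ?_
    rw [eval_curveValue, hprod, Polynomial.eval_mul, Polynomial.eval_C,
      Polynomial.eval_multiset_prod, Multiset.map_map]
    congr 2
    refine Multiset.map_congr rfl fun x _ => ?_
    simp only [Function.comp, eval_curvePoly, dotProduct_neg, dotProduct_add, dotProduct_smul,
      smul_eq_mul]
    ring
  have hκ : κ = 0 := by
    rcases mul_eq_zero.1 hz with h1 | h1
    · exact Polynomial.C_eq_zero.1 h1
    · exfalso
      obtain ⟨x, hx, hx0⟩ := Multiset.mem_map.1 (Multiset.prod_eq_zero_iff.1 h1)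
      by_contra _
      refine curvePoly_ne_zero (fun hxv => hS0 x hx ?_) hx0
      have h2 : x.2 • θ + x.1 • P = 0 := neg_eq_zero.1 hxv
      have h3 : x.1 = 0 := by
        have := congrArg (fun v => l₀ ⬝ᵥ v) h2
        simpa [dotProduct_add, dotProduct_smul, hP, hθ] using this
      have h4 : x.2 = 0 := by
        rw [h3, zero_smul, add_zero] at h2
        exact (smul_eq_zero.1 h2).resolve_right hθ0
      exact Prod.ext h3 h4
  refine (hprod α β).trans ?_
  rw [hκ, zero_mul]

/-- The Euler relation at a point of the surface. -/
lemma grad_dotProduct_self (hfd : f.IsHomogeneous d) {P : Fin 4 → k} (hfP : eval P f = 0) :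
    grad f P ⬝ᵥ P = 0 := by
  have : Infinite k := IsAlgClosed.instInfinite
  rw [← linePoly_coeff_one_eq_grad]
  have : linePoly f P P = 0 := by
    refine Polynomial.funext fun t => ?_
    have e : P + t • P = (1 + t) • P := by module
    rw [linePoly_eval', e, eval_smul_of_isHomogeneous hfd, hfP, mul_zero, Polynomial.eval_zero]
  rw [this, Polynomial.coeff_zero]

/-- The factorization of the pencil of resultants at a point of a smooth surface. -/
lemma exists_pencil_factorization (hf : IsSmoothSurface f d) (ha : a ≤ d)
    (h : ∀ j, 2 ≤ j → j < a → ∀ P u : Fin 4 → k, (linePoly f P u).coeff j = 0)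
    {P : Fin 4 → k} (hP : P ≠ 0) (hfP : eval P f = 0) :
    ∃ (l₀ : Fin 4 → k) (κ : k) (S : Multiset (Fin 4 → k)), l₀ ⬝ᵥ P = 1 ∧ S.card = a ∧
      (∀ θ ∈ S, θ ≠ 0 ∧ grad f P ⬝ᵥ θ = 0 ∧ l₀ ⬝ᵥ θ = 0 ∧ ∀ j ≤ a, (linePoly f P θ).coeff j = 0) ∧
      (κ = 0 → ∀ u, grad f P ⬝ᵥ u = 0 → (linePoly f P u).coeff a = 0) ∧
      (κ ≠ 0 → ∀ v, grad f P ⬝ᵥ v = 0 → l₀ ⬝ᵥ v = 0 → (linePoly f P v).coeff a = 0 →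
        ∃ θ ∈ S, ∃ r : k, v = r • θ) ∧
      polarRes f d a (fun i => Polynomial.C (P i)) Polynomial.X = Polynomial.C κ ^ d *
        (S.map fun θ => covecPoly (grad f P) ^ d * curveValue f P θ).prod := by
  have : Infinite k := IsAlgClosed.instInfinite
  have hfd := hf.2.1
  have hg := hf.grad_ne_zero hP hfP
  have hgP := grad_dotProduct_self hfd hfP
  have hlow : ∀ u, grad f P ⬝ᵥ u = 0 → ∀ j < a, (linePoly f P u).coeff j = 0 := by
    intro u hu j hj
    rcases Nat.lt_or_ge j 2 with h2 | h2
    · interval_cases j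
      · rw [linePoly_coeff_zero]
        exact hfP
      · rw [linePoly_coeff_one_eq_grad, hu]
    · exact h j h2 hj P u
  obtain ⟨l₀, hl₀⟩ := exists_dotProduct_eq_one hP
  obtain ⟨κ, S, hS, hSP, hfac⟩ := exists_polar_factorization hfd ha hP hg hgP hlow
  obtain ⟨y, hy⟩ : ∃ y, grad f P ⬝ᵥ y ≠ 0 := by
    obtain ⟨i, hi⟩ := Function.ne_iff.1 hg
    exact ⟨Pi.single i 1, by simpa using hi⟩
  have hne : ∀ ℓ ∈ S, cross ℓ (grad f P) l₀ ≠ 0 := fun ℓ hℓ => by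
    obtain ⟨hℓP, x, hx, hx'⟩ := hSP ℓ hℓ
    exact cross_ne_zero hℓP hgP hl₀ hx hx' hy
  refine ⟨l₀, κ, S.map fun ℓ => cross ℓ (grad f P) l₀, hl₀, by simpa using hS, ?_, ?_, ?_, ?_⟩
  · intro θ hθ
    obtain ⟨ℓ, hℓ, rfl⟩ := Multiset.mem_map.1 hθ
    obtain ⟨h1, h2, h3⟩ := cross_dotProduct ℓ (grad f P) l₀
    refine ⟨hne ℓ hℓ, h2, h3, fun j hj => ?_⟩
    rcases hj.lt_or_eq with hj | rfl
    · exact hlow _ h2 j hj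
    · rw [hfac _ h2, Multiset.prod_eq_zero, mul_zero]
      exact Multiset.mem_map.2 ⟨ℓ, hℓ, h1⟩
  · intro hκ u hu
    rw [hfac u hu, hκ, zero_mul]
  · intro hκ v hv hv0 hva
    rw [hfac v hv] at hva
    have h0 := (mul_eq_zero.1 hva).resolve_left hκ
    obtain ⟨ℓ, hℓ, hℓv⟩ := Multiset.mem_map.1 (Multiset.prod_eq_zero_iff.1 h0)
    exact ⟨_, Multiset.mem_map_of_mem _ hℓ, eq_smul_cross (hne ℓ hℓ) hℓv hv hv0⟩
  · refine Polynomial.funext fun τ => ?_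
    rw [eval_polarRes, polarRes_eq hfd hgP hl₀ hS (fun ℓ hℓ => (hSP ℓ hℓ).1) hfac,
      Polynomial.eval_mul, Polynomial.eval_pow, Polynomial.eval_C, Polynomial.eval_multiset_prod,
      Multiset.map_map, Multiset.map_map]
    congr 2
    refine Multiset.map_congr rfl fun ℓ _ => ?_
    simp [eval_covecPoly, eval_curveValue]

end PencilFactorization

section Dichotomy

variable {k : Type*} [Field k]

lemma isLineOn_span_pair {f : MvPolynomial (Fin 4) k} {P θ l₀ : Fin 4 → k} (hP : l₀ ⬝ᵥ P = 1)
    (hθ : l₀ ⬝ᵥ θ = 0) (hθ0 : θ ≠ 0) (h : ∀ α β : k, eval (α • P + β • θ) f = 0) :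
    IsLineOn f (Submodule.span k {P, θ}) := by
  have hli : LinearIndependent k ![P, θ] := by
    refine LinearIndependent.pair_iff.2 fun s t hst => ?_
    have h1 : s = 0 := by
      have := congrArg (fun v => l₀ ⬝ᵥ v) hst
      simpa [dotProduct_add, dotProduct_smul, hP, hθ] using this
    rw [h1, zero_smul, zero_add] at hst
    exact ⟨h1, (smul_eq_zero.1 hst).resolve_right hθ0⟩
  constructor
  · have := finrank_span_eq_card hli
    rwa [Matrix.range_cons, Matrix.range_cons, Matrix.range_empty, Set.union_empty,
      Set.singleton_union, Fintype.card_fin] at this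
  · intro v hv
    obtain ⟨α, β, rfl⟩ := Submodule.mem_span_pair.1 hv
    exact h α β

lemma exists_mem_dotProduct_eq_zero {L : Submodule k (Fin 4 → k)} (hL : Module.finrank k L = 2)
    {P l₀ : Fin 4 → k} (hP : P ∈ L) (hl₀ : l₀ ⬝ᵥ P = 1) : ∃ v ∈ L, v ≠ 0 ∧ l₀ ⬝ᵥ v = 0 := by
  obtain ⟨p, hp, u, hu, hind, hspan⟩ := exists_basis_of_finrank_eq_two hL
  refine ⟨(l₀ ⬝ᵥ u) • p + (-(l₀ ⬝ᵥ p)) • u, L.add_mem (L.smul_mem _ hp) (L.smul_mem _ hu),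
    fun h0 => ?_, ?_⟩
  · obtain ⟨h1, h2⟩ := hind _ _ h0
    obtain ⟨α, β, rfl⟩ := hspan P hP
    rw [neg_eq_zero] at h2
    simp [dotProduct_add, dotProduct_smul, h1, h2] at hl₀
  · simp only [dotProduct_add, dotProduct_smul, smul_eq_mul]
    ring

lemma linePoly_eq_zero_of_mem [Infinite k] {f : MvPolynomial (Fin 4) k}
    {L : Submodule k (Fin 4 → k)} (hL : ∀ v ∈ L, eval v f = 0) {P v : Fin 4 → k} (hP : P ∈ L)
    (hv : v ∈ L) : linePoly f P v = 0 := by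
  refine Polynomial.funext fun t => ?_
  rw [linePoly_eval', Polynomial.eval_zero]
  exact hL _ (L.add_mem hP (L.smul_mem _ hv))

lemma line_count_arith {d a : ℕ} (hd : 3 < d) (ha : 2 ≤ a) (had : 2 * a ≤ d)
    (h : d ^ 2 * (d ^ 2 - 3 * d + 3) + d * (((d - 1) * d + (a + 1)) * a) ≤
      d * ((d - a + (d - 1) * a) * d + (d - 1) * d * a)) : False := by
  have h1 := Nat.le_of_mul_le_mul_left
    (show d * (d * (d ^ 2 - 3 * d + 3) + ((d - 1) * d + (a + 1)) * a) ≤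
      d * ((d - a + (d - 1) * a) * d + (d - 1) * d * a) by
      refine le_trans (le_of_eq ?_) h
      ring) (by lia)
  have h3 : 3 * d ≤ d ^ 2 := by nlinarith
  have h2 : a ≤ d := by lia
  have h4 : 1 ≤ d := by lia
  zify [h2, h3, h4] at h1
  zify at hd ha had
  generalize (d : ℤ) = D at *
  generalize (a : ℤ) = b at *
  have hD : 4 ≤ D := by lia
  rcases eq_or_lt_of_le hD with h5 | h5
  · have : b = 2 := by lia
    subst h5 this
    norm_num at h1
  · have hD5 : 5 ≤ D := by lia
    have key : (D - 2 * b) * (D ^ 2 - 2 * D - 1) ≥ 0 :=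
      mul_nonneg (by lia) (by nlinarith)
    nlinarith [mul_nonneg (show (0 : ℤ) ≤ D - 5 by lia) (show (0 : ℤ) ≤ D by lia),
      mul_nonneg (mul_nonneg (show (0 : ℤ) ≤ D - 5 by lia) (show (0 : ℤ) ≤ D by lia))
        (show (0 : ℤ) ≤ D by lia)]

variable [IsAlgClosed k]

/-- On a smooth surface with the maximal number of lines, every point either lies on a line or
has vanishing lowest polar term. -/
lemma exists_line_or_polar_eq_zero {f : MvPolynomial (Fin 4) k} {d a : ℕ} (hd : 3 < d)
    (hf : IsSmoothSurface f d) (hirr : Irreducible f) (𝓛 : Finset (Submodule k (Fin 4 → k)))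
    (h𝓛 : ∀ L, L ∈ 𝓛 ↔ IsLineOn f L) (hcard : 𝓛.card = d ^ 2 * (d ^ 2 - 3 * d + 3))
    (ha : 2 ≤ a) (had : 2 * a ≤ d)
    (hmin : ∀ j, 2 ≤ j → j < a → ∀ P u : Fin 4 → k, (linePoly f P u).coeff j = 0)
    {P : Fin 4 → k} (hP : P ≠ 0) (hfP : eval P f = 0) :
    (∃ L ∈ 𝓛, P ∈ L) ∨ ∀ u, grad f P ⬝ᵥ u = 0 → (linePoly f P u).coeff a = 0 := by
  have : Infinite k := IsAlgClosed.instInfinite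
  have hfd := hf.2.1
  have ha' : a ≤ d := by lia
  obtain ⟨G, D, hG, hD⟩ := exists_generic_polarRes f d a
  by_cases hG0 : ∃ P, eval P f = 0 ∧ pencil G P ≠ 0
  · exfalso
    have hGh : ∀ r P, pencil G (r • P) =
        Polynomial.C (r ^ ((d - a + (d - 1) * a) * d + (d - 1) * d * a)) * pencil G P := by
      intro r P
      refine Polynomial.funext fun τ => ?_
      rw [hG, hG, eval_polarRes, polarRes_smul hfd ha', Polynomial.eval_mul, Polynomial.eval_C,
        eval_polarRes]
    have hDh : ∀ r P, pencil D (r • P) =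
        Polynomial.C (r ^ (((d - 1) * d + (a + 1)) * a)) * pencil D P := by
      intro r P
      refine Polynomial.funext fun τ => ?_
      rw [hD, hD, eval_polarExtra, polarExtra_smul hfd, Polynomial.eval_mul, Polynomial.eval_C,
        eval_polarExtra]
    refine line_count_arith hd ha had ?_
    rw [← hcard]
    refine card_lines_add_le hirr (by lia) hfd 𝓛 (fun L hL => (h𝓛 L).1 hL) hGh hDh ?_ ?_ ?_ hG0
    · intro P hP hfP
      obtain ⟨l₀, κ, S, -, hS, hθ, -, -, hres⟩ := exists_pencil_factorization hf ha' hmin hP hfP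
      rw [hG, hD, hres, polarExtra_eq, ← hS, ← Multiset.prod_replicate, ← Multiset.map_const']
      refine Dvd.dvd.mul_left (Multiset.prod_dvd_prod_of_dvd _ _ fun θ hθS => ?_) _
      rw [hS]
      exact mul_dvd_mul_left _ (pow_dvd_curveValue hfd (hθ θ hθS).2.2.2)
    · intro P hP hfP
      rw [hD, polarExtra_eq]
      exact pow_ne_zero _ (mul_ne_zero (pow_ne_zero _ (covecPoly_ne_zero (hf.grad_ne_zero hP hfP)))
        (pow_ne_zero _ (curvePoly_ne_zero hP)))
    · intro L hL P hPL
      by_cases hP : P = 0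
      · have := hGh 0 P
        rw [zero_pow, map_zero, zero_mul, zero_smul] at this
        · rw [hP, this]
        · have : 0 < (d - 1) * d * a := by
            have : 0 < d - 1 := by lia
            positivity
          lia
      obtain ⟨hL2, hLf⟩ := (h𝓛 L).1 hL
      obtain ⟨l₀, κ, S, hl₀, hS, hθ, hκ, hκ', hres⟩ :=
        exists_pencil_factorization hf ha' hmin hP (hLf P hPL)
      rw [hG, hres]
      by_cases hκ0 : κ = 0
      · rw [hκ0, map_zero, zero_pow (by lia), zero_mul]
      obtain ⟨v, hv, hv0, hl₀v⟩ := exists_mem_dotProduct_eq_zero hL2 hPL hl₀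
      have hlin := linePoly_eq_zero_of_mem hLf hPL hv
      obtain ⟨θ, hθS, r, rfl⟩ := hκ' hκ0 v
        (by rw [← linePoly_coeff_one_eq_grad, hlin, Polynomial.coeff_zero]) hl₀v
        (by rw [hlin, Polynomial.coeff_zero])
      have hr : r ≠ 0 := fun hr => hv0 (by rw [hr, zero_smul])
      rw [Multiset.prod_eq_zero, mul_zero]
      refine Multiset.mem_map.2 ⟨θ, hθS, ?_⟩
      rw [curveValue_eq_zero_of_mem hLf hPL ((L.smul_mem_iff hr).1 hv), mul_zero]
  · push Not at hG0
    obtain ⟨l₀, κ, S, hl₀, hS, hθ, hκ, -, hres⟩ := exists_pencil_factorization hf ha' hmin hP hfP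
    have h0 := hG0 P hfP
    rw [hG, hres] at h0
    rcases mul_eq_zero.1 h0 with h1 | h1
    · exact Or.inr (hκ (Polynomial.C_eq_zero.1 (eq_zero_of_pow_eq_zero h1)))
    · left
      obtain ⟨θ, hθS, hz⟩ := Multiset.mem_map.1 (Multiset.prod_eq_zero_iff.1 h1)
      obtain ⟨hθ0, -, hlθ, -⟩ := hθ θ hθS
      have hz' := (mul_eq_zero.1 hz).resolve_left
        (pow_ne_zero _ (covecPoly_ne_zero (hf.grad_ne_zero hP hfP)))
      refine ⟨Submodule.span k {P, θ}, (h𝓛 _).2 (isLineOn_span_pair hl₀ hlθ hθ0 fun α β =>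
        eval_eq_zero_of_curveValue_eq_zero hfd hl₀ hlθ hθ0 hz' α β), ?_⟩
      exact Submodule.subset_span (by simp)

end Dichotomy

section Vanishing

variable {k : Type*} [Field k] {f : MvPolynomial (Fin 4) k} {d a : ℕ}

lemma eval_linePoly_coeff {σ : Type*} (f : MvPolynomial (Fin 4) k) (a : ℕ)
    (P U : Fin 4 → MvPolynomial σ k) (v : σ → k) :
    eval v ((linePoly f P U).coeff a) =
      (linePoly f (fun i => eval v (P i)) (fun i => eval v (U i))).coeff a := by
  have h := linePoly_map f P U (aeval v : MvPolynomial σ k →ₐ[k] k)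
  have h' := congrArg (fun p => p.coeff a) h
  simp only [Polynomial.coeff_map] at h'
  exact h'

lemma linePoly_coeff_zero_left (hfd : f.IsHomogeneous d) (ha : a < d) (u : Fin 4 → k) :
    (linePoly f 0 u).coeff a = 0 := by
  have h := linePoly_coeff_smul_smul hfd ha.le (0 : k) 1 0 u
  simpa [Nat.sub_ne_zero_of_lt ha] using h

/-- A nonzero linear form vanishing on a proper subspace. -/
lemma exists_linear_polynomial (L : Submodule k (Fin 4 → k)) (hL : L ≠ ⊤) :
    ∃ Λ : MvPolynomial (Fin 4) k, Λ ≠ 0 ∧ (∀ (r : k) v, eval (r • v) Λ = r ^ 1 * eval v Λ) ∧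
      ∀ v ∈ L, eval v Λ = 0 := by
  obtain ⟨φ, h0, h⟩ := exists_dual_ne_zero L hL
  obtain ⟨l, rfl⟩ := (dotProductEquiv k (Fin 4)).surjective φ
  have hl : ∀ v, eval v (∑ i, C (l i) * X i) = l ⬝ᵥ v := fun v => by
    simp [dotProduct]
  refine ⟨∑ i, C (l i) * X i, fun hz => h0 ?_, fun r v => ?_, fun v hv => ?_⟩
  · refine LinearMap.ext fun v => ?_
    have := hl v
    rw [hz, map_zero] at this
    exact this.symm
  · rw [hl, hl, dotProduct_smul, pow_one, smul_eq_mul]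
  · rw [hl]
    exact h v hv

variable [IsAlgClosed k]

lemma linePoly_coeff_eq_zero_of_dichotomy (hf : IsSmoothSurface f d) (hirr : Irreducible f)
    (ha : a < d) (hd : 1 < d) (𝓛 : Finset (Submodule k (Fin 4 → k)))
    (h𝓛 : ∀ L ∈ 𝓛, IsLineOn f L)
    (h : ∀ P : Fin 4 → k, P ≠ 0 → eval P f = 0 → (∃ L ∈ 𝓛, P ∈ L) ∨
      ∀ u, grad f P ⬝ᵥ u = 0 → (linePoly f P u).coeff a = 0)
    {P u : Fin 4 → k} (hP : eval P f = 0) (hu : grad f P ⬝ᵥ u = 0) :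
    (linePoly f P u).coeff a = 0 := by
  have hfd := hf.2.1
  by_cases hP0 : P = 0
  · rw [hP0]
    exact linePoly_coeff_zero_left hfd ha u
  obtain ⟨B, hB⟩ := exists_dotProduct_eq_one (hf.grad_ne_zero hP0 hP)
  rw [dotProduct_comm] at hB
  have hΛ : ∀ L ∈ 𝓛, ∃ Λ : MvPolynomial (Fin 4) k, Λ ≠ 0 ∧
      (∀ (r : k) v, eval (r • v) Λ = r ^ 1 * eval v Λ) ∧ ∀ v ∈ L, eval v Λ = 0 := by
    refine fun L hL => exists_linear_polynomial L fun htop => ?_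
    have := (h𝓛 L hL).1
    rw [htop, finrank_top] at this
    simp at this
  choose! Λ hΛ0 hΛh hΛL using hΛ
  let gP : (Fin 4 → k) → MvPolynomial (Fin 4) k := fun w => grad f X ⬝ᵥ fun i => C (w i)
  have hgP : ∀ w v, eval v (gP w) = grad f v ⬝ᵥ w := fun w v => by
    have h1 := map_dotProduct' (aeval v : MvPolynomial (Fin 4) k →ₐ[k] k) (grad f X)
      (fun i => C (w i))
    simp only [map_grad, aeval_X, algHom_C, Algebra.algebraMap_self, RingHom.id_apply] at h1
    exact h1
  let c : MvPolynomial (Fin 4) k :=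
    (linePoly f X (fun i => gP B * C (u i) - gP u * C (B i))).coeff a
  have hc : ∀ v, eval v c =
      (linePoly f v ((grad f v ⬝ᵥ B) • u - (grad f v ⬝ᵥ u) • B)).coeff a := fun v => by
    simp only [c, eval_linePoly_coeff, map_sub, map_mul, eval_C, hgP, eval_X]
    rfl
  have hdvd : f ∣ c * ∏ L ∈ 𝓛, Λ L := by
    refine dvd_of_forall_eval_eq_zero hirr fun v hv => ?_
    rw [map_mul, map_prod]
    by_cases hv0 : v = 0
    · rw [hc, hv0, linePoly_coeff_zero_left hfd ha, zero_mul]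
    rcases h v hv0 hv with ⟨L, hL, hvL⟩ | h'
    · rw [Finset.prod_eq_zero hL (hΛL L hL v hvL), mul_zero]
    · rw [hc, h' _ (by simp only [dotProduct_sub, dotProduct_smul, smul_eq_mul]; ring), zero_mul]
  have hfc : f ∣ c := by
    refine (hirr.prime.dvd_or_dvd hdvd).resolve_right fun h' => ?_
    obtain ⟨L, hL, hfL⟩ := hirr.prime.exists_mem_finset_dvd h'
    exact hΛ0 L hL (eq_zero_of_dvd_of_smul hfd hf.1 hd (hΛh L hL) hfL)
  obtain ⟨q, hq⟩ := hfc
  have := hc P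
  rw [hq, map_mul, hP, zero_mul, hB, hu, one_smul, zero_smul, sub_zero] at this
  exact this.symm

end Vanishing

section PolarForm

variable {k : Type*} [Field k] {f : MvPolynomial (Fin 4) k} {d a : ℕ}

/-- The polar form of degree `a` with respect to the vector `u`, as a polynomial in the point. -/
noncomputable def polarForm (f : MvPolynomial (Fin 4) k) (a : ℕ) (u : Fin 4 → k) :
    MvPolynomial (Fin 4) k :=
  (linePoly f X (fun i => C (u i))).coeff a

lemma eval_polarForm (a : ℕ) (u v : Fin 4 → k) :
    eval v (polarForm f a u) = (linePoly f v u).coeff a := by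
  simp only [polarForm, eval_linePoly_coeff, eval_C, eval_X]

lemma eval_polarForm_smul (hfd : f.IsHomogeneous d) (ha : a ≤ d) (u : Fin 4 → k) (r : k)
    (v : Fin 4 → k) :
    eval (r • v) (polarForm f a u) = r ^ (d - a) * eval v (polarForm f a u) := by
  have h := linePoly_coeff_smul_smul hfd ha r 1 v u
  rw [one_smul, one_pow, mul_one, mul_comm] at h
  rw [eval_polarForm, eval_polarForm, h]

lemma eval_polarForm_one (u v : Fin 4 → k) : eval v (polarForm f 1 u) = grad f v ⬝ᵥ u := by
  rw [eval_polarForm, linePoly_coeff_one_eq_grad]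

lemma grad_dotProduct_eq_zero_of_mem [Infinite k] {L : Submodule k (Fin 4 → k)}
    (hL : ∀ v ∈ L, eval v f = 0) {P v : Fin 4 → k} (hP : P ∈ L) (hv : v ∈ L) :
    grad f P ⬝ᵥ v = 0 := by
  rw [← linePoly_coeff_one_eq_grad, linePoly_eq_zero_of_mem hL hP hv, Polynomial.coeff_zero]

lemma exists_sup_span_eq_top {L : Submodule k (Fin 4 → k)} (hL : Module.finrank k L = 2)
    {u : Fin 4 → k} (hu : u ∉ L) : ∃ B, L ⊔ k ∙ u ⊔ k ∙ B = ⊤ := by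
  by_cases h : L ⊔ k ∙ u = ⊤
  · exact ⟨0, by rw [h, top_sup_eq]⟩
  obtain ⟨B, hB⟩ : ∃ B, B ∉ L ⊔ k ∙ u := by
    by_contra! h'
    exact h (eq_top_iff.2 fun v _ => h' v)
  refine ⟨B, Submodule.eq_top_of_finrank_eq (le_antisymm (Submodule.finrank_le _) ?_)⟩
  have h1 : L < L ⊔ k ∙ u := lt_of_le_of_ne le_sup_left fun h' => hu <| by
    rw [h']
    exact Submodule.mem_sup_right (Submodule.mem_span_singleton_self u)
  have h2 : L ⊔ k ∙ u < L ⊔ k ∙ u ⊔ k ∙ B := lt_of_le_of_ne le_sup_left fun h' => hB <| by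
    rw [h']
    exact Submodule.mem_sup_right (Submodule.mem_span_singleton_self B)
  have h3 := Submodule.finrank_lt_finrank_of_lt h1
  have h4 := Submodule.finrank_lt_finrank_of_lt h2
  rw [Module.finrank_fin_fun]
  lia

variable [IsAlgClosed k]

/-- If `B` and `u` span a complement of the line `L` on a smooth surface, then the derivatives of
`f` in these two directions have no common zero on `L`. -/
lemma grad_dotProduct_ne_zero_or (hf : IsSmoothSurface f d) {L : Submodule k (Fin 4 → k)}
    (hL : ∀ v ∈ L, eval v f = 0) {u B : Fin 4 → k} (hB : L ⊔ k ∙ u ⊔ k ∙ B = ⊤)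
    {v : Fin 4 → k} (hv : v ∈ L) (hv0 : v ≠ 0) (hvB : grad f v ⬝ᵥ B = 0) :
    grad f v ⬝ᵥ u ≠ 0 := by
  have : Infinite k := IsAlgClosed.instInfinite
  intro hvu
  refine hf.grad_ne_zero hv0 (hL v hv) (dotProduct_eq_zero _ fun w => ?_)
  have hw : w ∈ L ⊔ k ∙ u ⊔ k ∙ B := by rw [hB]; trivial
  obtain ⟨x, hx, b, hb, rfl⟩ := Submodule.mem_sup.1 hw
  obtain ⟨l, hl, c, hc, rfl⟩ := Submodule.mem_sup.1 hx
  obtain ⟨r, rfl⟩ := Submodule.mem_span_singleton.1 hb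
  obtain ⟨s, rfl⟩ := Submodule.mem_span_singleton.1 hc
  simp [dotProduct_add, dotProduct_smul, hvB, hvu, grad_dotProduct_eq_zero_of_mem hL hv hl]

lemma polarForm_eq_zero_of_ne (hf : IsSmoothSurface f d) (hd : 1 < d) (ha : 2 ≤ a) (had : a < d)
    (h : ∀ P u : Fin 4 → k, eval P f = 0 → grad f P ⬝ᵥ u = 0 → (linePoly f P u).coeff a = 0)
    {L : Submodule k (Fin 4 → k)} (hL : ∀ v ∈ L, eval v f = 0) {u B p q : Fin 4 → k}
    (hB : L ⊔ k ∙ u ⊔ k ∙ B = ⊤) (hp : p ∈ L) (hq : q ∈ L) (hq0 : q ≠ 0)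
    (hqB : grad f q ⬝ᵥ B = 0) (hpq : ∀ t : k, p + t • q ≠ 0) :
    linePoly (polarForm f a u) p q = 0 := by
  have : Infinite k := IsAlgClosed.instInfinite
  have hfd := hf.2.1
  have hmem : ∀ t : k, p + t • q ∈ L := fun t => L.add_mem hp (L.smul_mem t hq)
  set G := linePoly (polarForm f 1 u) p q with hG
  set H := linePoly (polarForm f 1 B) p q with hH
  set F := linePoly (polarForm f a u) p q with hF
  have hGe : ∀ t, G.eval t = grad f (p + t • q) ⬝ᵥ u := fun t => by
    rw [hG, linePoly_eval', eval_polarForm_one]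
  have hHe : ∀ t, H.eval t = grad f (p + t • q) ⬝ᵥ B := fun t => by
    rw [hH, linePoly_eval', eval_polarForm_one]
  have hcop : IsCoprime G H := by
    refine isCoprime_of_irreducible_dvd (fun hGH => ?_) fun r hr hrG hrH => ?_
    · have := (linePoly_natDegree_le_of_smul (eval_polarForm_smul hfd hd.le u) p q).2
      rw [← hG, hGH.1, Polynomial.coeff_zero, eval_polarForm_one] at this
      exact grad_dotProduct_ne_zero_or hf hL hB hq hq0 hqB this.symm
    · obtain ⟨t, ht⟩ := IsAlgClosed.exists_root r (Polynomial.degree_pos_of_irreducible hr).ne'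
      refine grad_dotProduct_ne_zero_or hf hL hB (hmem t) (hpq t) ?_ ?_
      · rw [← hHe]
        exact ht.dvd hrH
      · rw [← hGe]
        exact ht.dvd hrG
  have hdvd : G ∣ F * H ^ a := by
    rw [← Ideal.mem_span_singleton, ← Ideal.Quotient.eq_zero_iff_mem]
    let P : Fin 4 → Polynomial k := fun i => Polynomial.C (p i) + Polynomial.C (q i) * Polynomial.X
    have hev : ∀ (U : Fin 4 → Polynomial k) (t : k), ((linePoly f P U).coeff a).eval t =
        (linePoly f (p + t • q) (fun i => (U i).eval t)).coeff a := fun U t => by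
      have h1 := linePoly_map f P U ((Polynomial.aeval t : Polynomial k →ₐ[k] k))
      have h2 := congrArg (fun p => p.coeff a) h1
      simp only [Polynomial.coeff_map] at h2
      refine Eq.trans h2 ?_
      congr 2
      ext i
      change (P i).eval t = p i + t * q i
      simp only [P, Polynomial.eval_add, Polynomial.eval_mul, Polynomial.eval_C, Polynomial.eval_X]
      ring
    have hz : (linePoly f P (fun i => H * Polynomial.C (u i) - G * Polynomial.C (B i))).coeff a =
        0 := by
      refine Polynomial.funext fun t => ?_
      rw [hev, Polynomial.eval_zero]
      refine h _ _ (hL _ (hmem t)) ?_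
      have : (fun i => (H * Polynomial.C (u i) - G * Polynomial.C (B i)).eval t) =
          H.eval t • u - G.eval t • B := by
        ext i
        simp
      rw [this, dotProduct_sub, dotProduct_smul, dotProduct_smul, hHe, hGe, smul_eq_mul,
        smul_eq_mul]
      ring
    have hFP : F = (linePoly f P (fun i => Polynomial.C (u i))).coeff a := by
      refine Polynomial.funext fun t => ?_
      rw [hev, hF, linePoly_eval', eval_polarForm]
      simp
    let φ := Ideal.Quotient.mkₐ k (Ideal.span {G})
    have hφG : φ G = 0 := Ideal.Quotient.eq_zero_iff_mem.2 (Ideal.mem_span_singleton_self G)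
    change φ (F * H ^ a) = 0
    have hsm := linePoly_coeff_smul hfd P (fun i => Polynomial.C (u i)) 1 H had.le
    simp only [mul_one, one_pow] at hsm
    rw [hFP, ← hsm]
    have h1 := congrArg (fun p => p.coeff a) (linePoly_map f P (fun i => Polynomial.C (u i) * H) φ)
    have h2 := congrArg (fun p => p.coeff a)
      (linePoly_map f P (fun i => H * Polynomial.C (u i) - G * Polynomial.C (B i)) φ)
    simp only [Polynomial.coeff_map, hz] at h1 h2
    refine h1.trans (Eq.trans ?_ (h2.symm.trans (map_zero φ)))
    congr 2
    ext i
    rw [map_sub, map_mul φ G, hφG, zero_mul, sub_zero, mul_comm]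
  refine Polynomial.eq_zero_of_dvd_of_natDegree_lt ((hcop.pow_right).dvd_of_dvd_mul_right hdvd) ?_
  refine lt_of_le_of_lt (linePoly_natDegree_le_of_smul (eval_polarForm_smul hfd had.le u) p q).1
    (lt_of_lt_of_le (show d - a < d - 1 by lia) ?_)
  refine Polynomial.le_natDegree_of_ne_zero ?_
  rw [(linePoly_natDegree_le_of_smul (eval_polarForm_smul hfd hd.le u) p q).2, eval_polarForm_one]
  exact grad_dotProduct_ne_zero_or hf hL hB hq hq0 hqB

end PolarForm

section VanishingPolars

variable {k : Type*} [Field k] [IsAlgClosed k] {f : MvPolynomial (Fin 4) k} {d a : ℕ}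

omit [IsAlgClosed k] in
lemma polarForm_isHomogeneous (hfd : f.IsHomogeneous d) (u : Fin 4 → k) :
    (polarForm f 1 u).IsHomogeneous (d - 1) := by
  have : polarForm f 1 u = ∑ i, C (u i) * pderiv i f := by
    rw [polarForm, linePoly_coeff_one]
    simp
  rw [this]
  refine IsHomogeneous.sum _ _ _ fun i _ => ?_
  simpa using (isHomogeneous_C (Fin 4) (u i)).mul (hfd.pderiv (i := i))

lemma eval_polarForm_eq_zero_of_mem (hf : IsSmoothSurface f d) (hd : 1 < d) (ha : 2 ≤ a)
    (had : a < d)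
    (h : ∀ P u : Fin 4 → k, eval P f = 0 → grad f P ⬝ᵥ u = 0 → (linePoly f P u).coeff a = 0)
    {L : Submodule k (Fin 4 → k)} (hL : IsLineOn f L) {u v : Fin 4 → k} (hu : eval u f ≠ 0)
    (hv : v ∈ L) : eval v (polarForm f a u) = 0 := by
  have : Infinite k := IsAlgClosed.instInfinite
  have hfd := hf.2.1
  obtain ⟨B, hB⟩ := exists_sup_span_eq_top hL.1 (u := u) fun hu' => hu (hL.2 u hu')
  obtain ⟨p₁, hp₁, p₂, hp₂, hind, -⟩ := exists_basis_of_finrank_eq_two hL.1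
  obtain ⟨α, β, hαβ, h0⟩ := exists_zero_of_linePoly (polarForm_isHomogeneous hfd B) (by lia) p₁ p₂
  set q := α • p₁ + β • p₂ with hq
  have hqL : q ∈ L := L.add_mem (L.smul_mem _ hp₁) (L.smul_mem _ hp₂)
  have hq0 : q ≠ 0 := fun hq0 => by
    obtain ⟨rfl, rfl⟩ := hind α β hq0
    simp at hαβ
  rw [eval_polarForm_one] at h0
  have hmain : ∀ p ∈ L, (∀ t : k, p + t • q ≠ 0) → linePoly (polarForm f a u) p q = 0 :=
    fun p hp hpq => polarForm_eq_zero_of_ne hf hd ha had h hL.2 hB hp hqL hq0 h0 hpq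
  have hqz : eval q (polarForm f a u) = 0 := by
    obtain ⟨p, hp, hpq⟩ : ∃ p ∈ L, ∀ t : k, p + t • q ≠ 0 := by
      by_contra! hcon
      obtain ⟨t, ht⟩ := hcon p₁ hp₁
      obtain ⟨s, hs⟩ := hcon p₂ hp₂
      have := hind s (-t) (by
        rw [eq_neg_of_add_eq_zero_left ht, eq_neg_of_add_eq_zero_left hs]
        module)
      rw [this.1, zero_smul, add_zero] at hs
      have := hind 0 1 (by rw [hs]; simp)
      exact one_ne_zero this.2
    have := (linePoly_natDegree_le_of_smul (eval_polarForm_smul hfd had.le u) p q).2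
    rw [hmain p hp hpq, Polynomial.coeff_zero] at this
    exact this.symm
  by_cases hvq : ∃ t : k, v + t • q = 0
  · obtain ⟨t, ht⟩ := hvq
    rw [eq_neg_of_add_eq_zero_left ht, ← neg_smul, eval_polarForm_smul hfd had.le, hqz, mul_zero]
  · push Not at hvq
    have := linePoly_eval' (polarForm f a u) v q 0
    rw [hmain v hv hvq] at this
    simpa using this.symm

/-- If the polar term of degree `a` vanishes on the tangent plane at each point of the surface and
the surface contains more than `d (d - a)` lines, then this polar term vanishes identically. -/
lemma linePoly_coeff_eq_zero_of_lt_card (hf : IsSmoothSurface f d) (hirr : Irreducible f)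
    (hd : 1 < d) (ha : 2 ≤ a) (had : a < d) (𝓛 : Finset (Submodule k (Fin 4 → k)))
    (h𝓛 : ∀ L ∈ 𝓛, IsLineOn f L) (hcard : d * (d - a) < 𝓛.card)
    (h : ∀ P u : Fin 4 → k, eval P f = 0 → grad f P ⬝ᵥ u = 0 → (linePoly f P u).coeff a = 0)
    (P u : Fin 4 → k) : (linePoly f P u).coeff a = 0 := by
  have : Infinite k := IsAlgClosed.instInfinite
  have hfd := hf.2.1
  have h1 : ∀ u, eval u f ≠ 0 → polarForm f a u = 0 := fun u hu => by
    refine eq_zero_of_dvd_of_smul hfd hf.1 (show d - a < d by lia)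
      (eval_polarForm_smul hfd had.le u) (dvd_of_forall_eval_eq_zero hirr fun v hv => ?_)
    by_contra hv'
    refine absurd (card_lines_le hirr (by lia) hfd 𝓛 h𝓛 (eval_polarForm_smul hfd had.le u)
      (fun L hL v hv => eval_polarForm_eq_zero_of_mem hf hd ha had h (h𝓛 L hL) hu hv)
      ⟨v, hv, hv'⟩) (by lia)
  have h2 : f * (linePoly f (fun i => C (P i)) X).coeff a = 0 := by
    refine MvPolynomial.funext fun u => ?_
    rw [map_mul, map_zero, eval_linePoly_coeff]
    simp only [eval_C, eval_X]
    by_cases hu : eval u f = 0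
    · rw [hu, zero_mul]
    · rw [← eval_polarForm, h1 u hu, map_zero, mul_zero]
  have h3 := congrArg (eval u) ((mul_eq_zero.1 h2).resolve_left hf.1)
  simpa only [eval_linePoly_coeff, eval_C, eval_X, map_zero] using h3

/-- A smooth surface of degree `d > 3` with `d² (d² - 3 d + 3)` lines is given by a form with
`f (p + t u) = f p + t B(p, u) + t ^ (d - 1) B(u, p) + t ^ d f u`. -/
lemma linePoly_coeff_eq_zero_of_card (hd : 3 < d) (hf : IsSmoothSurface f d)
    (hirr : Irreducible f) (𝓛 : Finset (Submodule k (Fin 4 → k)))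
    (h𝓛 : ∀ L, L ∈ 𝓛 ↔ IsLineOn f L) (hcard : 𝓛.card = d ^ 2 * (d ^ 2 - 3 * d + 3)) (j : ℕ)
    (hj : 2 ≤ j) (hjd : j + 2 ≤ d) (P u : Fin 4 → k) : (linePoly f P u).coeff j = 0 := by
  have key : ∀ a, 2 ≤ a → 2 * a ≤ d → ∀ P u : Fin 4 → k, (linePoly f P u).coeff a = 0 := by
    intro a
    induction a using Nat.strong_induction_on with
    | _ a ih =>
      intro ha had
      have hmin : ∀ j, 2 ≤ j → j < a → ∀ P u : Fin 4 → k, (linePoly f P u).coeff j = 0 :=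
        fun j hj hja => ih j hja hj (by lia)
      refine linePoly_coeff_eq_zero_of_lt_card hf hirr (by lia) ha (by lia) 𝓛
        (fun L hL => (h𝓛 L).1 hL) ?_ fun P u hP hu =>
          linePoly_coeff_eq_zero_of_dichotomy hf hirr (by lia) (by lia) 𝓛
            (fun L hL => (h𝓛 L).1 hL)
            (fun P hP0 hP => exists_line_or_polar_eq_zero hd hf hirr 𝓛 h𝓛 hcard ha had hmin hP0 hP)
            hP hu
      rw [hcard]
      have h1 : 3 * d ≤ d ^ 2 := by nlinarith
      have h2 : d * (d - a) ≤ d * d := Nat.mul_le_mul_left _ (Nat.sub_le _ _)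
      have h3 : d ^ 2 * 3 ≤ d ^ 2 * (d ^ 2 - 3 * d + 3) := Nat.mul_le_mul_left _ (by lia)
      nlinarith
  rcases le_total (2 * j) d with h | h
  · exact key j hj h P u
  · rw [linePoly_coeff_swap hf.2.1 u P (show j ≤ d by lia)]
    exact key (d - j) (by lia) (by lia) u P

end VanishingPolars

section FrobeniusForm

variable {k : Type*} [Field k] {f : MvPolynomial (Fin 4) k} {d : ℕ}

lemma eval_add_of_linePoly_coeff_eq_zero (hfd : f.IsHomogeneous d) (hd : 3 < d)
    (h : ∀ j, 2 ≤ j → j + 2 ≤ d → ∀ P u : Fin 4 → k, (linePoly f P u).coeff j = 0)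
    (x y : Fin 4 → k) :
    eval (x + y) f = eval x f + eval y f + grad f x ⬝ᵥ y + grad f y ⬝ᵥ x := by
  have h1 := eval_comb hfd x y 1 1
  simp only [one_smul, one_pow, mul_one] at h1
  have h2 : (linePoly f x y).coeff (d - 1) = grad f y ⬝ᵥ x := by
    rw [← linePoly_coeff_one_eq_grad, linePoly_coeff_swap hfd x y (show 1 ≤ d by lia)]
  obtain ⟨n, rfl⟩ : ∃ n, d = n + 3 + 1 := ⟨d - 4, by lia⟩
  rw [h1, Finset.sum_range_succ, Finset.sum_range_succ, Finset.sum_range_succ',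
    Finset.sum_range_succ', Finset.sum_eq_zero, linePoly_coeff_top hfd, linePoly_coeff_zero]
  · rw [show n + 3 = n + 3 + 1 - 1 by lia, h2, zero_add, linePoly_coeff_one_eq_grad]
    change grad f x ⬝ᵥ y + eval x f + _ + eval y f = _
    ring
  · intro j hj
    rw [Finset.mem_range] at hj
    exact h _ (by lia) (by lia) _ _

lemma exists_pow_ne_pow [Infinite k] {a b : ℕ} (hab : a ≠ b) (c : k) (hc : c ≠ 0) :
    ∃ t : k, t ^ a ≠ c * t ^ b := by
  by_contra! h
  have h1 : (Polynomial.X ^ a : Polynomial k) = Polynomial.C c * Polynomial.X ^ b :=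
    Polynomial.funext fun t => by simpa using h t
  have h2 := congrArg (fun p => p.coeff b) h1
  simp only [Polynomial.coeff_X_pow, Polynomial.coeff_C_mul] at h2
  simp [hab.symm, hc.symm] at h2

/-- The gradient is additive. -/
lemma grad_add [Infinite k] (hfd : f.IsHomogeneous d) (hd : 3 < d)
    (h : ∀ j, 2 ≤ j → j + 2 ≤ d → ∀ P u : Fin 4 → k, (linePoly f P u).coeff j = 0)
    (x y : Fin 4 → k) : grad f (x + y) = grad f x + grad f y := by
  have hadd := eval_add_of_linePoly_coeff_eq_zero hfd hd h
  let Δ : (Fin 4 → k) → (Fin 4 → k) → (Fin 4 → k) → k := fun z x y =>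
    grad f (x + y) ⬝ᵥ z - grad f x ⬝ᵥ z - grad f y ⬝ᵥ z
  have hcyc : ∀ z x y, Δ z x y = Δ x y z := fun z x y => by
    have h1 := hadd (x + y) z
    rw [add_assoc, hadd x (y + z), hadd x y, hadd y z] at h1
    simp only [dotProduct_add] at h1
    simp only [Δ]
    linear_combination -h1
  have hsmul : ∀ (t : k) z x y, Δ (t • z) x y = t * Δ z x y := fun t z x y => by
    simp only [Δ, dotProduct_smul, smul_eq_mul]
    ring
  refine sub_eq_zero.1 (dotProduct_eq_zero _ fun z => ?_)
  obtain ⟨t, ht⟩ := exists_pow_ne_pow (k := k) (show 3 ≠ d by lia) 1 one_ne_zero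
  have h1 : Δ (t • z) (t • x) (t • y) = t ^ 3 * Δ z x y := by
    rw [hsmul, hcyc, hsmul, hcyc, hsmul, hcyc]
    ring
  have h2 : Δ (t • z) (t • x) (t • y) = t ^ d * Δ z x y := by
    simp only [Δ, ← smul_add, grad_smul hfd, dotProduct_smul, smul_dotProduct, smul_eq_mul]
    rw [show d = d - 1 + 1 by lia, Nat.add_sub_cancel]
    ring
  have h3 : Δ z x y = 0 := by
    rw [h1, ← sub_eq_zero, ← sub_mul] at h2
    refine (mul_eq_zero.1 h2).resolve_left (sub_ne_zero.2 ?_)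
    simpa using ht
  simpa only [Δ, sub_dotProduct, add_dotProduct, sub_sub] using h3

/-- A surface as in `grad_add` is given by a Frobenius form. -/
lemma exists_frobenius_form [IsAlgClosed k] (hf : IsSmoothSurface f d) (hd : 3 < d)
    (h : ∀ j, 2 ≤ j → j + 2 ≤ d → ∀ P u : Fin 4 → k, (linePoly f P u).coeff j = 0)
    (hne : ∃ v : Fin 4 → k, v ≠ 0 ∧ eval v f = 0) :
    (∀ s t : k, (s + t) ^ (d - 1) = s ^ (d - 1) + t ^ (d - 1)) ∧
      ∃ M : Matrix (Fin 4) (Fin 4) k, IsUnit M ∧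
        ∀ v, eval v f = v ⬝ᵥ M.mulVec fun i => v i ^ (d - 1) := by
  have : Infinite k := IsAlgClosed.instInfinite
  have hfd := hf.2.1
  have hadd := grad_add hfd hd h
  have hpow : ∀ s t : k, (s + t) ^ (d - 1) = s ^ (d - 1) + t ^ (d - 1) := fun s t => by
    obtain ⟨v, hv0, hv⟩ := hne
    have h1 := hadd (s • v) (t • v)
    rw [← add_smul, grad_smul hfd, grad_smul hfd, grad_smul hfd, ← add_smul] at h1
    exact smul_left_injective _ (hf.grad_ne_zero hv0 hv) h1
  have hdiag : ∀ v, eval v f = grad f v ⬝ᵥ v := fun v => by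
    obtain ⟨t, ht⟩ := exists_pow_ne_pow (k := k) (show d - 1 ≠ 1 by lia) (-1) (by simp)
    have h1 := eval_add_of_linePoly_coeff_eq_zero hfd hd h v (t • v)
    have h2 : eval (v + t • v) f = (1 + t) ^ d * eval v f := by
      rw [← eval_smul_of_isHomogeneous hfd, add_smul, one_smul]
    have h3 : (1 + t) ^ d = (1 + t) * (1 + t ^ (d - 1)) := by
      rw [← one_pow (d - 1), ← hpow, one_pow, ← pow_succ', Nat.sub_add_cancel (by lia)]
    have h4 : t ^ d = t * t ^ (d - 1) := by
      rw [← pow_succ', Nat.sub_add_cancel (by lia)]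
    rw [h2, h3, eval_smul_of_isHomogeneous hfd, h4, grad_smul hfd, smul_dotProduct,
      dotProduct_smul, smul_eq_mul, smul_eq_mul] at h1
    refine mul_left_cancel₀ (a := t ^ (d - 1) + t) (fun h0 => ht ?_) (by linear_combination h1)
    linear_combination h0
  have hinj : ∀ v, grad f v = 0 → v = 0 := fun v hv => by
    by_contra hv0
    exact hf.grad_ne_zero hv0 (by rw [hdiag, hv, zero_dotProduct]) hv
  let M : Matrix (Fin 4) (Fin 4) k := Matrix.of fun i j => grad f (Pi.single j 1) i
  have hM : ∀ v : Fin 4 → k, grad f v = M.mulVec fun i => v i ^ (d - 1) := fun v => by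
    have h0 : grad f (0 : Fin 4 → k) = 0 := by simpa using hadd 0 0
    have h1 := map_sum (⟨⟨grad f, h0⟩, hadd⟩ : (Fin 4 → k) →+ (Fin 4 → k))
      (fun j => v j • (Pi.single j 1 : Fin 4 → k)) Finset.univ
    have h2 : ∑ j, v j • (Pi.single j 1 : Fin 4 → k) = v := by
      ext i
      simp [Finset.sum_apply, Pi.single_apply]
    rw [h2] at h1
    refine h1.trans (funext fun i => ?_)
    rw [Finset.sum_apply]
    change _ = ∑ j, M i j * v j ^ (d - 1)
    refine Finset.sum_congr rfl fun j _ => ?_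
    change grad f (v j • Pi.single j 1) i = grad f (Pi.single j 1) i * v j ^ (d - 1)
    rw [grad_smul hfd, Pi.smul_apply, smul_eq_mul, mul_comm]
  refine ⟨hpow, M, ?_, fun v => by rw [hdiag, hM, dotProduct_comm]⟩
  refine Matrix.mulVec_injective_iff_isUnit.1 ?_
  refine (injective_iff_map_eq_zero M.mulVecLin).2 fun w hw => ?_
  have hroot : ∀ i, ∃ x : k, x ^ (d - 1) = w i := fun i =>
    IsAlgClosed.exists_pow_nat_eq (w i) (by lia)
  choose v hv using hroot
  have h1 : v = 0 := hinj v (by rw [hM, funext hv]; exact hw)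
  ext i
  rw [← hv i, h1]
  exact zero_pow (by lia)

end FrobeniusForm

section Lang

variable {k V : Type*} [Field k] [AddCommGroup V] [Module k V]

lemma exists_iterate_eq_sum [FiniteDimensional k V] (φ : V → V) (v : V) :
    ∃ r, ∃ c : ℕ → k, φ^[r] v = ∑ i ∈ Finset.range r, c i • φ^[i] v := by
  by_contra! h
  have hli : ∀ r, LinearIndependent k fun i : Fin r => φ^[i] v := by
    intro r
    induction r with
    | zero => exact linearIndependent_empty_type
    | succ r ih =>
      refine linearIndependent_finSucc'.2 ⟨ih, fun hmem => ?_⟩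
      obtain ⟨c, hc⟩ := (Submodule.mem_span_range_iff_exists_fun k).1 hmem
      refine h r (fun i => if hi : i < r then c ⟨i, hi⟩ else 0) (Eq.trans hc.symm ?_)
      rw [Finset.sum_range]
      exact Finset.sum_congr rfl fun i _ => by simp [Fin.init]
  have := (hli (Module.finrank k V + 1)).fintype_card_le_finrank
  simp at this

/-- The coordinates of a fixed vector of a Frobenius-linear map in terms of the last one. -/
noncomputable def fixedCoord (Q : ℕ) (c : ℕ → k) : ℕ → Polynomial k
  | 0 => Polynomial.C (c 0) * Polynomial.X ^ Q
  | i + 1 => fixedCoord Q c i ^ Q + Polynomial.C (c (i + 1)) * Polynomial.X ^ Q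

lemma X_pow_dvd_fixedCoord {Q : ℕ} (hQ : Q ≠ 0) (c : ℕ → k) (i : ℕ) :
    Polynomial.X ^ Q ∣ fixedCoord Q c i := by
  induction i with
  | zero => exact Dvd.intro_left _ rfl
  | succ i ih => exact dvd_add (dvd_pow ih hQ) (Dvd.intro_left _ rfl)

lemma fixedCoord_ne_zero {Q : ℕ} (hQ : 2 ≤ Q) (c : ℕ → k) (i : ℕ) (h : ∃ j ≤ i, c j ≠ 0) :
    fixedCoord Q c i ≠ 0 := by
  induction i with
  | zero =>
    obtain ⟨j, hj, hcj⟩ := h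
    rw [Nat.le_zero.1 hj] at hcj
    simpa [fixedCoord] using hcj
  | succ i ih =>
    by_cases hi : fixedCoord Q c i = 0
    · obtain ⟨j, hj, hcj⟩ := h
      have hj' : j = i + 1 := by
        by_contra hji
        exact ih ⟨j, by lia, hcj⟩ hi
      rw [fixedCoord, hi, zero_pow (by lia), zero_add, ← hj']
      simpa using hcj
    · intro h0
      have h1 := Polynomial.natDegree_le_of_dvd (X_pow_dvd_fixedCoord (by lia) c i) hi
      rw [Polynomial.natDegree_X_pow] at h1
      have h2 : (fixedCoord Q c i ^ Q).natDegree ≤ Q := by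
        rw [eq_neg_of_add_eq_zero_left h0, Polynomial.natDegree_neg]
        exact Polynomial.natDegree_C_mul_X_pow_le _ _
      rw [Polynomial.natDegree_pow] at h2
      nlinarith

variable [IsAlgClosed k]

lemma exists_fixed_point_of_dvd {p : Polynomial k} (hp : p ≠ 0) (h : Polynomial.X ^ 2 ∣ p) :
    ∃ y, y ≠ 0 ∧ p.eval y = y := by
  obtain ⟨q, rfl⟩ := h
  have hq : q ≠ 0 := right_ne_zero_of_mul hp
  have hdeg : (Polynomial.X * q - 1).degree ≠ 0 := by
    have h1 : (1 : Polynomial k).degree < (Polynomial.X * q).degree := by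
      rw [mul_comm, Polynomial.degree_mul_X, Polynomial.degree_one,
        Polynomial.degree_eq_natDegree hq]
      exact_mod_cast Nat.succ_pos _
    rw [Polynomial.degree_sub_eq_left_of_degree_lt h1]
    rw [Polynomial.degree_one] at h1
    exact h1.ne'
  obtain ⟨y, hy⟩ := IsAlgClosed.exists_root _ hdeg
  simp only [Polynomial.IsRoot, Polynomial.eval_sub, Polynomial.eval_mul, Polynomial.eval_X,
    Polynomial.eval_one] at hy
  refine ⟨y, fun h0 => by simp [h0] at hy, ?_⟩
  simp only [Polynomial.eval_mul, Polynomial.eval_pow, Polynomial.eval_X]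
  linear_combination y * hy

variable [FiniteDimensional k V] {σ : k →+* k} {Q : ℕ}

/-- An injective Frobenius-linear map has a nonzero fixed vector. -/
lemma exists_fixed_vector [Nontrivial V] (hQ : 2 ≤ Q) (hσ : ∀ x, σ x = x ^ Q) (φ : V →ₛₗ[σ] V)
    (hφ : ∀ v, φ v = 0 → v = 0) : ∃ v, v ≠ 0 ∧ φ v = v := by
  classical
  obtain ⟨v, hv⟩ := exists_ne (0 : V)
  have hex := exists_iterate_eq_sum (k := k) φ v
  obtain ⟨r, ⟨c, hc⟩, hmin⟩ : ∃ r, (∃ c : ℕ → k, φ^[r] v = ∑ i ∈ Finset.range r, c i • φ^[i] v) ∧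
      ∀ m < r, ¬ ∃ c : ℕ → k, φ^[m] v = ∑ i ∈ Finset.range m, c i • φ^[i] v :=
    ⟨Nat.find hex, Nat.find_spec hex, fun m hm => Nat.find_min hex hm⟩
  obtain _ | n := r
  · simp [hv] at hc
  have hiter : ∀ r, φ^[r] v ≠ 0 := fun r => by
    induction r with
    | zero => exact hv
    | succ r ih =>
      rw [Function.iterate_succ_apply']
      exact fun h => ih (hφ _ h)
  have hc0 : ∃ j ≤ n, c j ≠ 0 := by
    by_contra! h0
    refine hiter (n + 1) (hc.trans (Finset.sum_eq_zero fun i hi => ?_))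
    rw [h0 i (by rw [Finset.mem_range] at hi; lia), zero_smul]
  obtain ⟨y, hy0, hy⟩ := exists_fixed_point_of_dvd (fixedCoord_ne_zero hQ c n hc0)
    ((pow_dvd_pow _ hQ).trans (X_pow_dvd_fixedCoord (by lia) c n))
  let x : ℕ → k := fun i => (fixedCoord Q c i).eval y
  have hxn : x n = y := hy
  refine ⟨∑ i ∈ Finset.range (n + 1), x i • φ^[i] v, fun h0 => ?_, ?_⟩
  · refine hmin n (Nat.lt_succ_self n) ⟨fun i => -y⁻¹ * x i, ?_⟩
    rw [Finset.sum_range_succ, hxn] at h0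
    simp only [mul_smul, ← Finset.smul_sum]
    rw [eq_neg_of_add_eq_zero_left h0, smul_neg, neg_smul, neg_neg, smul_smul,
      inv_mul_cancel₀ hy0, one_smul]
  · rw [map_sum]
    have h1 : ∀ i, φ (x i • φ^[i] v) = x i ^ Q • φ^[i + 1] v := fun i => by
      rw [map_smulₛₗ, hσ, Function.iterate_succ_apply']
    have h2 : ∀ i, x (i + 1) = x i ^ Q + c (i + 1) * y ^ Q := fun i => by
      simp [x, fixedCoord]
    have h3 : x 0 = c 0 * y ^ Q := by simp [x, fixedCoord]
    simp only [h1]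
    rw [Finset.sum_range_succ, hxn, hc, Finset.smul_sum, Finset.sum_range_succ',
      Finset.sum_range_succ' (fun i => x i • φ^[i] v), ← add_assoc, ← Finset.sum_add_distrib]
    simp only [h2, h3, add_smul, smul_smul, mul_comm]

/-- **Lang's theorem** for the general linear group: an injective Frobenius-linear map on a finite
dimensional space has a basis of fixed vectors. -/
lemma span_fixed_eq_top (hQ : 2 ≤ Q) (hσ : ∀ x, σ x = x ^ Q) (φ : V →ₛₗ[σ] V)
    (hφ : ∀ v, φ v = 0 → v = 0) : Submodule.span k {v | φ v = v} = ⊤ := by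
  set W := Submodule.span k {v | φ v = v} with hW
  have hroot : ∀ c : k, ∃ x, x ^ Q - x + c = 0 := fun c => by
    have hdeg : (Polynomial.X ^ Q + (Polynomial.C c - Polynomial.X)).degree = (Q : WithBot ℕ) := by
      rw [Polynomial.degree_add_eq_left_of_degree_lt, Polynomial.degree_X_pow]
      rw [Polynomial.degree_X_pow]
      refine lt_of_le_of_lt (Polynomial.degree_sub_le _ _) (max_lt ?_ ?_)
      · exact lt_of_le_of_lt Polynomial.degree_C_le (by exact_mod_cast (by lia : 0 < Q))
      · rw [Polynomial.degree_X]
        exact_mod_cast hQ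
    obtain ⟨x, hx⟩ := IsAlgClosed.exists_root
      (Polynomial.X ^ Q + (Polynomial.C c - Polynomial.X)) (by
        rw [hdeg]
        exact_mod_cast (by lia : Q ≠ 0))
    simp only [Polynomial.IsRoot, Polynomial.eval_add, Polynomial.eval_sub, Polynomial.eval_pow,
      Polynomial.eval_X, Polynomial.eval_C] at hx
    exact ⟨x, by linear_combination hx⟩
  have hle : W ≤ W.comap φ := Submodule.span_le.2 fun v hv => by
    change φ v ∈ W
    rw [show φ v = v from hv]
    exact Submodule.subset_span hv
  have hsub : ∀ w ∈ W, ∃ y ∈ W, φ y - y + w = 0 := by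
    intro w hw
    induction hw using Submodule.closure_induction with
    | zero => exact ⟨0, W.zero_mem, by simp⟩
    | add x y _ _ hx hy =>
      obtain ⟨a, ha, hax⟩ := hx
      obtain ⟨b, hb, hby⟩ := hy
      refine ⟨a + b, W.add_mem ha hb, ?_⟩
      rw [map_add, ← add_zero (0 : V)]
      nth_rewrite 1 [← hax]
      rw [← hby]
      abel
    | smul_mem r x hx =>
      obtain ⟨t, ht⟩ := hroot r
      refine ⟨t • x, W.smul_mem _ (Submodule.subset_span hx), ?_⟩
      rw [map_smulₛₗ, hσ, show φ x = x from hx, ← sub_smul, ← add_smul, ht, zero_smul]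
  have hsurj : ∀ w ∈ W, ∃ y ∈ W, φ y = w := by
    intro w hw
    induction hw using Submodule.closure_induction with
    | zero => exact ⟨0, W.zero_mem, by simp⟩
    | add x y _ _ hx hy =>
      obtain ⟨a, ha, hax⟩ := hx
      obtain ⟨b, hb, hby⟩ := hy
      exact ⟨a + b, W.add_mem ha hb, by rw [map_add, hax, hby]⟩
    | smul_mem r x hx =>
      obtain ⟨t, ht⟩ := IsAlgClosed.exists_pow_nat_eq r (show 0 < Q by lia)
      refine ⟨t • x, W.smul_mem _ (Submodule.subset_span hx), ?_⟩
      rw [map_smulₛₗ, hσ, ht, show φ x = x from hx]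
  by_contra hne
  have : Nontrivial (V ⧸ W) := Submodule.Quotient.nontrivial_iff.2 hne
  obtain ⟨q, hq0, hq⟩ := exists_fixed_vector hQ hσ (W.mapQ W φ hle) (fun q hq => by
    obtain ⟨v, rfl⟩ := W.mkQ_surjective q
    rw [Submodule.mkQ_apply, Submodule.mapQ_apply, Submodule.Quotient.mk_eq_zero] at hq
    obtain ⟨y, hy, hyv⟩ := hsurj _ hq
    have h0 := sub_eq_zero.1 (hφ (v - y) (by rw [map_sub, hyv, sub_self]))
    rw [h0]
    exact (Submodule.Quotient.mk_eq_zero W).2 hy)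
  obtain ⟨v, rfl⟩ := W.mkQ_surjective q
  rw [Submodule.mkQ_apply, Submodule.mapQ_apply, Submodule.Quotient.eq] at hq
  obtain ⟨y, hy, hyv⟩ := hsub _ hq
  have hfix : φ (v + y) = v + y := by
    rw [map_add, ← sub_eq_zero, ← hyv]
    abel
  refine hq0 ((Submodule.Quotient.mk_eq_zero W).2 ?_)
  rw [← add_sub_cancel_right v y]
  exact W.sub_mem (Submodule.subset_span hfix) hy

end Lang

section Orthonormal

variable {k V : Type*} [Field k] [AddCommGroup V] [Module k V] {τ : k →+* k} {m : ℕ}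
  (h : V →ₗ[k] V →ₛₗ[τ] k) (φ : V →ₛₗ[τ.comp τ] V)

include φ in
lemma form_symm_of_fixed (hφ : ∀ e v, h (φ e) v = τ (h v e)) {x : V} (hx : φ x = x) (v : V) :
    h x v = τ (h v x) := by
  rw [← hφ, hx]

include φ in
lemma form_fixed_of_fixed (hφ : ∀ e v, h (φ e) v = τ (h v e)) {x y : V} (hx : φ x = x)
    (hy : φ y = y) : τ (τ (h x y)) = h x y := by
  rw [← form_symm_of_fixed h φ hφ hy, ← form_symm_of_fixed h φ hφ hx]

lemma map_smul_of_fixed {x : V} (hx : φ x = x) {c : k} (hc : τ (τ c) = c) :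
    φ (c • x) = c • x := by
  rw [map_smulₛₗ, hx, RingHom.comp_apply, hc]

variable [IsAlgClosed k]

lemma exists_fixed_scalar (hm : 2 ≤ m) (hτ : ∀ x, τ x = x ^ m) :
    ∃ μ : k, τ (τ μ) = μ ∧ τ μ + μ = 1 := by
  have hdeg : (Polynomial.X ^ m + (Polynomial.X - Polynomial.C (1 : k))).degree =
      (m : WithBot ℕ) := by
    rw [Polynomial.degree_add_eq_left_of_degree_lt, Polynomial.degree_X_pow]
    rw [Polynomial.degree_X_pow, Polynomial.degree_X_sub_C]
    exact_mod_cast hm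
  obtain ⟨μ, hμ⟩ := IsAlgClosed.exists_root _ (show Polynomial.degree _ ≠ 0 by
    rw [hdeg]
    exact_mod_cast (by lia : m ≠ 0))
  have h1 : τ μ + μ = 1 := by
    rw [hτ]
    simp only [Polynomial.IsRoot, Polynomial.eval_add, Polynomial.eval_sub, Polynomial.eval_pow,
      Polynomial.eval_X, Polynomial.eval_C] at hμ
    linear_combination hμ
  refine ⟨μ, ?_, h1⟩
  have h2 := congrArg τ h1
  rw [map_add, map_one] at h2
  linear_combination h2 - h1

/-- If every fixed vector orthogonal to the fixed vectors `v` is isotropic, then any two such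
vectors are orthogonal. -/
lemma form_eq_zero_of_isotropic (hm : 2 ≤ m) (hτ : ∀ x, τ x = x ^ m)
    (hφ : ∀ e v, h (φ e) v = τ (h v e)) {ι : Type*} (v : ι → V)
    (hiso : ∀ x, φ x = x → (∀ i, h x (v i) = 0) → h x x = 0) {x y : V} (hx : φ x = x)
    (hxv : ∀ i, h x (v i) = 0) (hy : φ y = y) (hyv : ∀ i, h y (v i) = 0) : h x y = 0 := by
  obtain ⟨μ, hμ, hμ1⟩ := exists_fixed_scalar hm hτ
  have hb := form_fixed_of_fixed h φ hφ hx hy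
  have hyx := form_symm_of_fixed h φ hφ hy x
  have hc : τ (τ (μ * h x y)) = μ * h x y := by rw [map_mul, map_mul, hμ, hb]
  have hz := hiso (x + (μ * h x y) • y) (by rw [map_add, hx, map_smul_of_fixed φ hy hc])
    (fun i => by simp [hxv, hyv])
  simp only [map_add, map_smul, map_smulₛₗ, LinearMap.add_apply, LinearMap.smul_apply,
    hiso x hx hxv, hiso y hy hyv, hyx, smul_eq_mul, map_mul] at hz
  have h1 : τ (h x y) * h x y = 0 := by linear_combination hz - τ (h x y) * h x y * hμ1
  rcases mul_eq_zero.1 h1 with h2 | h2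
  · exact (map_eq_zero τ).1 h2
  · exact h2

lemma exists_normalizing_scalar (hτ : ∀ x, τ x = x ^ m) {b : k} (hb : b ≠ 0) (hτb : τ b = b) :
    ∃ c, τ (τ c) = c ∧ c * τ c * b = 1 := by
  obtain ⟨c, hc⟩ := IsAlgClosed.exists_pow_nat_eq b⁻¹ (Nat.succ_pos m)
  have h1 : c * τ c = b⁻¹ := by rw [hτ, ← pow_succ', ← hc]
  have hc0 : τ c ≠ 0 := fun h0 => inv_ne_zero hb (by rw [← h1, h0, mul_zero])
  refine ⟨c, ?_, by rw [h1, inv_mul_cancel₀ hb]⟩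
  have h2 := congrArg τ h1
  rw [map_inv₀, hτb, map_mul, ← h1, mul_comm c] at h2
  exact mul_left_cancel₀ hc0 h2

lemma exists_orthonormal (hm : 2 ≤ m) (hτ : ∀ x, τ x = x ^ m)
    (hφ : ∀ e v, h (φ e) v = τ (h v e)) (hspan : Submodule.span k {v | φ v = v} = ⊤)
    (hnd : ∀ x, (∀ y, h x y = 0) → x = 0) (n : ℕ) (hn : n ≤ Module.finrank k V) :
    ∃ v : Fin n → V, (∀ i, φ (v i) = v i) ∧ ∀ i j, h (v i) (v j) = if i = j then 1 else 0 := by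
  induction n with
  | zero => exact ⟨Fin.elim0, fun i => i.elim0, fun i => i.elim0⟩
  | succ n ih =>
    obtain ⟨v, hv, hvv⟩ := ih (by lia)
    obtain ⟨x, hx, hxv, hxx⟩ : ∃ x, φ x = x ∧ (∀ i, h x (v i) = 0) ∧ h x x ≠ 0 := by
      by_contra! hiso
      let U : Set V := {x | φ x = x ∧ ∀ i, h x (v i) = 0}
      have hsup : Submodule.span k U ⊔ Submodule.span k (Set.range v) = ⊤ := by
        rw [eq_top_iff, ← hspan]
        refine Submodule.span_le.2 fun x hx => ?_
        have hx' : φ x = x := hx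
        rw [← sub_add_cancel x (∑ i, h x (v i) • v i)]
        refine Submodule.add_mem_sup (Submodule.subset_span ⟨?_, fun j => ?_⟩)
          (Submodule.sum_mem _ fun i _ => Submodule.smul_mem _ _
            (Submodule.subset_span ⟨i, rfl⟩))
        · rw [map_sub, map_sum, hx']
          congr 1
          exact Finset.sum_congr rfl fun i _ =>
            map_smul_of_fixed φ (hv i) (form_fixed_of_fixed h φ hφ hx' (hv i))
        · simp [LinearMap.sum_apply, hvv]
      have hU : ∃ x ∈ U, x ≠ 0 := by
        by_contra! hU
        rw [Submodule.span_eq_bot.2 hU, bot_sup_eq] at hsup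
        have := finrank_range_le_card (R := k) v
        rw [Set.finrank, hsup, finrank_top, Fintype.card_fin] at this
        lia
      obtain ⟨x, hx, hx0⟩ := hU
      refine hx0 (hnd x fun y => ?_)
      have hker : Submodule.span k U ⊔ Submodule.span k (Set.range v) ≤ LinearMap.ker (h x) := by
        refine sup_le (Submodule.span_le.2 fun y hy => ?_) (Submodule.span_le.2 ?_)
        · exact form_eq_zero_of_isotropic h φ hm hτ hφ v hiso hx.1 hx.2 hy.1 hy.2
        · rintro _ ⟨i, rfl⟩
          exact hx.2 i
      rw [hsup] at hker
      exact hker (Submodule.mem_top (x := y))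
    obtain ⟨c, hc, hc1⟩ := exists_normalizing_scalar hτ hxx
      (form_symm_of_fixed h φ hφ hx x).symm
    have hvx : ∀ i, h (v i) x = 0 := fun i => by
      rw [form_symm_of_fixed h φ hφ (hv i), hxv, map_zero]
    refine ⟨Fin.cons (c • x) v, Fin.cases ?_ fun i => ?_, Fin.cases (Fin.cases ?_ fun j => ?_)
      fun i => Fin.cases ?_ fun j => ?_⟩
    · exact map_smul_of_fixed φ hx hc
    · exact hv i
    · simp only [Fin.cons_zero, map_smul, map_smulₛₗ, LinearMap.smul_apply, smul_eq_mul, if_true]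
      linear_combination hc1
    · simp [hxv, (Fin.succ_ne_zero j).symm]
    · simp [hvx]
    · simp [hvv]

end Orthonormal

section Hyperbolic

variable {k V : Type*} [Field k] [IsAlgClosed k] [AddCommGroup V] [Module k V] {τ : k →+* k}
  {m : ℕ}

lemma exists_hyperbolic_scalars (hm : 2 ≤ m) (hτ : ∀ x, τ x = x ^ m) :
    ∃ a b c e : k, a * τ a + b * τ b = 0 ∧ c * τ c + e * τ e = 0 ∧ a * τ c + b * τ e = 1 ∧
      c * τ a + e * τ b = 1 := by
  have : Infinite k := IsAlgClosed.instInfinite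
  obtain ⟨s, hs0, hs⟩ : ∃ s : k, s ≠ 0 ∧ s * τ s + τ s + s = 0 := by
    have hdeg : (Polynomial.X ^ m + (Polynomial.X ^ (m - 1) + Polynomial.C (1 : k))).degree =
        (m : WithBot ℕ) := by
      rw [Polynomial.degree_add_eq_left_of_degree_lt, Polynomial.degree_X_pow]
      rw [Polynomial.degree_X_pow, Polynomial.degree_X_pow_add_C (by lia)]
      exact_mod_cast (by lia : m - 1 < m)
    obtain ⟨s, hs⟩ := IsAlgClosed.exists_root _ (show Polynomial.degree _ ≠ 0 by
      rw [hdeg]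
      exact_mod_cast (by lia : m ≠ 0))
    simp only [Polynomial.IsRoot, Polynomial.eval_add, Polynomial.eval_pow, Polynomial.eval_X,
      Polynomial.eval_C] at hs
    have hs0 : s ≠ 0 := fun h0 => by
      rw [h0, zero_pow (by lia), zero_pow (by lia)] at hs
      simp at hs
    have h1 : s ^ m = s * s ^ (m - 1) := by rw [← pow_succ', Nat.sub_add_cancel (by lia)]
    refine ⟨s, hs0, ?_⟩
    rw [hτ]
    linear_combination s * hs + h1
  obtain ⟨ε, hε⟩ := IsAlgClosed.exists_pow_nat_eq (-1 : k) (Nat.succ_pos m)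
  have hε' : ε * τ ε = -1 := by rw [hτ, ← pow_succ', ← hε]
  set ζ := 1 + s with hζ
  have hζ1 : ζ * τ ζ = 1 := by
    rw [hζ, map_add, map_one]
    linear_combination hs
  have hζ0 : 1 - ζ ≠ 0 := by simpa [hζ] using hs0
  have hτζ0 : 1 - τ ζ ≠ 0 := by
    rw [← map_one τ, ← map_sub]
    exact (map_ne_zero τ).2 hζ0
  have hc0 : τ (1 - τ ζ)⁻¹ * (1 - ζ) ≠ 0 :=
    mul_ne_zero ((map_ne_zero τ).2 (inv_ne_zero hτζ0)) hζ0
  obtain ⟨γ, hγ⟩ := IsAlgClosed.exists_pow_nat_eq (τ (1 - τ ζ)⁻¹ * (1 - ζ))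
    (show 0 < m * m - 1 from Nat.sub_pos_of_lt (by nlinarith))
  have hγ0 : γ ≠ 0 := fun h0 => by
    rw [h0, zero_pow (Nat.sub_pos_of_lt (by nlinarith)).ne'] at hγ
    exact hc0 hγ.symm
  have hτγ0 : τ γ ≠ 0 := (map_ne_zero τ).2 hγ0
  have hττγ : τ (τ γ) = γ * (τ (1 - τ ζ)⁻¹ * (1 - ζ)) := by
    rw [hτ, hτ, ← pow_mul, ← hγ, ← pow_succ', Nat.sub_add_cancel (by nlinarith)]
  have hττγ0 : τ (τ γ) ≠ 0 := (map_ne_zero τ).2 hτγ0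
  refine ⟨(1 - τ ζ)⁻¹ / τ γ, (1 - τ ζ)⁻¹ / τ γ * ε, γ, γ * (ε * ζ), ?_, ?_, ?_, ?_⟩
  · simp only [map_mul]
    linear_combination (1 - τ ζ)⁻¹ / τ γ * τ ((1 - τ ζ)⁻¹ / τ γ) * hε'
  · simp only [map_mul]
    linear_combination γ * τ γ * (ε * τ ε * hζ1 + hε')
  · simp only [map_mul]
    have : (1 - τ ζ)⁻¹ / τ γ * τ γ * (1 - τ ζ) = 1 := by field_simp
    linear_combination this + (1 - τ ζ)⁻¹ / τ γ * τ γ * τ ζ * hε'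
  · rw [map_mul, map_div₀]
    have : γ * (τ (1 - τ ζ)⁻¹ / τ (τ γ)) * (1 - ζ) = 1 := by
      rw [mul_div_assoc', div_mul_eq_mul_div, div_eq_one_iff_eq hττγ0, hττγ]
      ring
    linear_combination this + γ * (τ (1 - τ ζ)⁻¹ / τ (τ γ)) * ζ * hε'

lemma exists_hyperbolic_basis (hm : 2 ≤ m) (hτ : ∀ x, τ x = x ^ m) (h : V →ₗ[k] V →ₛₗ[τ] k)
    (v : Fin 4 → V) (hv : ∀ i j, h (v i) (v j) = if i = j then 1 else 0) :
    ∃ w : Fin 4 → V, ∀ i j, h (w i) (w j) = if j = i.rev then 1 else 0 := by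
  obtain ⟨a, b, c, e, h1, h2, h3, h4⟩ := exists_hyperbolic_scalars hm hτ
  refine ⟨![a • v 0 + b • v 1, a • v 2 + b • v 3, c • v 2 + e • v 3, c • v 0 + e • v 1], ?_⟩
  intro i j
  fin_cases i <;> fin_cases j <;>
    simp [hv, Fin.rev, Fin.ext_iff, h1, h2, h3, h4, add_comm]

end Hyperbolic

section FrobeniusNormalForm

variable {k : Type*} [Field k] [IsAlgClosed k] {m : ℕ}

/-- Over an algebraically closed field, nondegenerate Frobenius forms in four variables are
equivalent to the Fermat form in hyperbolic coordinates. -/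
lemma exists_frobenius_normal_form (hm : 2 ≤ m)
    (hpow : ∀ s t : k, (s + t) ^ m = s ^ m + t ^ m) {M : Matrix (Fin 4) (Fin 4) k}
    (hM : IsUnit M) : ∃ A : Matrix (Fin 4) (Fin 4) k, IsUnit A ∧ ∀ v : Fin 4 → k,
      (A.mulVec v ⬝ᵥ M.mulVec fun i => A.mulVec v i ^ m) =
        v 0 ^ m * v 3 + v 0 * v 3 ^ m + v 1 ^ m * v 2 + v 1 * v 2 ^ m := by
  let τ : k →+* k :=
    { toFun := fun x => x ^ m
      map_one' := one_pow m
      map_mul' := fun x y => mul_pow x y m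
      map_zero' := zero_pow (by lia)
      map_add' := hpow }
  have hτ : ∀ x, τ x = x ^ m := fun x => rfl
  let F : (Fin 4 → k) → (Fin 4 → k) := fun v i => τ (v i)
  have hFadd : ∀ x y, F (x + y) = F x + F y := fun x y => funext fun i => map_add τ _ _
  have hFsmul : ∀ (c : k) x, F (c • x) = τ c • F x := fun c x => funext fun i => map_mul τ _ _
  let h : (Fin 4 → k) →ₗ[k] (Fin 4 → k) →ₛₗ[τ] k :=
    LinearMap.mk₂'ₛₗ (RingHom.id k) τ (fun u v => u ⬝ᵥ M.mulVec (F v))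
      (fun x y z => add_dotProduct _ _ _) (fun c x y => smul_dotProduct _ _ _)
      (fun x y z => by rw [hFadd, Matrix.mulVec_add, dotProduct_add])
      (fun c x y => by rw [hFsmul, Matrix.mulVec_smul, dotProduct_smul])
  have hh : ∀ u v, h u v = u ⬝ᵥ M.mulVec (F v) := fun u v => rfl
  have hMT : IsUnit M.transpose := (Matrix.isUnit_transpose M).2 hM
  have hMT' : M.transpose * M.transpose⁻¹ = 1 :=
    Matrix.mul_nonsing_inv _ ((Matrix.isUnit_iff_isUnit_det _).1 hMT)
  let φ : (Fin 4 → k) →ₛₗ[τ.comp τ] (Fin 4 → k) :=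
    { toFun := fun e => M.transpose⁻¹.mulVec (F (M.mulVec (F e)))
      map_add' := fun x y => by rw [hFadd, Matrix.mulVec_add, hFadd, Matrix.mulVec_add]
      map_smul' := fun c x => by
        rw [hFsmul, Matrix.mulVec_smul, hFsmul, Matrix.mulVec_smul]
        rfl }
  have hφ : ∀ e v, h (φ e) v = τ (h v e) := fun e v => by
    rw [hh, hh, Matrix.dotProduct_mulVec, ← Matrix.mulVec_transpose]
    change M.transpose.mulVec (M.transpose⁻¹.mulVec (F (M.mulVec (F e)))) ⬝ᵥ F v = _
    rw [Matrix.mulVec_mulVec, hMT', Matrix.one_mulVec, dotProduct_comm]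
    simp only [dotProduct, map_sum, map_mul, F]
  have hF0 : ∀ x, F x = 0 → x = 0 := fun x hx =>
    funext fun i => (map_eq_zero τ).1 (congrFun hx i)
  have hMinj : ∀ x, M.mulVec x = 0 → x = 0 := fun x hx =>
    (Matrix.mulVec_injective_iff_isUnit.2 hM) (hx.trans (Matrix.mulVec_zero M).symm)
  have hφ0 : ∀ x, φ x = 0 → x = 0 := fun x hx => by
    have h1 : M.transpose.mulVec (φ x) = 0 := by rw [hx, Matrix.mulVec_zero]
    change M.transpose.mulVec (M.transpose⁻¹.mulVec (F (M.mulVec (F x)))) = 0 at h1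
    rw [Matrix.mulVec_mulVec, hMT', Matrix.one_mulVec] at h1
    exact hF0 x (hMinj _ (hF0 _ h1))
  have hnd : ∀ x, (∀ y, h x y = 0) → x = 0 := fun x hx => by
    refine Matrix.vecMul_injective_iff_isUnit.2 hM (Eq.trans ?_ (Matrix.zero_vecMul M).symm)
    refine dotProduct_eq_zero _ fun y => ?_
    have hroot : ∀ i, ∃ z : k, z ^ m = y i := fun i =>
      IsAlgClosed.exists_pow_nat_eq (y i) (by lia)
    choose z hz using hroot
    rw [← Matrix.dotProduct_mulVec, ← show F z = y from funext hz]
    exact hx z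
  have hspan := span_fixed_eq_top (show 2 ≤ m * m by nlinarith)
    (fun x => show τ (τ x) = x ^ (m * m) by rw [hτ, hτ, pow_mul]) φ hφ0
  obtain ⟨e, -, he⟩ := exists_orthonormal h φ hm hτ hφ hspan hnd 4 (by simp)
  obtain ⟨w, hw⟩ := exists_hyperbolic_basis hm hτ h e he
  have hA : ∀ v, (Matrix.of fun i j => w j i).mulVec v = ∑ j, v j • w j := fun v => by
    ext i
    simp [Matrix.mulVec, dotProduct, Finset.sum_apply, mul_comm]
  have hleft : ∀ (v : Fin 4 → k) j, h (∑ j, v j • w j) (w j) = v j.rev := fun v j => by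
    simp only [map_sum, map_smul, LinearMap.sum_apply, LinearMap.smul_apply, hw, smul_eq_mul]
    simp [eq_comm (a := j), Fin.rev_eq_iff]
  refine ⟨Matrix.of fun i j => w j i, ?_, fun v => ?_⟩
  · refine Matrix.mulVec_injective_iff_isUnit.1 ((injective_iff_map_eq_zero
      (Matrix.mulVecLin _)).2 fun v hv => funext fun j => ?_)
    have h1 := hleft v j.rev
    rw [← hA, show (Matrix.of fun i j => w j i).mulVec v = 0 from hv] at h1
    simpa using h1.symm
  · change h _ _ = _
    rw [hA]
    nth_rewrite 2 [Fin.sum_univ_four]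
    simp only [map_add, map_smulₛₗ, hleft, smul_eq_mul, hτ]
    simp [Fin.rev]
    ring

end FrobeniusNormalForm

theorem max_lines_gives_fermat_normal_form {k : Type*} [Field k] [IsAlgClosed k]
    (d : ℕ) (hd : 3 < d)
    (f : MvPolynomial (Fin 4) k) (hf : IsSmoothSurface f d)
    (hcount : {W : Submodule k (Fin 4 → k) | IsLineOn f W}.ncard =
      d ^ 2 * (d ^ 2 - 3 * d + 3)) :
    ∃ (A : Matrix (Fin 4) (Fin 4) k) (c : k), IsUnit A ∧ c ≠ 0 ∧
      ∀ v : Fin 4 → k,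
        c * MvPolynomial.eval (A.mulVec v) f =
          v 0 ^ (d - 1) * v 3 + v 0 * v 3 ^ (d - 1) +
          v 1 ^ (d - 1) * v 2 + v 1 * v 2 ^ (d - 1) := by
  have hfin : {W : Submodule k (Fin 4 → k) | IsLineOn f W}.Finite := by
    refine Set.finite_of_ncard_ne_zero ?_
    rw [hcount]
    positivity
  obtain ⟨L, hL⟩ : {W : Submodule k (Fin 4 → k) | IsLineOn f W}.Nonempty := by
    rw [Set.nonempty_iff_ne_empty]
    intro h0
    rw [h0, Set.ncard_empty] at hcount
    exact absurd hcount (by positivity)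
  have hcoeff := linePoly_coeff_eq_zero_of_card hd hf (hf.irreducible hL) hfin.toFinset
    (fun W => by simp) (by rw [← Set.ncard_eq_toFinset_card _ hfin, hcount])
  obtain ⟨p, hp, u, -, hind, -⟩ := exists_basis_of_finrank_eq_two hL.1
  have hp0 : p ≠ 0 := fun h0 => one_ne_zero (hind 1 0 (by simp [h0])).1
  obtain ⟨hpow, M, hM, hfM⟩ := exists_frobenius_form hf hd hcoeff ⟨p, hp0, hL.2 p hp⟩
  obtain ⟨A, hA, hAM⟩ := exists_frobenius_normal_form (by lia) hpow hM
  exact ⟨A, 1, hA, one_ne_zero, fun v => by rw [one_mul, hfM, hAM]⟩
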